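/- arXiv:1402.4780 — 6 statements merged into one kernel-verified Lean document; each statement's English description precedes it below -/
import Mathlib

section
/- Let A_f(x) = Σ_{n : λ_n ≤ x} a_n be the summatory function of the coefficients. Then there exist real polynomials p_1, …, p_k and a constant C > 0 such that for all x ≥ 2, | A_f(x) − a·x − Σ_{j=1}^k x^{ρ_j}·p_j(log x) | ≤ C·x^{1−1/(2r)}·log x, where a is the residue of f at s = 1 and ρ_1, …, ρ_k ∈ (0,1) are the other poles of f. -/
open Filter Complex


lemma contour_shift (g : ℂ → ℂ) (hg : DifferentiableOn ℂ g {s | 0 < s.re}) (s1 s2 M : ℝ)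
    (h1 : 0 < s1) (h12 : s1 ≤ s2)
    (hb : ∀ σ t : ℝ, s1 ≤ σ → σ ≤ s2 → ‖g (σ + t * I)‖ ≤ M * (1 + t ^ 2)⁻¹) :
    MeasureTheory.Integrable (fun t : ℝ => g (s2 + t * I)) ∧
    ∫ t : ℝ, g (s1 + t * I) = ∫ t : ℝ, g (s2 + t * I) := by
  have hint : ∀ σ, s1 ≤ σ → σ ≤ s2 → MeasureTheory.Integrable (fun t : ℝ => g (σ + t * I)) := by
    intro σ ha hb'
    refine (integrable_inv_one_add_sq.const_mul M).mono' ?_ (.of_forall fun t => hb σ t ha hb')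
    refine Continuous.aestronglyMeasurable ?_
    refine hg.continuousOn.comp_continuous (by fun_prop) (fun t => ?_)
    simp; linarith
  refine ⟨hint s2 h12 le_rfl, ?_⟩
  have hT : Tendsto (fun T : ℝ => T) atTop atTop := tendsto_id
  have hN : Tendsto (fun T : ℝ => -T) atTop atBot := tendsto_neg_atTop_atBot
  have l1 := MeasureTheory.intervalIntegral_tendsto_integral (hint s1 le_rfl h12) hN hT
  have l2 := MeasureTheory.intervalIntegral_tendsto_integral (hint s2 h12 le_rfl) hN hT
  have hz : Tendsto (fun T : ℝ => |M| * (1 + T ^ 2)⁻¹ * |s2 - s1|) atTop (nhds 0) := by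
    have : Tendsto (fun T : ℝ => (1 + T ^ 2)⁻¹) atTop (nhds 0) := by
      apply Tendsto.inv_tendsto_atTop
      exact tendsto_atTop_add_const_left _ _ (tendsto_pow_atTop two_ne_zero)
    simpa using (this.const_mul |M|).mul_const |s2 - s1|
  have hh : ∀ T : ℝ, ‖∫ x in s1..s2, g (x + T * I)‖ ≤ |M| * (1 + T ^ 2)⁻¹ * |s2 - s1| := by
    intro T
    apply intervalIntegral.norm_integral_le_of_norm_le_const
    intro x hx
    rw [Set.uIoc_of_le h12] at hx
    refine (hb x T hx.1.le hx.2).trans ?_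
    gcongr
    exact le_abs_self M
  have k1 : Tendsto (fun T : ℝ => ∫ x in s1..s2, g (x + T * I)) atTop (nhds 0) :=
    squeeze_zero_norm hh hz
  have k2 : Tendsto (fun T : ℝ => ∫ x in s1..s2, g (x + (-T : ℝ) * I)) atTop (nhds 0) :=
    squeeze_zero_norm (fun T => by simpa using hh (-T)) hz
  have key : ∀ T : ℝ, (∫ x in s1..s2, g (x + (-T : ℝ) * I)) - (∫ x in s1..s2, g (x + T * I)) +
      I • (∫ y in (-T)..T, g (s2 + y * I)) - I • (∫ y in (-T)..T, g (s1 + y * I)) = 0 := by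
    intro T
    have := integral_boundary_rect_eq_zero_of_differentiableOn g (⟨s1, -T⟩ : ℂ) (⟨s2, T⟩ : ℂ) ?_
    · simpa using this
    · apply hg.mono
      intro z hz
      have := hz.1
      simp only [Set.mem_preimage, Set.uIcc_of_le h12] at this
      exact lt_of_lt_of_le h1 this.1
  have lim := ((k2.sub k1).add (l2.const_smul I)).sub (l1.const_smul I)
  have lim0 := tendsto_nhds_unique (tendsto_const_nhds.congr (fun T => (key T).symm)) lim
  simp only [sub_self, zero_add, smul_eq_mul] at lim0
  exact (mul_left_cancel₀ I_ne_zero (sub_eq_zero.1 lim0.symm)).symm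

noncomputable def qq (z : ℂ) : ℂ := (exp z - 1) / z

lemma qq_int (z : ℂ) (hz : z ≠ 0) : ∫ v in Set.Icc (0:ℝ) 1, exp (z * v) = qq z := by
  rw [MeasureTheory.integral_Icc_eq_integral_Ioc, ← intervalIntegral.integral_of_le zero_le_one,
    integral_exp_mul_complex hz]
  simp [qq]

lemma qq_bound (z : ℂ) (h0 : 0 < z.re) (h1 : z.re ≤ 5/4) : ‖qq z‖ ≤ 9 / (1 + |z.im|) := by
  have hz : z ≠ 0 := by rintro rfl; simp at h0
  have he : Real.exp z.re ≤ 4 := by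
    calc Real.exp z.re ≤ Real.exp (5/4) := Real.exp_le_exp.2 h1
      _ ≤ 4 := by
        have h := Real.exp_one_lt_d9
        have : Real.exp (5/4) ^ 4 = Real.exp 1 ^ 5 := by
          rw [← Real.exp_nat_mul, ← Real.exp_nat_mul]; norm_num
        have h5 : Real.exp 1 ^ 5 ≤ 2.7182818286 ^ 5 := by gcongr
        by_contra! hc
        have : (4:ℝ)^4 < Real.exp (5/4) ^ 4 := by gcongr
        norm_num at *
        linarith
  have b1 : ‖qq z‖ ≤ 4 := by
    rw [← qq_int z hz]
    refine (MeasureTheory.norm_setIntegral_le_of_norm_le_const (C := 4) (by simp) ?_).trans ?_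
    · intro v hv
      rw [norm_exp]
      refine le_trans (Real.exp_le_exp.2 ?_) he
      simp
      nlinarith [hv.1, hv.2]
    · simp
  have b2 : |z.im| * ‖qq z‖ ≤ 5 := by
    calc |z.im| * ‖qq z‖ ≤ ‖z‖ * ‖qq z‖ := by gcongr; exact abs_im_le_norm z
      _ = ‖exp z - 1‖ := by rw [qq, norm_div]; field_simp
      _ ≤ ‖exp z‖ + ‖(1:ℂ)‖ := norm_sub_le _ _
      _ ≤ 5 := by rw [norm_exp]; simp; linarith
  rw [le_div_iff₀ (by positivity)]
  linarith

open MeasureTheory in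
noncomputable def WW (k : ℕ) : Measure (Fin k → ℝ) :=
  Measure.pi fun _ => (volume.restrict (Set.Icc (0:ℝ) 1))

instance WW_prob (k : ℕ) : MeasureTheory.IsProbabilityMeasure (WW k) := by
  have : MeasureTheory.IsProbabilityMeasure (MeasureTheory.volume.restrict (Set.Icc (0:ℝ) 1)) :=
    ⟨by simp⟩
  unfold WW
  infer_instance

lemma WW_restrict (k : ℕ) : WW k =
    MeasureTheory.volume.restrict (Set.univ.pi fun _ : Fin k => Set.Icc (0:ℝ) 1) := by
  rw [WW, ← MeasureTheory.Measure.restrict_pi_pi]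
  rfl

lemma WW_ae (k : ℕ) : ∀ᵐ v ∂(WW k), 0 ≤ ∑ i, v i ∧ ∑ i, v i ≤ (k:ℝ) := by
  rw [WW_restrict]
  refine (MeasureTheory.ae_restrict_iff' (MeasurableSet.univ_pi fun _ => measurableSet_Icc)).2
    (.of_forall fun v hv => ?_)
  have hv' : ∀ i, v i ∈ Set.Icc (0:ℝ) 1 := fun i => hv i (Set.mem_univ i)
  refine ⟨Finset.sum_nonneg fun i _ => (hv' i).1, ?_⟩
  calc ∑ i, v i ≤ ∑ i : Fin k, (1:ℝ) := Finset.sum_le_sum fun i _ => (hv' i).2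
    _ = k := by simp

lemma WW_null (k : ℕ) (hk : 0 < k) (D : Set ℝ) (hD : D.Countable) (u δ : ℝ) (hδ : δ ≠ 0) :
    ∀ᵐ v ∂(WW k), u + δ * ∑ i, v i ∉ D := by
  rw [WW_restrict]
  apply MeasureTheory.ae_restrict_of_ae
  let L : (Fin k → ℝ) →ₗ[ℝ] ℝ := ∑ i, LinearMap.proj i
  have hL : ∀ v, L v = ∑ i, v i := by intro v; simp [L]
  have hs : Function.Surjective L := by
    intro y
    refine ⟨Pi.single ⟨0, hk⟩ y, ?_⟩
    rw [hL]; simp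
  have hD' : ((fun y => u + δ * y) ⁻¹' D).Countable := by
    apply hD.preimage
    intro x y h
    simpa [hδ] using h
  have := (MeasureTheory.ae_comp_linearMap_mem_iff L MeasureTheory.volume MeasureTheory.volume hs
    hD'.measurableSet.compl).2 (hD'.ae_notMem _)
  filter_upwards [this] with v hv
  simpa [hL] using hv

noncomputable def SM (k : ℕ) (δ : ℝ) (H : ℝ → ℂ) (u : ℝ) : ℂ :=
  ∫ v, H (u + δ * ∑ i, v i) ∂(WW k)

lemma SM_cont (k : ℕ) (hk : 0 < k) (δ : ℝ) (hδ : 0 < δ) (H : ℝ → ℂ) (hm : Measurable H)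
    (hb : ∀ X : ℝ, ∃ M, ∀ u, |u| ≤ X → ‖H u‖ ≤ M)
    (hc : {u | ¬ ContinuousAt H u}.Countable) : Continuous (SM k δ H) := by
  rw [continuous_iff_continuousAt]
  intro u₀
  obtain ⟨M, hM⟩ := hb (|u₀| + 1 + δ * k)
  refine MeasureTheory.continuousAt_of_dominated (bound := fun _ => M) ?_ ?_ ?_ ?_
  · exact .of_forall fun u => (hm.comp (by fun_prop)).aestronglyMeasurable
  · filter_upwards [Metric.ball_mem_nhds u₀ one_pos] with u hu
    filter_upwards [WW_ae k] with v hv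
    apply hM
    rw [Metric.mem_ball, Real.dist_eq] at hu
    have h1 : |u| ≤ |u₀| + 1 := by
      have := abs_sub_abs_le_abs_sub u u₀; linarith
    have h2 : |δ * ∑ i, v i| ≤ δ * k := by
      rw [abs_of_nonneg (mul_nonneg hδ.le hv.1)]
      exact mul_le_mul_of_nonneg_left hv.2 hδ.le
    exact (abs_add_le _ _).trans (add_le_add h1 h2)
  · exact MeasureTheory.integrable_const _
  · filter_upwards [WW_null k hk _ hc u₀ δ hδ.ne'] with v hv
    have hv : ContinuousAt H (u₀ + δ * ∑ i, v i) := by simpa using hv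
    exact ContinuousAt.comp (f := fun u => u + δ * ∑ i, v i) hv (by fun_prop)

lemma SM_laplace (k : ℕ) (δ : ℝ) (hδ : 0 < δ) (H : ℝ → ℂ) (hm : Measurable H) (s : ℂ)
    (hs : s ≠ 0)
    (hi : MeasureTheory.Integrable (fun u : ℝ => exp (-s * u) * H u)) :
    MeasureTheory.Integrable (fun u : ℝ => exp (-s * u) * SM k δ H u) ∧
    ∫ u : ℝ, exp (-s * u) * SM k δ H u = qq (δ * s) ^ k * ∫ u : ℝ, exp (-s * u) * H u := by
  have e1 : ∀ w u : ℝ, exp (-s * u) * H (u + w) =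
      exp (s * w) * (exp (-s * (u + w : ℝ)) * H (u + w)) := by
    intro w u
    rw [← mul_assoc, ← exp_add]; congr 2; push_cast; ring
  have i1 : ∀ w : ℝ, MeasureTheory.Integrable (fun u : ℝ => exp (-s * u) * H (u + w)) := by
    intro w
    simp_rw [e1 w]
    exact (hi.comp_add_right w).const_mul _
  have i2 : ∀ w : ℝ, ∫ u : ℝ, exp (-s * u) * H (u + w) =
      exp (s * w) * ∫ u : ℝ, exp (-s * u) * H u := by
    intro w
    simp_rw [e1 w]
    rw [MeasureTheory.integral_const_mul,
      MeasureTheory.integral_add_right_eq_self (fun u : ℝ => exp (-s * u) * H u) w]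
  have i3 : ∀ w : ℝ, ∫ u : ℝ, ‖exp (-s * u) * H (u + w)‖ =
      ‖exp (s * w)‖ * ∫ u : ℝ, ‖exp (-s * u) * H u‖ := by
    intro w
    simp_rw [e1 w, norm_mul (exp (s * w))]
    rw [MeasureTheory.integral_const_mul,
      MeasureTheory.integral_add_right_eq_self (fun u : ℝ => ‖exp (-s * u) * H u‖) w]
  have hI : MeasureTheory.Integrable (fun p : ℝ × (Fin k → ℝ) =>
      exp (-s * p.1) * H (p.1 + δ * ∑ i, p.2 i)) (MeasureTheory.volume.prod (WW k)) := by
    rw [MeasureTheory.integrable_prod_iff']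
    · refine ⟨.of_forall fun v => i1 (δ * ∑ i, v i), ?_⟩
      simp_rw [i3]
      apply MeasureTheory.Integrable.mul_const
      refine MeasureTheory.Integrable.mono' (MeasureTheory.integrable_const
        (Real.exp (|s.re| * (δ * k)))) ?_ ?_
      · apply Continuous.aestronglyMeasurable; fun_prop
      · filter_upwards [WW_ae k] with v hv
        rw [norm_norm, norm_exp]
        apply Real.exp_le_exp.2
        rw [re_mul_ofReal]
        refine (mul_le_mul_of_nonneg_right (le_abs_self _) (mul_nonneg hδ.le hv.1)).trans ?_
        have := mul_le_mul_of_nonneg_left hv.2 hδ.le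
        gcongr
    · apply Measurable.aestronglyMeasurable
      apply Measurable.mul
      · fun_prop
      · exact hm.comp (by fun_prop)
  have hsm : ∀ u : ℝ, exp (-s * u) * SM k δ H u =
      ∫ v, exp (-s * u) * H (u + δ * ∑ i, v i) ∂(WW k) := by
    intro u; rw [SM, MeasureTheory.integral_const_mul]
  simp_rw [hsm]
  refine ⟨hI.integral_prod_left, ?_⟩
  rw [MeasureTheory.integral_integral_swap hI]
  simp_rw [i2]
  rw [MeasureTheory.integral_mul_const]
  congr 1
  rw [← qq_int _ (mul_ne_zero (ofReal_ne_zero.2 hδ.ne') hs)]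
  have := MeasureTheory.integral_fintype_prod_eq_pow (ι := Fin k)
    (μ := MeasureTheory.volume.restrict (Set.Icc (0:ℝ) 1)) (fun v : ℝ => exp (δ * s * v))
  rw [Fintype.card_fin] at this
  rw [← this]
  apply MeasureTheory.integral_congr_ae
  refine .of_forall fun v => ?_
  simp only
  rw [← exp_sum]
  congr 1
  push_cast
  rw [← Finset.mul_sum]; ring

lemma smooth_pt (F : ℂ → ℂ) (r C : ℝ) (hr : 1 ≤ r) (hC : 0 ≤ C)
    (hFb : ∀ σ t : ℝ, 0 < σ → σ ≤ 5/4 → ‖F (σ + t * I)‖ ≤ C / σ * (1 + |t|) ^ (r - 1))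
    (k : ℕ) (hk : r + 1 ≤ k) (u δ : ℝ) (hδ : 0 < δ) (hδ1 : δ ≤ 1) (σ t : ℝ) (h0 : 0 < σ)
    (h1 : σ ≤ 5/4) :
    ‖exp (u * (σ + t * I)) * (F (σ + t * I) * qq (δ * (σ + t * I)) ^ k)‖ ≤
      Real.exp (u * σ) * (C / σ * 9 ^ k * δ ^ (-(r - 1))) * (1 + (δ * t) ^ 2)⁻¹ := by
  have hq : ‖qq (δ * (σ + t * I))‖ ≤ 9 / (1 + δ * |t|) := by
    have := qq_bound (δ * (σ + t * I)) (by simp; positivity) (by simp; nlinarith)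
    simpa [abs_mul, abs_of_pos hδ] using this
  have hy : 1 ≤ 1 + δ * |t| := by have := abs_nonneg t; nlinarith
  have hy0 : 0 < 1 + δ * |t| := by linarith
  have hA : (1 + |t|) ^ (r - 1) ≤ δ ^ (-(r-1)) * (1 + δ * |t|) ^ (r - 1) := by
    rw [Real.rpow_neg hδ.le, ← Real.inv_rpow hδ.le, ← Real.mul_rpow (by positivity) hy0.le]
    apply Real.rpow_le_rpow (by positivity) _ (by linarith)
    rw [inv_mul_eq_div, le_div_iff₀ hδ]
    have := abs_nonneg t; nlinarith
  have hB : (1 + δ * |t|) ^ (r - 1) * (1 / (1 + δ * |t|)) ^ k ≤ (1 + (δ * t) ^ 2)⁻¹ := by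
    rw [one_div, inv_pow, ← Real.rpow_natCast, ← Real.rpow_neg hy0.le, ← Real.rpow_add hy0]
    calc (1 + δ * |t|) ^ (r - 1 + -(k:ℝ)) ≤ (1 + δ * |t|) ^ (-2 : ℝ) :=
          Real.rpow_le_rpow_of_exponent_le hy (by linarith)
      _ = ((1 + δ * |t|) ^ 2)⁻¹ := by
          rw [Real.rpow_neg hy0.le]; norm_num
      _ ≤ (1 + (δ * t) ^ 2)⁻¹ := by
          apply inv_anti₀ (by positivity)
          have : (δ * t) ^ 2 = (δ * |t|) ^ 2 := by rw [mul_pow, mul_pow, sq_abs]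
          rw [this]; nlinarith [mul_nonneg hδ.le (abs_nonneg t)]
  rw [norm_mul, norm_mul, norm_pow, norm_exp]
  have e1 : (u * (σ + t * I) : ℂ).re = u * σ := by simp
  rw [e1, mul_assoc (Real.exp _)]
  apply mul_le_mul_of_nonneg_left _ (Real.exp_pos _).le
  calc ‖F (σ + t * I)‖ * ‖qq (δ * (σ + t * I))‖ ^ k
      ≤ (C / σ * (δ ^ (-(r-1)) * (1 + δ * |t|) ^ (r - 1))) * (9 / (1 + δ * |t|)) ^ k := by
        gcongr
        exact (hFb σ t h0 h1).trans (by gcongr)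
    _ = C / σ * 9 ^ k * δ ^ (-(r-1)) * ((1 + δ * |t|) ^ (r - 1) * (1 / (1 + δ * |t|)) ^ k) := by
        rw [div_pow, div_pow]; ring
    _ ≤ _ := by gcongr

lemma smooth_bound (E : ℝ → ℂ) (hm : Measurable E)
    (hb : ∀ X : ℝ, ∃ M, ∀ u, |u| ≤ X → ‖E u‖ ≤ M)
    (hc : {u | ¬ ContinuousAt E u}.Countable)
    (F : ℂ → ℂ) (hF : DifferentiableOn ℂ F {s | 0 < s.re}) (r C : ℝ) (hr : 1 ≤ r) (hC : 0 ≤ C)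
    (hFb : ∀ σ t : ℝ, 0 < σ → σ ≤ 5/4 → ‖F (σ + t * I)‖ ≤ C / σ * (1 + |t|) ^ (r - 1))
    (hi : ∀ s : ℂ, s.re = 5/4 → MeasureTheory.Integrable (fun u : ℝ => exp (-s * u) * E u))
    (hL : ∀ s : ℂ, s.re = 5/4 → ∫ u : ℝ, exp (-s * u) * E u = F s)
    (k : ℕ) (hk : r + 1 ≤ k) (u δ : ℝ) (hu : 1 ≤ u) (hδ : 0 < δ) (hδ1 : δ ≤ 1) :
    ‖SM k δ E u‖ ≤ (Real.exp 1 * C * 9 ^ k / 2) * u * δ ^ (-r) := by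
  have hk0 : 0 < k := by
    rcases Nat.eq_zero_or_pos k with h | h
    · subst h; norm_num at hk; linarith
    · exact h
  set g : ℂ → ℂ := fun s => exp (u * s) * (F s * qq (δ * s) ^ k) with hg
  have hpt := smooth_pt F r C hr hC hFb k hk u δ hδ hδ1
  have hgd : DifferentiableOn ℂ g {s | 0 < s.re} := by
    intro s hs
    have hs0 : s ≠ 0 := by rintro rfl; simp at hs
    have : DifferentiableAt ℂ (fun s : ℂ => qq (δ * s)) s := by
      unfold qq
      have : (δ : ℂ) * s ≠ 0 := mul_ne_zero (ofReal_ne_zero.2 hδ.ne') hs0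
      fun_prop (disch := assumption)
    have h2 : DifferentiableAt ℂ (fun s : ℂ => exp (u * s)) s := by fun_prop
    exact h2.differentiableWithinAt.mul ((hF s hs).mul (this.pow k).differentiableWithinAt)
  have hu0 : 0 < u := by linarith
  have hu1 : 1 / u ≤ 5/4 := by
    rw [div_le_iff₀ hu0]; linarith
  obtain ⟨gi, gs⟩ := contour_shift g hgd (1/u) (5/4)
    (Real.exp (u * (5/4)) * (C / (1/u) * 9 ^ k * δ ^ (-(r - 1))) * (δ ^ 2)⁻¹) (by positivity) hu1 (by
      intro σ t ha hb'
      have hσ : 0 < σ := lt_of_lt_of_le (by positivity) ha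
      refine (hpt σ t hσ hb').trans ?_
      rw [mul_assoc (_ * _)]
      gcongr
      rw [← mul_inv]
      apply inv_anti₀ (by positivity)
      nlinarith [sq_nonneg t])
  -- bound of the shifted integral
  have hbd : ‖∫ t : ℝ, g ((1/u : ℝ) + t * I)‖ ≤
      (Real.exp 1 * (C * u * 9 ^ k * δ ^ (-(r - 1)))) * (δ⁻¹ * Real.pi) := by
    have hint : ∫ t : ℝ, (1 + (δ * t) ^ 2)⁻¹ = δ⁻¹ * Real.pi := by
      rw [MeasureTheory.Measure.integral_comp_mul_left (fun x : ℝ => (1 + x ^ 2)⁻¹) δ,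
        integral_univ_inv_one_add_sq, abs_of_pos (by positivity), smul_eq_mul]
    rw [← hint, ← MeasureTheory.integral_const_mul]
    apply MeasureTheory.norm_integral_le_of_norm_le
    · exact (integrable_inv_one_add_sq.comp_mul_left' hδ.ne').const_mul _
    · refine .of_forall fun t => ?_
      have := hpt (1/u) t (by positivity) hu1
      have e : u * (1/u) = 1 := by field_simp
      have e2 : C / (1/u) = C * u := by field_simp
      rw [e, e2] at this
      exact this
  -- Fourier inversion
  set φ : ℝ → ℂ := fun v => exp (-(5/4 : ℂ) * v) * SM k δ E v with hφ
  have hφc : Continuous φ := by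
    have := SM_cont k hk0 δ hδ E hm hb hc
    fun_prop
  have h54 : ((5/4 : ℂ)).re = 5/4 := by norm_num
  have hφi : MeasureTheory.Integrable φ :=
    (SM_laplace k δ hδ E hm (5/4) (by norm_num) (hi _ h54)).1
  have hfou : ∀ ξ : ℝ, FourierTransform.fourier φ ξ =
      exp (-(u * (5/4 + (2 * Real.pi * ξ : ℝ) * I))) * g (5/4 + (2 * Real.pi * ξ : ℝ) * I) := by
    intro ξ
    have hre : (5/4 + (2 * Real.pi * ξ : ℝ) * I : ℂ).re = 5/4 := by
      rw [add_re, re_ofReal_mul, I_re, h54]; simp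
    have hne : (5/4 + (2 * Real.pi * ξ : ℝ) * I : ℂ) ≠ 0 := by
      intro h; rw [h] at hre; norm_num at hre
    rw [Real.fourier_real_eq_integral_exp_smul]
    have h3 := (SM_laplace k δ hδ E hm _ hne (hi _ hre)).2
    rw [hL _ hre] at h3
    simp only [hg]
    rw [← mul_assoc, ← exp_add, neg_add_cancel, exp_zero, one_mul, mul_comm (F _), ← h3]
    congr 1
    ext v
    simp only [hφ, smul_eq_mul]
    rw [← mul_assoc, ← exp_add]
    congr 2
    push_cast
    ring
  have hcast : ((5/4 : ℝ) : ℂ) = 5/4 := by push_cast; rfl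
  rw [hcast] at gi gs
  have hfi : MeasureTheory.Integrable (FourierTransform.fourier φ) := by
    have h1 := gi.comp_mul_left' (R := 2 * Real.pi) (by positivity)
    have h2 : MeasureTheory.Integrable (fun ξ : ℝ => exp (-(u * (5/4 + (2 * Real.pi * ξ : ℝ) * I)))
        * g (5/4 + (2 * Real.pi * ξ : ℝ) * I)) := by
      refine h1.bdd_mul (c := Real.exp (-(u * (5/4)))) ?_ (.of_forall fun ξ => ?_)
      · apply Continuous.aestronglyMeasurable; fun_prop
      · rw [norm_exp]
        apply le_of_eq
        congr 1
        rw [neg_re, re_ofReal_mul, add_re, re_ofReal_mul, I_re, h54]; simp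
    exact h2.congr (.of_forall fun ξ => (hfou ξ).symm)
  have hinv := hφi.fourierInv_fourier_eq hfi (v := u) hφc.continuousAt
  rw [Real.fourierInv_eq'] at hinv
  have hmain : φ u = exp (-(5/4 : ℂ) * u) * ((2 * Real.pi)⁻¹ • ∫ t : ℝ, g ((1/u : ℝ) + t * I)) := by
    rw [gs, ← abs_of_pos (a := (2 * Real.pi)⁻¹) (by positivity),
      ← MeasureTheory.Measure.integral_comp_mul_left (fun t : ℝ => g (5/4 + t * I)) (2 * Real.pi),
      ← hinv, ← MeasureTheory.integral_const_mul]
    congr 1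
    ext ξ
    rw [hfou, smul_eq_mul, ← mul_assoc, ← exp_add]
    congr 2
    simp
    push_cast
    ring
  have hS : SM k δ E u = (2 * Real.pi)⁻¹ • ∫ t : ℝ, g ((1/u : ℝ) + t * I) :=
    mul_left_cancel₀ (exp_ne_zero _) hmain
  rw [hS, norm_smul, Real.norm_of_nonneg (by positivity)]
  calc (2 * Real.pi)⁻¹ * ‖∫ t : ℝ, g ((1/u : ℝ) + t * I)‖ ≤ (2 * Real.pi)⁻¹ *
        ((Real.exp 1 * (C * u * 9 ^ k * δ ^ (-(r - 1)))) * (δ⁻¹ * Real.pi)) := by gcongr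
    _ = (Real.exp 1 * C * 9 ^ k / 2) * u * (δ ^ (-(r-1)) * δ⁻¹) := by
        field_simp
    _ = _ := by
        rw [← Real.rpow_neg_one, ← Real.rpow_add hδ]; congr 2; ring

lemma taub (B : ℝ → ℝ) (hB : Monotone B) (hB0 : ∀ u, 0 ≤ B u) (R : ℝ → ℂ) (hR : Continuous R)
    (CR : ℝ) (hCR : 0 ≤ CR)
    (hRl : ∀ u v, 0 ≤ u → u ≤ v → ‖R v - R u‖ ≤ CR * (v - u) * Real.exp v)
    (E : ℝ → ℂ) (hE : ∀ u, E u = B u - (if 0 ≤ u then R u else 0))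
    (F : ℂ → ℂ) (hF : DifferentiableOn ℂ F {s | 0 < s.re}) (r C : ℝ) (hr : 1 ≤ r) (hC : 0 ≤ C)
    (hFb : ∀ σ t : ℝ, 0 < σ → σ ≤ 5/4 → ‖F (σ + t * I)‖ ≤ C / σ * (1 + |t|) ^ (r - 1))
    (hi : ∀ s : ℂ, s.re = 5/4 → MeasureTheory.Integrable (fun u : ℝ => exp (-s * u) * E u))
    (hL : ∀ s : ℂ, s.re = 5/4 → ∫ u : ℝ, exp (-s * u) * E u = F s) :
    ∃ C', 0 < C' ∧ ∀ u, Real.log 2 ≤ u →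
      |B u - (R u).re| ≤ C' * Real.exp (u * (1 - 1/(2*r))) * u := by
  have hE' : E = fun u => (B u : ℂ) - (if 0 ≤ u then R u else 0) := funext hE
  have hm : Measurable E := by
    rw [hE']
    refine (measurable_ofReal.comp hB.measurable).sub ?_
    exact Measurable.ite measurableSet_Ici hR.measurable measurable_const
  have hRb : ∀ X : ℝ, ∃ M, 0 ≤ M ∧ ∀ u, |u| ≤ X → ‖R u‖ ≤ M := by
    intro X
    obtain ⟨M, hM⟩ := (isCompact_Icc (a := -X) (b := X)).exists_bound_of_continuousOn hR.continuousOn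
    exact ⟨max M 0, le_max_right _ _, fun u hu => (hM u (abs_le.1 hu)).trans (le_max_left _ _)⟩
  have hb : ∀ X : ℝ, ∃ M, ∀ u, |u| ≤ X → ‖E u‖ ≤ M := by
    intro X
    obtain ⟨M, hM0, hM⟩ := hRb X
    refine ⟨B X + M, fun u hu => ?_⟩
    rw [hE]
    refine (norm_sub_le _ _).trans (add_le_add ?_ ?_)
    · rw [norm_real, Real.norm_of_nonneg (hB0 u)]
      exact hB ((le_abs_self u).trans hu)
    · split_ifs
      · exact hM u hu
      · simpa using hM0
  have hc : {u | ¬ ContinuousAt E u}.Countable := by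
    refine (hB.countable_not_continuousAt.union (Set.countable_singleton 0)).mono ?_
    intro u hu
    by_contra hcon
    simp only [Set.mem_union, Set.mem_setOf_eq, Set.mem_singleton_iff, not_or, not_not] at hcon
    apply hu
    rw [hE']
    refine (continuous_ofReal.continuousAt.comp hcon.1).sub ?_
    rcases lt_or_gt_of_ne hcon.2 with h | h
    · refine (continuousAt_const (y := (0:ℂ))).congr ?_
      filter_upwards [gt_mem_nhds h] with v hv
      rw [if_neg (not_le.2 hv)]
    · refine hR.continuousAt.congr ?_
      filter_upwards [lt_mem_nhds h] with v hv
      rw [if_pos hv.le]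
  obtain ⟨k, hk⟩ := exists_nat_ge (r + 1)
  have hSB := smooth_bound E hm hb hc F hF r C hr hC hFb hi hL k hk
  set C1 := Real.exp 1 * C * 9 ^ k / 2 with hC1
  have hC1' : 0 ≤ C1 := by positivity
  -- sandwich
  have hEi : ∀ w δ : ℝ, 0 < δ → MeasureTheory.Integrable (fun v => E (w + δ * ∑ i, v i)) (WW k) := by
    intro w δ hδ
    obtain ⟨M, hM⟩ := hb (|w| + δ * k)
    refine MeasureTheory.Integrable.mono' (MeasureTheory.integrable_const M)
      (hm.comp (by fun_prop)).aestronglyMeasurable ?_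
    filter_upwards [WW_ae k] with v hv
    apply hM
    have h2 : |δ * ∑ i, v i| ≤ δ * k := by
      rw [abs_of_nonneg (mul_nonneg hδ.le hv.1)]
      exact mul_le_mul_of_nonneg_left hv.2 hδ.le
    exact (abs_add_le _ _).trans (add_le_add le_rfl h2)
  have hre : ∀ w δ : ℝ, 0 < δ → (SM k δ E w).re = ∫ v, (E (w + δ * ∑ i, v i)).re ∂(WW k) := by
    intro w δ hδ
    exact (reCLM.integral_comp_comm (hEi w δ hδ)).symm
  have hlow : ∀ w δ : ℝ, 0 ≤ w → 0 < δ →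
      B w - (R w).re - CR * (k * δ) * Real.exp (w + k * δ) ≤ ‖SM k δ E w‖ := by
    intro w δ hw hδ
    refine le_trans ?_ (re_le_norm _)
    rw [hre w δ hδ]
    have : ∫ _, (B w - (R w).re - CR * (k * δ) * Real.exp (w + k * δ)) ∂(WW k) =
      B w - (R w).re - CR * (k * δ) * Real.exp (w + k * δ) := by simp
    rw [← this]
    refine MeasureTheory.integral_mono_ae (MeasureTheory.integrable_const _) (hEi w δ hδ).re ?_
    filter_upwards [WW_ae k] with v hv
    have h1 : 0 ≤ δ * ∑ i, v i := mul_nonneg hδ.le hv.1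
    have h2 : δ * ∑ i, v i ≤ k * δ := by rw [mul_comm (k:ℝ)]; gcongr; exact hv.2
    rw [hE, if_pos (by linarith)]
    have h3 := hRl w (w + δ * ∑ i, v i) hw (by linarith)
    have h4 := (abs_le.1 ((abs_re_le_norm _).trans h3)).2
    have h5 := hB (show w ≤ w + δ * ∑ i, v i by linarith)
    have h6 : CR * (w + δ * ∑ i, v i - w) * Real.exp (w + δ * ∑ i, v i) ≤
        CR * (k * δ) * Real.exp (w + k * δ) := by
      gcongr; linarith
    simp only [sub_re, ofReal_re] at *
    linarith
  have hupp : ∀ w δ : ℝ, 0 ≤ w → 0 < δ →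
      -‖SM k δ E w‖ ≤ B (w + k * δ) - (R (w + k * δ)).re + CR * (k * δ) * Real.exp (w + k * δ) := by
    intro w δ hw hδ
    refine le_trans (neg_le_of_abs_le (abs_re_le_norm _)) ?_
    rw [hre w δ hδ]
    have : ∫ _, (B (w + k * δ) - (R (w + k * δ)).re + CR * (k * δ) * Real.exp (w + k * δ)) ∂(WW k) =
      B (w + k * δ) - (R (w + k * δ)).re + CR * (k * δ) * Real.exp (w + k * δ) := by simp
    rw [← this]
    refine MeasureTheory.integral_mono_ae (hEi w δ hδ).re (MeasureTheory.integrable_const _) ?_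
    filter_upwards [WW_ae k] with v hv
    have h1 : 0 ≤ δ * ∑ i, v i := mul_nonneg hδ.le hv.1
    have h2 : δ * ∑ i, v i ≤ k * δ := by rw [mul_comm (k:ℝ)]; gcongr; exact hv.2
    rw [hE, if_pos (by linarith)]
    have h3 := hRl (w + δ * ∑ i, v i) (w + k * δ) (by linarith) (by linarith)
    have h4 := (abs_le.1 ((abs_re_le_norm _).trans h3)).2
    have h5 := hB (show w + δ * ∑ i, v i ≤ w + k * δ by linarith)
    have h6 : CR * (w + k * δ - (w + δ * ∑ i, v i)) * Real.exp (w + k * δ) ≤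
        CR * (k * δ) * Real.exp (w + k * δ) := by
      gcongr; linarith
    simp only [sub_re, ofReal_re] at *
    linarith
  obtain ⟨M, hM0, hM⟩ := hRb (k + 1)
  have hl2 : 0 < Real.log 2 := Real.log_pos (by norm_num)
  have hr0 : 0 < r := by linarith
  have hexp : 0 ≤ 1 - 1/(2*r) := by
    rw [sub_nonneg, div_le_one (by positivity)]; linarith
  set C2 := C1 + CR * k * Real.exp k with hC2
  set C3 := (B (k+1) + M) / Real.log 2 with hC3
  have hC3' : 0 ≤ C3 := div_nonneg (add_nonneg (hB0 _) hM0) hl2.le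
  have hC2' : 0 ≤ C2 := by positivity
  refine ⟨C2 + C3 + 1, by positivity, fun u hu => ?_⟩
  have hu0 : 0 < u := hl2.trans_le hu
  set X := Real.exp (u * (1 - 1/(2*r))) with hX
  have hX1 : 1 ≤ X := Real.one_le_exp (by positivity)
  rcases le_total u (k + 1) with hsmall | hlarge
  · have h1 : |B u - (R u).re| ≤ B (k+1) + M := by
      refine (abs_sub _ _).trans (add_le_add ?_ ?_)
      · rw [abs_of_nonneg (hB0 u)]; exact hB hsmall
      · exact (abs_re_le_norm _).trans (hM u (by rwa [abs_of_pos hu0]))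
    calc |B u - (R u).re| ≤ C3 * 1 * Real.log 2 := by rw [hC3]; field_simp; exact h1
      _ ≤ (C2 + C3 + 1) * X * u := by
        gcongr
        linarith
  · have hu1 : 1 ≤ u := by have : (0:ℝ) ≤ k := by positivity
                           linarith
    set δ := Real.exp (-(u / (2 * r))) with hδd
    have hδ : 0 < δ := Real.exp_pos _
    have hδ1 : δ ≤ 1 := by
      rw [hδd, Real.exp_le_one_iff]; have : 0 ≤ u / (2*r) := by positivity
      linarith
    have hδr : δ ^ (-r) ≤ X := by
      rw [hδd, ← Real.exp_mul, hX, Real.exp_le_exp]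
      have e : -(u / (2*r)) * -r = u * (1/2) := by field_simp
      rw [e]
      gcongr
      have : 1 / (2*r) ≤ 1/2 := by
        apply one_div_le_one_div_of_le <;> linarith
      linarith
    have hδX : δ * Real.exp u = X := by
      rw [hδd, hX, ← Real.exp_add]; congr 1; ring
    have hkδ : k * δ ≤ k := by
      have : (0:ℝ) ≤ k := by positivity
      nlinarith
    have hXu : X ≤ X * u := by nlinarith
    have herr : CR * (k * δ) * Real.exp (u + k * δ) ≤ CR * k * Real.exp k * (X * u) := by
      calc CR * (k * δ) * Real.exp (u + k * δ) ≤ CR * (k * δ) * Real.exp (u + k) := by gcongr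
        _ = CR * k * Real.exp k * (δ * Real.exp u) := by rw [Real.exp_add]; ring
        _ = CR * k * Real.exp k * X := by rw [hδX]
        _ ≤ _ := by gcongr
    have hfin : C1 * (X * u) + CR * k * Real.exp k * (X * u) ≤ (C2 + C3 + 1) * X * u := by
      have : 0 ≤ (C3 + 1) * (X * u) := by positivity
      rw [hC2]; linarith
    rw [abs_le]
    constructor
    · have hw : 1 ≤ u - k * δ := by linarith
      have h1 := hupp (u - k * δ) δ (by linarith) hδ
      rw [sub_add_cancel] at h1
      have h2 := hSB (u - k * δ) δ hw hδ hδ1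
      have h3 : C1 * (u - k * δ) * δ ^ (-r) ≤ C1 * (X * u) := by
        rw [mul_assoc, mul_comm X]
        have : 0 ≤ k * δ := by positivity
        gcongr
        linarith
      have h4 : CR * (k * δ) * Real.exp u ≤ CR * (k * δ) * Real.exp (u + k * δ) := by
        have : 0 ≤ k * δ := by positivity
        gcongr; linarith
      linarith
    · have h1 := hlow u δ hu0.le hδ
      have h2 := hSB u δ hu1 hδ hδ1
      have h3 : C1 * u * δ ^ (-r) ≤ C1 * (X * u) := by
        rw [mul_assoc, mul_comm X]
        gcongr
      linarith

lemma princ_part (z0 : ℂ) (m : ℕ) : ∀ (g : ℂ → ℂ) (L : ℂ),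
    (∀ᶠ z in nhdsWithin z0 {z0}ᶜ, DifferentiableAt ℂ g z) →
    Tendsto (fun z => (z - z0) ^ m * g z) (nhdsWithin z0 {z0}ᶜ) (nhds L) →
    ∃ (c : ℕ → ℂ) (l : ℂ), Tendsto (fun z => g z - ∑ i ∈ Finset.range m, c i / (z - z0) ^ (i + 1))
      (nhdsWithin z0 {z0}ᶜ) (nhds l) ∧ (1 ≤ m → c (m - 1) = L) := by
  induction m with
  | zero =>
    intro g L hd hl
    refine ⟨0, L, ?_, by simp⟩
    simpa using hl
  | succ m ih =>
    intro g L hd hl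
    set h : ℂ → ℂ := Function.update (fun z => (z - z0) ^ (m + 1) * g z) z0 L with hh
    have hc : ContinuousAt h z0 := continuousAt_update_same.2 hl
    have hne : ∀ᶠ z in nhdsWithin z0 {z0}ᶜ, z ≠ z0 := eventually_mem_nhdsWithin
    have hdiff : ∀ᶠ z in nhdsWithin z0 {z0}ᶜ, DifferentiableAt ℂ h z := by
      filter_upwards [hd, hne] with z hz hz'
      have : DifferentiableAt ℂ (fun z => (z - z0) ^ (m + 1) * g z) z := by fun_prop
      refine this.congr_of_eventuallyEq ?_
      filter_upwards [isOpen_ne.mem_nhds hz'] with w hw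
      rw [hh, Function.update_of_ne hw]
    have han := analyticAt_of_differentiable_on_punctured_nhds_of_continuousAt hdiff hc
    have hder := (hasDerivAt_iff_tendsto_slope.1 han.differentiableAt.hasDerivAt)
    have hd' : ∀ᶠ z in nhdsWithin z0 {z0}ᶜ,
        DifferentiableAt ℂ (fun z => g z - L / (z - z0) ^ (m + 1)) z := by
      filter_upwards [hd, hne] with z hz hz'
      have : (z - z0) ^ (m + 1) ≠ 0 := pow_ne_zero _ (sub_ne_zero.2 hz')
      fun_prop (disch := assumption)
    obtain ⟨c, l, hcl, -⟩ := ih (fun z => g z - L / (z - z0) ^ (m + 1)) (deriv h z0) hd' (by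
      refine hder.congr' ?_
      filter_upwards [hne] with z hz
      have : z - z0 ≠ 0 := sub_ne_zero.2 hz
      rw [slope_def_field, hh, Function.update_of_ne hz, Function.update_self]
      rw [mul_sub, div_eq_iff this, pow_succ]
      field_simp)
    refine ⟨Function.update c m L, l, ?_, by simp⟩
    refine hcl.congr fun z => ?_
    have : ∑ i ∈ Finset.range m, Function.update c m L i / (z - z0) ^ (i + 1) =
        ∑ i ∈ Finset.range m, c i / (z - z0) ^ (i + 1) := by
      refine Finset.sum_congr rfl fun i hi => ?_
      rw [Function.update_of_ne (Finset.mem_range.1 hi).ne]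
    rw [Finset.sum_range_succ, Function.update_self, this]
    ring

lemma lap_mono (i : ℕ) (z : ℂ) (hz : 0 < z.re) :
    MeasureTheory.IntegrableOn (fun u : ℝ => (u:ℂ) ^ i * exp (-z * u)) (Set.Ioi 0) ∧
    ∫ u in Set.Ioi (0:ℝ), (u:ℂ) ^ i * exp (-z * u) = (i.factorial : ℂ) / z ^ (i + 1) := by
  have hz0 : z ≠ 0 := by rintro rfl; simp at hz
  have hint : ∀ i : ℕ, MeasureTheory.IntegrableOn (fun u : ℝ => (u:ℂ) ^ i * exp (-z * u)) (Set.Ioi 0) := by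
    intro i
    have := Real.GammaIntegral_convergent (s := i + 1) (by positivity)
    have h2 := integrableOn_rpow_mul_exp_neg_mul_rpow (s := (i:ℝ)) (p := 1) (b := z.re) (by
      have : (0:ℝ) ≤ i := by positivity
      linarith) zero_lt_one hz
    refine MeasureTheory.Integrable.mono' h2 ?_ ?_
    · apply Continuous.aestronglyMeasurable; fun_prop
    · refine (MeasureTheory.ae_restrict_iff' measurableSet_Ioi).2 (.of_forall fun u hu => ?_)
      have hu : 0 < u := hu
      rw [norm_mul, norm_pow, norm_real, Real.norm_of_nonneg hu.le, norm_exp]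
      simp
  refine ⟨hint i, ?_⟩
  induction i with
  | zero =>
    have := integral_exp_mul_complex_Ioi (a := -z) (by simpa using hz) 0
    simp only [pow_zero, one_mul]
    rw [this]; simp
  | succ i ih =>
    have hlim : Tendsto (fun u : ℝ => (u:ℂ) ^ (i+1) * exp (-z * u)) atTop (nhds 0) := by
      rw [tendsto_zero_iff_norm_tendsto_zero]
      have := Real.tendsto_pow_mul_exp_neg_atTop_nhds_zero (i+1)
      have h1 := tendsto_rpow_mul_exp_neg_mul_atTop_nhds_zero (i+1 : ℝ) z.re hz
      refine h1.congr' ?_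
      filter_upwards [eventually_gt_atTop 0] with u hu
      rw [norm_mul, norm_pow, norm_real, Real.norm_of_nonneg hu.le, norm_exp]
      rw [← Real.rpow_natCast]; simp
    have hFTC := MeasureTheory.integral_Ioi_of_hasDerivAt_of_tendsto'
      (f := fun u : ℝ => (u:ℂ) ^ (i+1) * exp (-z * u)) (a := 0)
      (f' := fun u : ℝ => ((i+1 : ℕ):ℂ) * ((u:ℂ) ^ i * exp (-z * u)) -
        z * ((u:ℂ) ^ (i+1) * exp (-z * u))) (m := 0) (fun u _ => ?_) ?_ hlim
    · rw [MeasureTheory.integral_sub ((hint i).const_mul _) ((hint (i+1)).const_mul _),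
        MeasureTheory.integral_const_mul, MeasureTheory.integral_const_mul, ih] at hFTC
      simp at hFTC
      have h2 : z * ∫ u in Set.Ioi (0:ℝ), (u:ℂ) ^ (i+1) * exp (-z * u) =
        (i + 1) * (i.factorial / z ^ (i+1)) := by
        simp only [neg_mul]
        linear_combination -hFTC
      rw [eq_div_iff (pow_ne_zero _ hz0), pow_succ z (i+1), ← mul_assoc, mul_comm _ z, ← mul_assoc, h2, Nat.factorial_succ]
      field_simp
      push_cast
      ring
    · have h1 : HasDerivAt (fun w : ℂ => w ^ (i+1) * exp (-z * w))
          (((i+1 : ℕ):ℂ) * ((u:ℂ) ^ i * exp (-z * u)) - z * ((u:ℂ) ^ (i+1) * exp (-z * u))) (u:ℂ) := by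
        have ha := hasDerivAt_pow (i+1) (u:ℂ)
        have hb : HasDerivAt (fun w : ℂ => exp (-z * w)) (exp (-z * u) * (-z * 1)) (u:ℂ) :=
          ((hasDerivAt_id (u:ℂ)).const_mul (-z)).cexp
        refine (ha.mul hb).congr_deriv ?_
        simp
        ring
      exact h1.comp_ofReal
    · exact ((hint i).const_mul _).sub ((hint (i+1)).const_mul _)

lemma term_lip (i : ℕ) (ρ : ℝ) (h0 : 0 < ρ) (h : ρ < 1 ∨ (ρ = 1 ∧ i = 0)) :
    ∃ C, 0 ≤ C ∧ ∀ u v : ℝ, 0 ≤ u → u ≤ v →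
      ‖(v ^ i * Real.exp (ρ * v)) - (u ^ i * Real.exp (ρ * u))‖ ≤ C * (v - u) * Real.exp v := by
  have hb : ∀ j : ℕ, (ρ < 1 ∨ (ρ = 1 ∧ j = 0)) → ∃ C, 0 ≤ C ∧ ∀ u : ℝ, 0 ≤ u →
      u ^ j * Real.exp (ρ * u) ≤ C * Real.exp u := by
    rintro j (h | ⟨rfl, rfl⟩)
    · have hd : 0 < 1 - ρ := by linarith
      refine ⟨j.factorial / (1 - ρ) ^ j, by positivity, fun u hu => ?_⟩
      have := Real.pow_div_factorial_le_exp ((1-ρ) * u) (by positivity) j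
      have e : Real.exp u = Real.exp ((1-ρ) * u) * Real.exp (ρ * u) := by
        rw [← Real.exp_add]; congr 1; ring
      rw [e, ← mul_assoc]
      gcongr
      rw [div_le_iff₀ (by positivity), mul_pow] at this
      rw [div_mul_eq_mul_div, le_div_iff₀ (by positivity)]
      linarith
    · exact ⟨1, zero_le_one, fun u hu => by simp⟩
  obtain ⟨C1, hC1, h1⟩ := hb i h
  have h2 : ∃ C, 0 ≤ C ∧ ∀ u : ℝ, 0 ≤ u →
      (i * u ^ (i-1)) * Real.exp (ρ * u) ≤ C * Real.exp u := by
    rcases h with h | ⟨-, rfl⟩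
    · obtain ⟨C2, hC2, h2⟩ := hb (i-1) (Or.inl h)
      refine ⟨i * C2, by positivity, fun u hu => ?_⟩
      rw [mul_assoc, mul_assoc]
      exact mul_le_mul_of_nonneg_left (h2 u hu) (by positivity)
    · exact ⟨0, le_rfl, fun u hu => by simp⟩
  obtain ⟨C2, hC2, h2⟩ := h2
  refine ⟨C2 + C1 * ρ, by positivity, fun u v hu huv => ?_⟩
  have hder : ∀ x ∈ Set.Icc u v, HasDerivWithinAt (fun x : ℝ => x ^ i * Real.exp (ρ * x))
      ((i * x ^ (i-1)) * Real.exp (ρ * x) + x ^ i * (Real.exp (ρ * x) * (ρ * 1))) (Set.Icc u v) x := by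
    intro x _
    exact ((hasDerivAt_pow i x).mul ((hasDerivAt_id x).const_mul ρ).exp).hasDerivWithinAt
  have := Convex.norm_image_sub_le_of_norm_hasDerivWithin_le
    (C := (C2 + C1 * ρ) * Real.exp v) hder ?_ (convex_Icc u v)
    (Set.left_mem_Icc.2 huv) (Set.right_mem_Icc.2 huv)
  · refine this.trans (le_of_eq ?_)
    rw [Real.norm_of_nonneg (by linarith)]; ring
  · intro x hx
    have hx0 : 0 ≤ x := hu.trans hx.1
    rw [Real.norm_of_nonneg (by positivity)]
    have := h1 x hx0
    have := h2 x hx0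
    have e1 : Real.exp x ≤ Real.exp v := Real.exp_le_exp.2 hx.2
    calc _ = (i * x ^ (i-1)) * Real.exp (ρ * x) + (x ^ i * Real.exp (ρ * x)) * ρ := by ring
      _ ≤ C2 * Real.exp x + (C1 * Real.exp x) * ρ := by gcongr
      _ = (C2 + C1 * ρ) * Real.exp x := by ring
      _ ≤ _ := by gcongr

section BB
variable (a lam : ℕ → ℝ)

noncomputable def BB (u : ℝ) : ℝ := ∑' n, if lam n ≤ Real.exp u then a n else 0

lemma BB_summable (htop : Tendsto lam atTop atTop) (u : ℝ) :
    Summable (fun n => if lam n ≤ Real.exp u then a n else 0) := by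
  obtain ⟨N, hN⟩ := eventually_atTop.1 (htop.eventually_gt_atTop (Real.exp u))
  refine summable_of_ne_finset_zero (s := Finset.range N) fun n hn => ?_
  rw [if_neg]
  simp only [Finset.mem_range, not_lt] at hn
  exact not_le.2 (hN n hn)

lemma BB_nonneg (ha : ∀ n, 0 < a n) (u : ℝ) : 0 ≤ BB a lam u :=
  tsum_nonneg fun n => by split_ifs; exacts [(ha n).le, le_rfl]

lemma BB_mono (ha : ∀ n, 0 < a n) (htop : Tendsto lam atTop atTop) : Monotone (BB a lam) := by
  intro u v huv
  refine (BB_summable a lam htop u).tsum_le_tsum (fun n => ?_) (BB_summable a lam htop v)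
  split_ifs with h1 h2 h2
  · exact le_rfl
  · exact absurd (h1.trans (Real.exp_le_exp.2 huv)) h2
  · exact (ha n).le
  · exact le_rfl

lemma BB_laplace (ha : ∀ n, 0 < a n) (hlam : ∀ n, 0 < lam n)
    (hmono : StrictMono lam) (htop : Tendsto lam atTop atTop)
    (habs : ∀ s : ℂ, 1 < s.re → Summable fun n => a n * lam n ^ (-s.re))
    (s : ℂ) (hs : s.re = 5/4) :
    MeasureTheory.Integrable (fun u : ℝ => exp (-s * u) * (BB a lam u : ℂ)) ∧
    ∫ u : ℝ, exp (-s * u) * (BB a lam u : ℂ) = (∑' n, (a n : ℂ) * ((lam n : ℂ) ^ (-s))) / s := by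
  have hs0 : s ≠ 0 := by rintro rfl; norm_num at hs
  have hre : (-s).re < 0 := by rw [neg_re, hs]; norm_num
  constructor
  · have hsum := habs (9/8) (by norm_num)
    have e98 : (9/8 : ℂ).re = 9/8 := by norm_num
    rw [e98] at hsum
    set K := ∑' n, a n * lam n ^ (-(9/8 : ℝ)) with hK
    have hbound : ∀ u, BB a lam u ≤ K * Real.exp (9/8 * u) := by
      intro u
      rw [hK, ← tsum_mul_right]
      refine (BB_summable a lam htop u).tsum_le_tsum (fun n => ?_) (hsum.mul_right _)
      have hp := Real.rpow_pos_of_pos (hlam n) (-(9/8))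
      split_ifs with h
      · rw [mul_assoc]
        apply le_mul_of_one_le_right (ha n).le
        rw [mul_comm (9/8 : ℝ), Real.exp_mul, Real.rpow_neg (hlam n).le, inv_mul_eq_div,
          one_le_div (Real.rpow_pos_of_pos (hlam n) _)]
        exact Real.rpow_le_rpow (hlam n).le h (by norm_num)
      · have := ha n; positivity
    have hzero : ∀ u, u < Real.log (lam 0) → BB a lam u = 0 := by
      intro u hu
      have : ∀ n, (if lam n ≤ Real.exp u then a n else 0) = 0 := by
        intro n
        rw [if_neg]
        rw [not_le]
        calc Real.exp u < Real.exp (Real.log (lam 0)) := Real.exp_lt_exp.2 hu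
          _ = lam 0 := Real.exp_log (hlam 0)
          _ ≤ lam n := hmono.monotone (Nat.zero_le n)
      simp [BB, this]
    have hdom : MeasureTheory.Integrable ((Set.Ici (Real.log (lam 0))).indicator
        (fun u : ℝ => K * Real.exp (-(1/8) * u))) := by
      rw [MeasureTheory.integrable_indicator_iff measurableSet_Ici, integrableOn_Ici_iff_integrableOn_Ioi]
      exact (integrableOn_exp_mul_Ioi (by norm_num) _).const_mul K
    refine hdom.mono' ?_ (.of_forall fun u => ?_)
    · apply Measurable.aestronglyMeasurable
      apply Measurable.mul
      · fun_prop
      · exact measurable_ofReal.comp (BB_mono a lam ha htop).measurable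
    · by_cases hu : u < Real.log (lam 0)
      · rw [hzero u hu, Set.indicator_of_notMem (by simpa using hu)]; simp
      · rw [Set.indicator_of_mem (by simpa using hu), norm_mul, norm_real, norm_exp,
          Real.norm_of_nonneg (BB_nonneg a lam ha u), re_mul_ofReal, neg_re, hs]
        calc Real.exp (-(5/4) * u) * BB a lam u ≤ Real.exp (-(5/4) * u) * (K * Real.exp (9/8 * u)) := by
              gcongr; exact hbound u
          _ = K * (Real.exp (-(5/4) * u) * Real.exp (9/8 * u)) := by ring
          _ = _ := by rw [← Real.exp_add]; congr 2; ring
  · set G : ℕ → ℝ → ℂ := fun n => (Set.Ici (Real.log (lam n))).indicator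
      (fun u : ℝ => (a n : ℂ) * exp (-s * u)) with hG
    have hGi : ∀ n, MeasureTheory.Integrable (G n) := by
      intro n
      rw [hG, MeasureTheory.integrable_indicator_iff measurableSet_Ici,
        integrableOn_Ici_iff_integrableOn_Ioi]
      exact (integrableOn_exp_mul_complex_Ioi hre _).const_mul _
    have hGv : ∀ n, ∫ u, G n u = (a n : ℂ) * ((lam n : ℂ) ^ (-s)) / s := by
      intro n
      rw [hG]
      simp only
      rw [MeasureTheory.integral_indicator measurableSet_Ici,
        MeasureTheory.integral_Ici_eq_integral_Ioi, MeasureTheory.integral_const_mul,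
        integral_exp_mul_complex_Ioi hre, cpow_def_of_ne_zero (by exact_mod_cast (hlam n).ne'),
        ofReal_log (hlam n).le, mul_comm (-s), neg_div_neg_eq, mul_div_assoc]
    have hGn : ∀ n, ∫ u, ‖G n u‖ = a n * lam n ^ (-(5/4 : ℝ)) / (5/4) := by
      intro n
      have : ∀ u, ‖G n u‖ = (Set.Ici (Real.log (lam n))).indicator
          (fun u : ℝ => a n * Real.exp (-(5/4) * u)) u := by
        intro u
        rw [hG]
        simp only
        rw [norm_indicator_eq_indicator_norm]
        congr 1
        ext u
        rw [norm_mul, norm_real, Real.norm_of_nonneg (ha n).le, norm_exp, re_mul_ofReal, neg_re, hs]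
      simp_rw [this]
      rw [MeasureTheory.integral_indicator measurableSet_Ici,
        MeasureTheory.integral_Ici_eq_integral_Ioi, MeasureTheory.integral_const_mul,
        integral_exp_mul_Ioi (by norm_num), Real.rpow_def_of_pos (hlam n), mul_comm (-(5/4 : ℝ)),
        neg_div_neg_eq, mul_div_assoc]
    have hsumm : Summable fun n => ∫ u, ‖G n u‖ := by
      simp_rw [hGn]
      have := (habs s (by rw [hs]; norm_num)).div_const (5/4)
      rwa [hs] at this
    have := (MeasureTheory.hasSum_integral_of_summable_integral_norm hGi hsumm).tsum_eq
    simp_rw [hGv] at this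
    rw [tsum_div_const] at this
    rw [this]
    congr 1
    ext u
    rw [BB, ofReal_tsum, ← tsum_mul_left]
    congr 1
    ext n
    rw [hG]
    simp only [Set.indicator, Set.mem_Ici]
    have : lam n ≤ Real.exp u ↔ Real.log (lam n) ≤ u := (Real.log_le_iff_le_exp (hlam n)).symm
    simp only [this]
    split_ifs
    · ring
    · simp
end BB

noncomputable def PP (S : Finset ℝ) (m : ℝ → ℕ) (c : ℝ → ℕ → ℂ) (s : ℂ) : ℂ :=
  ∑ x ∈ S, ∑ i ∈ Finset.range (m x), c x i / (s - x) ^ (i + 1)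

lemma PP_diff (S : Finset ℝ) (m : ℝ → ℕ) (c : ℝ → ℕ → ℂ) (s : ℂ) (hs : ∀ x ∈ S, s ≠ (x:ℂ)) :
    DifferentiableAt ℂ (PP S m c) s := by
  unfold PP
  refine DifferentiableAt.fun_sum fun x hx => DifferentiableAt.fun_sum fun i _ => ?_
  have : (s - x) ^ (i + 1) ≠ 0 := pow_ne_zero _ (sub_ne_zero.2 (hs x hx))
  fun_prop (disch := assumption)

lemma exists_F (f : ℂ → ℂ) (S : Finset ℝ) (hS : ∀ x ∈ S, 0 < x) (m : ℝ → ℕ) (L : ℝ → ℂ)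
    (hholo : DifferentiableOn ℂ f {s : ℂ | 0 < s.re ∧ ∀ x ∈ S, s ≠ (x:ℂ)})
    (hord : ∀ x ∈ S, Tendsto (fun s : ℂ => (s - (x : ℂ)) ^ m x * f s)
      (nhdsWithin (x : ℂ) {(x : ℂ)}ᶜ) (nhds (L x)))
    (hcont : ContinuousOn f {s : ℂ | 0 ≤ s.re ∧ ∀ x ∈ S, s ≠ (x:ℂ)})
    (r C₀ t₀ : ℝ) (hr : 1 ≤ r) (hC₀ : 0 < C₀) (ht₀ : 1 ≤ t₀)
    (hgrowth : ∀ σ t : ℝ, 0 ≤ σ → σ < 3/2 → t₀ ≤ |t| →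
      ‖f (σ + t * Complex.I)‖ ≤ C₀ * |t| ^ r) :
    ∃ (c : ℝ → ℕ → ℂ) (F : ℂ → ℂ) (C : ℝ), 0 ≤ C ∧
      (∀ x ∈ S, 1 ≤ m x → c x (m x - 1) = L x / x) ∧
      DifferentiableOn ℂ F {s | 0 < s.re} ∧
      (∀ σ t : ℝ, 0 < σ → σ ≤ 5/4 → ‖F (σ + t * I)‖ ≤ C / σ * (1 + |t|) ^ (r - 1)) ∧
      (∀ s : ℂ, (∀ x ∈ S, s ≠ (x:ℂ)) → s ≠ 0 → F s = f s / s - PP S m c s) := by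
  classical
  have hclosed : ∀ T : Finset ℝ, IsOpen {s : ℂ | ∀ x ∈ T, s ≠ (x:ℂ)} := by
    intro T
    have : {s : ℂ | ∀ x ∈ T, s ≠ (x:ℂ)} = ((T.image (fun x : ℝ => (x:ℂ)) : Finset ℂ) : Set ℂ)ᶜ := by
      ext s
      simp only [Set.mem_ofPred_eq, Set.mem_compl_iff, Finset.coe_image, Set.mem_image, not_exists, not_and, Finset.mem_coe]
      exact ⟨fun h x hx e => h x hx e.symm, fun h x hx e => h x hx e.symm⟩
    rw [this]
    exact (Finset.finite_toSet _).isClosed.isOpen_compl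
  have hpos : IsOpen {s : ℂ | 0 < s.re} := isOpen_lt continuous_const continuous_re
  have hU : IsOpen {s : ℂ | 0 < s.re ∧ ∀ x ∈ S, s ≠ (x:ℂ)} := hpos.inter (hclosed S)
  have hfd : ∀ s : ℂ, 0 < s.re → (∀ x ∈ S, s ≠ (x:ℂ)) → DifferentiableAt ℂ f s := fun s h1 h2 =>
    hholo.differentiableAt (hU.mem_nhds ⟨h1, h2⟩)
  have hpunct : ∀ x ∈ S, ∀ᶠ s in nhdsWithin (x:ℂ) {(x:ℂ)}ᶜ, 0 < s.re ∧ ∀ y ∈ S, s ≠ (y:ℂ) := by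
    intro x hx
    have h1 : {s : ℂ | 0 < s.re} ∈ nhds (x:ℂ) := hpos.mem_nhds (by simpa using hS x hx)
    have h2 : {s : ℂ | ∀ y ∈ S.erase x, s ≠ (y:ℂ)} ∈ nhds (x:ℂ) := (hclosed _).mem_nhds (by
      intro y hy
      exact_mod_cast (Finset.ne_of_mem_erase hy).symm)
    filter_upwards [mem_nhdsWithin_of_mem_nhds h1, mem_nhdsWithin_of_mem_nhds h2,
      self_mem_nhdsWithin] with s a1 a2 a3
    refine ⟨a1, fun y hy => ?_⟩
    by_cases hxy : y = x
    · subst hxy; exact a3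
    · exact a2 y (Finset.mem_erase.2 ⟨hxy, hy⟩)
  have hne0 : ∀ s : ℂ, 0 < s.re → s ≠ 0 := by rintro s h rfl; simp at h
  have hex : ∀ x : ℝ, ∃ (c : ℕ → ℂ) (l : ℂ), x ∈ S →
      Tendsto (fun z => f z / z - ∑ i ∈ Finset.range (m x), c i / (z - x) ^ (i + 1))
        (nhdsWithin (x:ℂ) {(x:ℂ)}ᶜ) (nhds l) ∧ (1 ≤ m x → c (m x - 1) = L x / x) := by
    intro x
    by_cases hx : x ∈ S
    · have hx0 : (x:ℂ) ≠ 0 := by exact_mod_cast (hS x hx).ne'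
      obtain ⟨c, l, h⟩ := princ_part x (m x) (fun z => f z / z) (L x / x) (by
        filter_upwards [hpunct x hx] with s hs
        exact (hfd s hs.1 hs.2).div differentiableAt_id (hne0 s hs.1)) (by
        have h1 : Tendsto (fun z : ℂ => z) (nhdsWithin (x:ℂ) {(x:ℂ)}ᶜ) (nhds (x:ℂ)) :=
          tendsto_nhdsWithin_of_tendsto_nhds tendsto_id
        refine ((hord x hx).div h1 hx0).congr fun z => ?_
        simp only [Pi.div_apply]
        rw [mul_div_assoc])
      exact ⟨c, l, fun _ => h⟩
    · exact ⟨0, 0, fun h => absurd h hx⟩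
  choose c l hcl using hex
  -- limit of full
  set l' : ℝ → ℂ := fun x => l x - PP (S.erase x) m c x with hl'
  have hlim : ∀ x ∈ S, Tendsto (fun z => f z / z - PP S m c z) (nhdsWithin (x:ℂ) {(x:ℂ)}ᶜ)
      (nhds (l' x)) := by
    intro x hx
    have h1 := (hcl x hx).1
    have h2 : Tendsto (PP (S.erase x) m c) (nhdsWithin (x:ℂ) {(x:ℂ)}ᶜ) (nhds (PP (S.erase x) m c x)) := by
      apply tendsto_nhdsWithin_of_tendsto_nhds
      refine (PP_diff (S.erase x) m c x ?_).continuousAt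
      intro y hy
      exact_mod_cast (Finset.ne_of_mem_erase hy).symm
    refine (h1.sub h2).congr fun z => ?_
    rw [PP, PP, ← Finset.add_sum_erase S _ hx]
    ring
  set G : ℂ → ℂ := fun s => if ∀ x ∈ S, s ≠ (x:ℂ) then f s - s * PP S m c s else s * l' s.re with hG
  set F : ℂ → ℂ := fun s => G s / s with hF
  have hFe : ∀ s : ℂ, (∀ x ∈ S, s ≠ (x:ℂ)) → s ≠ 0 → F s = f s / s - PP S m c s := by
    intro s hs hs0
    simp only [hF, hG]
    rw [if_pos hs, sub_div, mul_div_cancel_left₀ _ hs0]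
  have hd1 : ∀ s : ℂ, 0 < s.re → (∀ x ∈ S, s ≠ (x:ℂ)) → DifferentiableAt ℂ F s := by
    intro s h1 h2
    have : DifferentiableAt ℂ (fun z => f z / z - PP S m c z) s :=
      ((hfd s h1 h2).div differentiableAt_id (hne0 s h1)).sub (PP_diff S m c s h2)
    refine this.congr_of_eventuallyEq ?_
    filter_upwards [hU.mem_nhds ⟨h1, h2⟩] with z hz
    exact hFe z hz.2 (hne0 z hz.1)
  have hd2 : ∀ x ∈ S, DifferentiableAt ℂ F (x:ℂ) := by
    intro x hx
    have hx0 : (x:ℂ) ≠ 0 := by exact_mod_cast (hS x hx).ne'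
    have hFx : F x = l' x := by
      simp only [hF, hG]
      rw [if_neg (by push Not; exact ⟨x, hx, rfl⟩), mul_div_cancel_left₀ _ hx0, ofReal_re]
    refine (analyticAt_of_differentiable_on_punctured_nhds_of_continuousAt ?_ ?_).differentiableAt
    · filter_upwards [hpunct x hx] with s hs
      exact hd1 s hs.1 hs.2
    · rw [continuousAt_iff_punctured_nhds, hFx]
      refine (hlim x hx).congr' ?_
      filter_upwards [hpunct x hx] with s hs
      exact (hFe s hs.2 (hne0 s hs.1)).symm
  have hFd : DifferentiableOn ℂ F {s | 0 < s.re} := by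
    intro s hs
    apply DifferentiableAt.differentiableWithinAt
    by_cases h : ∀ x ∈ S, s ≠ (x:ℂ)
    · exact hd1 s hs h
    · push Not at h
      obtain ⟨x, hx, rfl⟩ := h
      exact hd2 x hx
  have hGc : ContinuousOn G {s | 0 ≤ s.re} := by
    intro s hs
    by_cases h : ∀ x ∈ S, s ≠ (x:ℂ)
    · have hnh := (hclosed S).mem_nhds (x := s) h
      have h1 : ContinuousWithinAt (fun z => f z - z * PP S m c z) {s | 0 ≤ s.re} s := by
        refine ContinuousWithinAt.sub ?_ ?_
        · refine (hcont s ⟨hs, h⟩).mono_of_mem_nhdsWithin ?_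
          filter_upwards [self_mem_nhdsWithin, mem_nhdsWithin_of_mem_nhds hnh] with z a b
          exact ⟨a, b⟩
        · exact (continuousAt_id.mul (PP_diff S m c s h).continuousAt).continuousWithinAt
      refine h1.congr_of_eventuallyEq ?_ ?_
      · filter_upwards [mem_nhdsWithin_of_mem_nhds hnh] with z hz
        simp only [hG]
        rw [if_pos hz]
      · simp only [hG]
        rw [if_pos h]
    · push Not at h
      obtain ⟨x, hx, rfl⟩ := h
      have h2 : ContinuousAt (fun z => z * F z) (x:ℂ) := continuousAt_id.mul (hd2 x hx).continuousAt
      refine (h2.congr ?_).continuousWithinAt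
      filter_upwards [hpos.mem_nhds (show 0 < (x:ℂ).re by simpa using hS x hx)] with z hz
      simp only [hF]
      rw [mul_div_cancel₀ _ (hne0 z hz)]
  -- compact bound
  have hcpt : IsCompact (Set.Icc (0:ℝ) (5/4) ×ℂ Set.Icc (-t₀) t₀) :=
    isCompact_Icc.reProdIm isCompact_Icc
  obtain ⟨M, hM⟩ := hcpt.exists_bound_of_continuousOn (hGc.mono (by
    intro z hz; exact hz.1.1))
  set A := ∑ x ∈ S, ∑ i ∈ Finset.range (m x), ‖c x i‖ with hA
  have hA0 : 0 ≤ A := Finset.sum_nonneg fun x _ => Finset.sum_nonneg fun i _ => norm_nonneg _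
  have hPb : ∀ σ t : ℝ, 1 ≤ |t| → ‖PP S m c (σ + t * I)‖ ≤ A := by
    intro σ t ht
    refine norm_sum_le_of_le _ fun x _ => norm_sum_le_of_le _ fun i _ => ?_
    rw [norm_div, norm_pow]
    apply div_le_self (norm_nonneg _)
    apply one_le_pow₀
    refine ht.trans ?_
    have := abs_im_le_norm ((σ:ℂ) + t * I - x)
    simpa using this
  refine ⟨c, F, |M| + 5/4 * (C₀ + A), by positivity, fun x hx => (hcl x hx).2, hFd, ?_, hFe⟩
  intro σ t hσ hσ1
  have h1t : 1 ≤ (1 + |t|) ^ (r - 1) :=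
    Real.one_le_rpow (by have := abs_nonneg t; linarith) (by linarith)
  have hsσ : σ ≤ ‖(σ + t * I : ℂ)‖ := by
    have := (le_abs_self _).trans (abs_re_le_norm (σ + t * I : ℂ)); simpa using this
  rcases le_total t₀ |t| with ht | ht
  · have ht1 : 1 ≤ |t| := ht₀.trans ht
    have ht0 : 0 < |t| := by linarith
    have hst : |t| ≤ ‖(σ + t * I : ℂ)‖ := by
      have := abs_im_le_norm (σ + t * I : ℂ); simpa using this
    rw [hFe]
    · have e1 : ‖f (σ + t * I) / (σ + t * I)‖ ≤ C₀ * (1 + |t|) ^ (r - 1) := by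
        rw [norm_div]
        calc _ ≤ C₀ * |t| ^ r / |t| :=
              div_le_div₀ (by positivity) (hgrowth σ t hσ.le (by linarith) ht) ht0 hst
          _ = C₀ * |t| ^ (r - 1) := by
              rw [Real.rpow_sub_one ht0.ne']; ring
          _ ≤ _ := by gcongr; linarith
      calc _ ≤ C₀ * (1 + |t|) ^ (r - 1) + A * 1 := by
            refine (norm_sub_le _ _).trans (add_le_add e1 ?_)
            rw [mul_one]; exact hPb σ t ht1
        _ ≤ C₀ * (1 + |t|) ^ (r - 1) + A * (1 + |t|) ^ (r - 1) := by gcongr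
        _ = (C₀ + A) * (1 + |t|) ^ (r - 1) := by ring
        _ ≤ _ := by
          gcongr
          rw [le_div_iff₀ hσ]
          have := abs_nonneg M
          nlinarith
    · intro x _ h
      have := congrArg Complex.im h
      simp at this
      rw [this] at ht0; simp at ht0
    · exact hne0 _ (by simpa using hσ)
  · have : ‖F (σ + t * I)‖ ≤ |M| / σ := by
      simp only [hF]
      rw [norm_div]
      refine div_le_div₀ (abs_nonneg _) ((hM _ ?_).trans (le_abs_self M)) hσ hsσ
      rw [mem_reProdIm]
      have := abs_le.1 ht
      simp
      exact ⟨⟨hσ.le, hσ1⟩, this⟩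
    calc _ ≤ |M| / σ * 1 := by rwa [mul_one]
      _ ≤ _ := by
        gcongr
        have : 0 ≤ 5/4 * (C₀ + A) := by positivity
        linarith

noncomputable def RR (S : Finset ℝ) (m : ℝ → ℕ) (c : ℝ → ℕ → ℂ) (u : ℝ) : ℂ :=
  ∑ x ∈ S, ∑ i ∈ Finset.range (m x), c x i / (i.factorial : ℂ) *
    ((u ^ i * Real.exp (x * u) : ℝ) : ℂ)

lemma RR_cont (S : Finset ℝ) (m : ℝ → ℕ) (c : ℝ → ℕ → ℂ) : Continuous (RR S m c) := by
  unfold RR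
  fun_prop

lemma RR_lip (S : Finset ℝ) (m : ℝ → ℕ) (c : ℝ → ℕ → ℂ)
    (hS : ∀ x ∈ S, 0 < x ∧ (x < 1 ∨ (x = 1 ∧ m x = 1))) :
    ∃ C, 0 ≤ C ∧ ∀ u v : ℝ, 0 ≤ u → u ≤ v →
      ‖RR S m c v - RR S m c u‖ ≤ C * (v - u) * Real.exp v := by
  have h : ∀ (x : ℝ) (i : ℕ), ∃ C, 0 ≤ C ∧ (x ∈ S → i < m x → ∀ u v : ℝ, 0 ≤ u → u ≤ v →
      ‖(v ^ i * Real.exp (x * v)) - (u ^ i * Real.exp (x * u))‖ ≤ C * (v - u) * Real.exp v) := by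
    intro x i
    by_cases hx : x ∈ S ∧ i < m x
    · obtain ⟨C, hC, h⟩ := term_lip i x (hS x hx.1).1 (by
        rcases (hS x hx.1).2 with h | ⟨h, h'⟩
        · exact Or.inl h
        · exact Or.inr ⟨h, by omega⟩)
      exact ⟨C, hC, fun _ _ => h⟩
    · exact ⟨0, le_rfl, fun h1 h2 => absurd ⟨h1, h2⟩ hx⟩
  choose D hD0 hD using h
  refine ⟨∑ x ∈ S, ∑ i ∈ Finset.range (m x), ‖c x i / (i.factorial : ℂ)‖ * D x i, 
    Finset.sum_nonneg fun x _ => Finset.sum_nonneg fun i _ =>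
      mul_nonneg (norm_nonneg _) (hD0 x i), ?_⟩
  intro u v hu huv
  unfold RR
  rw [← Finset.sum_sub_distrib, Finset.sum_mul, Finset.sum_mul]
  refine norm_sum_le_of_le _ fun x hx => ?_
  rw [← Finset.sum_sub_distrib, Finset.sum_mul, Finset.sum_mul]
  refine norm_sum_le_of_le _ fun i hi => ?_
  rw [← mul_sub, norm_mul, ← Complex.ofReal_sub, Complex.norm_real, mul_assoc, mul_assoc]
  refine mul_le_mul_of_nonneg_left ?_ (norm_nonneg _)
  rw [← mul_assoc]
  exact hD x i hx (Finset.mem_range.1 hi) u v hu huv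

lemma RR_laplace (S : Finset ℝ) (m : ℝ → ℕ) (c : ℝ → ℕ → ℂ) (hS : ∀ x ∈ S, x ≤ 1)
    (s : ℂ) (hs : s.re = 5/4) :
    MeasureTheory.Integrable (fun u : ℝ => exp (-s * u) * (if 0 ≤ u then RR S m c u else 0)) ∧
    ∫ u : ℝ, exp (-s * u) * (if 0 ≤ u then RR S m c u else 0) = PP S m c s := by
  have hz : ∀ x ∈ S, 0 < (s - (x:ℂ)).re := by
    intro x hx
    have := hS x hx
    simp [hs]; linarith
  have hpt : (fun u : ℝ => exp (-s * u) * (if 0 ≤ u then RR S m c u else 0)) =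
      (Set.Ici (0:ℝ)).indicator (fun u : ℝ => ∑ x ∈ S, ∑ i ∈ Finset.range (m x),
        c x i / (i.factorial : ℂ) * ((u:ℂ) ^ i * exp (-(s - x) * u))) := by
    funext u
    by_cases hu : 0 ≤ u
    · rw [if_pos hu, Set.indicator_of_mem (Set.mem_Ici.2 hu)]
      unfold RR
      rw [Finset.mul_sum]
      refine Finset.sum_congr rfl fun x _ => ?_
      rw [Finset.mul_sum]
      refine Finset.sum_congr rfl fun i _ => ?_
      have : exp (-(s - x) * u) = exp (-s * u) * exp (x * u) := by
        rw [← Complex.exp_add]; congr 1; ring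
      rw [this]; push_cast; ring
    · rw [if_neg hu, Set.indicator_of_notMem (by simpa using hu), mul_zero]
  have hint : ∀ x ∈ S, ∀ i ∈ Finset.range (m x), MeasureTheory.IntegrableOn
      (fun u : ℝ => c x i / (i.factorial : ℂ) * ((u:ℂ) ^ i * exp (-(s - x) * u))) (Set.Ioi 0) :=
    fun x hx i _ => (lap_mono i (s - x) (hz x hx)).1.const_mul _
  rw [hpt]
  constructor
  · rw [MeasureTheory.integrable_indicator_iff measurableSet_Ici,
      integrableOn_Ici_iff_integrableOn_Ioi]
    exact MeasureTheory.integrable_finset_sum _ fun x hx =>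
      MeasureTheory.integrable_finset_sum _ fun i hi => hint x hx i hi
  · rw [MeasureTheory.integral_indicator measurableSet_Ici, MeasureTheory.integral_Ici_eq_integral_Ioi,
      MeasureTheory.integral_finset_sum _ fun x hx =>
      MeasureTheory.integrable_finset_sum _ fun i hi => hint x hx i hi]
    unfold PP
    refine Finset.sum_congr rfl fun x hx => ?_
    rw [MeasureTheory.integral_finset_sum _ fun i hi => hint x hx i hi]
    refine Finset.sum_congr rfl fun i hi => ?_
    rw [MeasureTheory.integral_const_mul, (lap_mono i (s - x) (hz x hx)).2]
    have : (i.factorial : ℂ) ≠ 0 := by exact_mod_cast i.factorial_ne_zero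
    field_simp

lemma RR_poly (K : ℕ) (ρ : Fin K → ℝ) (hρ : ∀ j, ρ j ∈ Set.Ioo (0:ℝ) 1) (m : ℝ → ℕ)
    (c : ℝ → ℕ → ℂ) (ares : ℝ) (h1 : m 1 = 1) (hc : c 1 0 = ares) :
    ∃ p : Fin K → Polynomial ℝ, ∀ x : ℝ, 0 < x →
      (RR (insert 1 (Finset.univ.image ρ)) m c (Real.log x)).re =
        ares * x + ∑ j, x ^ (ρ j) * (p j).eval (Real.log x) := by
  classical
  refine ⟨fun j => Polynomial.C (1 / ((Finset.univ.filter fun j' => ρ j' = ρ j).card : ℝ)) *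
    ∑ i ∈ Finset.range (m (ρ j)), Polynomial.monomial i ((c (ρ j) i).re / i.factorial), ?_⟩
  intro x hx
  have hn : (1:ℝ) ∉ Finset.univ.image ρ := by
    simp only [Finset.mem_image, not_exists, not_and]
    intro j _ h
    have := (hρ j).2
    linarith
  have key : ∑ j, x ^ (ρ j) * ((Polynomial.C (1 / ((Finset.univ.filter fun j' => ρ j' = ρ j).card : ℝ)) *
    ∑ i ∈ Finset.range (m (ρ j)), Polynomial.monomial i ((c (ρ j) i).re / i.factorial)).eval
      (Real.log x)) = ∑ b ∈ Finset.univ.image ρ, ∑ i ∈ Finset.range (m b),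
        (c b i).re / i.factorial * (Real.log x ^ i * x ^ b) := by
    have := Finset.sum_comp (s := (Finset.univ : Finset (Fin K))) (fun b : ℝ => x ^ b * ((Polynomial.C (1 / ((Finset.univ.filter fun j' => ρ j' = b).card : ℝ)) *
    ∑ i ∈ Finset.range (m b), Polynomial.monomial i ((c b i).re / i.factorial)).eval
      (Real.log x))) ρ
    rw [this]
    refine Finset.sum_congr rfl fun b hb => ?_
    have hcard : ((Finset.univ.filter fun j' => ρ j' = b).card : ℝ) ≠ 0 := by
      obtain ⟨j, _, hj⟩ := Finset.mem_image.1 hb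
      have : 0 < (Finset.univ.filter fun j' => ρ j' = b).card :=
        Finset.card_pos.2 ⟨j, by simp [hj]⟩
      positivity
    rw [nsmul_eq_mul, Polynomial.eval_mul, Polynomial.eval_C, Polynomial.eval_finset_sum]
    have e : ∑ i ∈ Finset.range (m b),
        (c b i).re / i.factorial * (Real.log x ^ i * x ^ b) = x ^ b * ∑ i ∈ Finset.range (m b),
        Polynomial.eval (Real.log x) (Polynomial.monomial i ((c b i).re / i.factorial)) := by
      rw [Finset.mul_sum]
      refine Finset.sum_congr rfl fun i _ => ?_
      rw [Polynomial.eval_monomial]; ring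
    rw [e]
    field_simp
  rw [key]
  unfold RR
  rw [Finset.sum_insert hn, h1, Complex.add_re]
  congr 1
  · rw [Finset.sum_range_one, Complex.re_mul_ofReal, hc]
    simp [Real.exp_log hx]
  · rw [Complex.re_sum]
    refine Finset.sum_congr rfl fun b hb => ?_
    rw [Complex.re_sum]
    refine Finset.sum_congr rfl fun i _ => ?_
    rw [Complex.re_mul_ofReal, Real.rpow_def_of_pos hx, mul_comm b]
    congr 1
    rw [← Complex.ofReal_natCast, Complex.div_ofReal_re]


/-- For a generalized Dirichlet series `f(s) = Σ aₙ λₙ^{-s}` with positive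
coefficients as in the context (absolutely convergent for `Re s > 1`, meromorphic on
`Re s > 0` with a simple pole at `s = 1` of residue `ares` and finitely many further poles
`ρⱼ ∈ (0,1)`, continuous up to `Re s = 0`, polynomial growth `|f(σ+it)| ≤ C₀|t|^r`),
the summatory function `A_f(x) = Σ_{λₙ ≤ x} aₙ` satisfies
`A_f(x) = ares·x + Σⱼ x^{ρⱼ} pⱼ(log x) + O(x^{1-1/(2r)} log x)` for suitable real
polynomials `pⱼ`. -/
theorem dirichlet_summatory_asymptotic
    (a lam : ℕ → ℝ) (f : ℂ → ℂ) (r C₀ t₀ ares : ℝ) (K : ℕ) (ρ : Fin K → ℝ)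
    (ha : ∀ n, 0 < a n) (hlam : ∀ n, 0 < lam n)
    (hmono : StrictMono lam) (htop : Tendsto lam atTop atTop)
    (habs : ∀ s : ℂ, 1 < s.re → Summable fun n => a n * lam n ^ (-s.re))
    (hf : ∀ s : ℂ, 1 < s.re → f s = ∑' n, (a n : ℂ) * ((lam n : ℂ) ^ (-s)))
    (hρ : ∀ j, ρ j ∈ Set.Ioo (0:ℝ) 1)
    (hholo : DifferentiableOn ℂ f
      ({s : ℂ | 0 < s.re} \ ({1} ∪ Set.range fun j => ((ρ j : ℝ) : ℂ))))
    (hares : 0 < ares)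
    (hpole1 : Tendsto (fun s : ℂ => (s - 1) * f s) (nhdsWithin 1 {(1:ℂ)}ᶜ)
      (nhds (ares : ℂ)))
    (hord : ∀ j, ∃ (m : ℕ) (L : ℂ), Tendsto (fun s : ℂ => (s - (ρ j : ℂ)) ^ m * f s)
      (nhdsWithin ((ρ j : ℝ) : ℂ) {((ρ j : ℝ) : ℂ)}ᶜ) (nhds L))
    (hcont : ContinuousOn f {s : ℂ | 0 ≤ s.re ∧ s ≠ 1 ∧ ∀ j, s ≠ ((ρ j : ℝ) : ℂ)})
    (hr : 1 ≤ r) (hC₀ : 0 < C₀) (ht₀ : 1 ≤ t₀)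
    (hgrowth : ∀ σ t : ℝ, 0 ≤ σ → σ < 3/2 → t₀ ≤ |t| →
      ‖f (σ + t * Complex.I)‖ ≤ C₀ * |t| ^ r) :
    ∃ (p : Fin K → Polynomial ℝ) (C : ℝ), 0 < C ∧ ∀ x : ℝ, 2 ≤ x →
      |(∑' n, if lam n ≤ x then a n else 0) - ares * x
          - ∑ j, x ^ (ρ j) * (p j).eval (Real.log x)|
        ≤ C * x ^ (1 - 1/(2*r)) * Real.log x := by
  classical
  set S : Finset ℝ := insert 1 (Finset.univ.image ρ) with hSdef
  have hmemS : ∀ x, x ∈ S ↔ x = 1 ∨ ∃ j, ρ j = x := by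
    intro x; simp [hSdef]
  have hex : ∀ x : ℝ, ∃ (m : ℕ) (L : ℂ), (x = 1 → m = 1 ∧ L = ares) ∧
      (x ∈ S → Tendsto (fun s : ℂ => (s - (x : ℂ)) ^ m * f s)
        (nhdsWithin (x : ℂ) {(x : ℂ)}ᶜ) (nhds L)) := by
    intro x
    by_cases hx : x = 1
    · refine ⟨1, ares, fun _ => ⟨rfl, rfl⟩, fun _ => ?_⟩
      subst hx
      simpa using hpole1
    · by_cases hx' : ∃ j, ρ j = x
      · obtain ⟨j, rfl⟩ := hx'
        obtain ⟨m, L, h⟩ := hord j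
        exact ⟨m, L, fun h => absurd h hx, fun _ => h⟩
      · exact ⟨0, 0, fun h => absurd h hx, fun h => absurd ((hmemS x).1 h) (by tauto)⟩
  choose m L hmL1 hmL using hex
  have hSpos : ∀ x ∈ S, 0 < x ∧ (x < 1 ∨ (x = 1 ∧ m x = 1)) := by
    intro x hx
    rcases (hmemS x).1 hx with rfl | ⟨j, rfl⟩
    · exact ⟨one_pos, Or.inr ⟨rfl, (hmL1 1 rfl).1⟩⟩
    · exact ⟨(hρ j).1, Or.inl (hρ j).2⟩
  have hSle : ∀ x ∈ S, x ≤ 1 := by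
    intro x hx
    rcases (hSpos x hx).2 with h | h
    · exact h.le
    · exact h.1.le
  obtain ⟨c, F, C, hC, hcm, hFd, hFb, hFe⟩ := exists_F f S (fun x hx => (hSpos x hx).1) m L
    (hholo.mono (by
      rintro s ⟨h0, hs⟩
      refine ⟨h0, ?_⟩
      rintro (h | ⟨j, h⟩)
      · exact hs 1 ((hmemS 1).2 (Or.inl rfl)) (by simpa using h)
      · exact hs (ρ j) ((hmemS _).2 (Or.inr ⟨j, rfl⟩)) h.symm))
    hmL
    (hcont.mono (by
      rintro s ⟨h0, hs⟩
      refine ⟨h0, ?_, fun j => hs (ρ j) ((hmemS _).2 (Or.inr ⟨j, rfl⟩))⟩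
      simpa using hs 1 ((hmemS 1).2 (Or.inl rfl))))
    r C₀ t₀ hr hC₀ ht₀ hgrowth
  have hm1 : m 1 = 1 := (hmL1 1 rfl).1
  have hc1 : c 1 0 = ares := by
    have := hcm 1 ((hmemS 1).2 (Or.inl rfl)) hm1.ge
    rw [hm1, (hmL1 1 rfl).2] at this
    simpa using this
  obtain ⟨CR, hCR, hRl⟩ := RR_lip S m c hSpos
  have hcomb : ∀ s : ℂ, s.re = 5/4 →
      MeasureTheory.Integrable (fun u : ℝ => exp (-s * u) *
        ((BB a lam u : ℂ) - (if 0 ≤ u then RR S m c u else 0))) ∧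
      ∫ u : ℝ, exp (-s * u) *
        ((BB a lam u : ℂ) - (if 0 ≤ u then RR S m c u else 0)) = F s := by
    intro s hs
    obtain ⟨h1, h2⟩ := BB_laplace a lam ha hlam hmono htop habs s hs
    obtain ⟨h3, h4⟩ := RR_laplace S m c hSle s hs
    have hne : ∀ x ∈ S, s ≠ (x:ℂ) := by
      rintro x hx rfl
      have := hSle x hx
      rw [Complex.ofReal_re] at hs
      linarith
    have hs0 : s ≠ 0 := by
      rintro rfl
      norm_num at hs
    simp only [mul_sub]
    refine ⟨h1.sub h3, ?_⟩
    rw [MeasureTheory.integral_sub h1 h3, h2, h4, hFe s hne hs0, hf s (by rw [hs]; norm_num)]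
  obtain ⟨C', hC', hmain⟩ := taub (BB a lam) (BB_mono a lam ha htop) (BB_nonneg a lam ha)
    (RR S m c) (RR_cont S m c) CR hCR hRl _ (fun u => rfl) F hFd r C hr hC hFb
    (fun s hs => (hcomb s hs).1) (fun s hs => (hcomb s hs).2)
  obtain ⟨p, hp⟩ := RR_poly K ρ hρ m c ares hm1 hc1
  refine ⟨p, C', hC', fun x hx => ?_⟩
  have hx0 : 0 < x := by linarith
  have h := hmain (Real.log x) (Real.log_le_log (by norm_num) hx)
  rw [hp x hx0, ← Real.rpow_def_of_pos hx0] at h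
  unfold BB at h
  rw [Real.exp_log hx0] at h
  rw [sub_sub]
  exact h
end

section
/- Fix 0 < σ₀ < 1 and an integer k with k > r. For x ≥ 1 define the finite Dirichlet polynomial f*_{x,k}(s) = Σ_{n : λ_n ≤ x} a_n·(1 − λ_n/x)^k·λ_n^{−s}. Then there exists a constant C > 0 such that for every x ≥ 2 and every s = σ + it with σ₀ ≤ σ ≤ 3/2 and x^{(1−σ₀)/(k+1)} ≤ t ≤ x^{σ₀/r}, one has | f*_{x,k}(s) − f(s) | ≤ C. -/
open Filter Complex

namespace SPS
open MeasureTheory Set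

/-- The Mellin kernel `k!/(w(w+1)...(w+k))`. -/
noncomputable def KK (k : ℕ) (w : ℂ) : ℂ :=
  (k.factorial : ℂ) / ∏ j ∈ Finset.range (k + 1), (w + j)

/-- The smoothing weight. -/
noncomputable def MM (k : ℕ) (u : ℝ) : ℝ := (max 0 (1 - u)) ^ k

lemma KK_bound (k : ℕ) (b v δ : ℝ) (hδ : 0 < δ) (hδ1 : δ ≤ 1)
    (hb : ∀ j : ℕ, δ ≤ |b + j|) :
    ‖KK k (b + v * I)‖ ≤ k.factorial * (2 / δ) ^ (k + 1) * (1 + |v|) ^ (-((k : ℝ) + 1)) := by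
  unfold KK
  rw [norm_div, norm_prod, Complex.norm_natCast, div_eq_mul_inv, mul_assoc]
  gcongr
  have h1 : (δ / 2 * (1 + |v|)) ^ (k + 1) ≤ ∏ j ∈ Finset.range (k + 1), ‖(b + v * I + j : ℂ)‖ := by
    rw [← Finset.card_range (k + 1), ← Finset.prod_const, Finset.card_range]
    apply Finset.prod_le_prod
    · intro i _; positivity
    · intro j _
      have e1 : |b + j| ≤ ‖(b + v * I + j : ℂ)‖ := by
        simpa using Complex.abs_re_le_norm (b + v * I + j : ℂ)
      have e2 : |v| ≤ ‖(b + v * I + j : ℂ)‖ := by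
        simpa using Complex.abs_im_le_norm (b + v * I + j : ℂ)
      have := hb j
      have := abs_nonneg v
      nlinarith
  have h2 : (2 / δ) ^ (k + 1) * (1 + |v|) ^ (-((k : ℝ) + 1)) = ((δ / 2 * (1 + |v|)) ^ (k + 1))⁻¹ := by
    rw [Real.rpow_neg (by positivity), mul_pow, mul_inv, ← inv_pow, inv_div]
    congr 2
    exact_mod_cast Real.rpow_natCast (1 + |v|) (k + 1)
  rw [h2]
  exact inv_anti₀ (by positivity) h1

lemma KK_bound_im (k : ℕ) (b v : ℝ) (hv : 0 < |v|) :
    ‖KK k (b + v * I)‖ ≤ k.factorial * |v| ^ (-((k : ℝ) + 1)) := by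
  unfold KK
  rw [norm_div, norm_prod, Complex.norm_natCast, div_eq_mul_inv]
  gcongr
  have h1 : |v| ^ (k + 1) ≤ ∏ j ∈ Finset.range (k + 1), ‖(b + v * I + j : ℂ)‖ := by
    rw [← Finset.card_range (k + 1), ← Finset.prod_const, Finset.card_range]
    apply Finset.prod_le_prod
    · intro i _; positivity
    · intro j _
      simpa using Complex.abs_im_le_norm (b + v * I + j : ℂ)
  rw [Real.rpow_neg (by positivity)]
  have : |v| ^ ((k : ℝ) + 1) = |v| ^ (k + 1) := by exact_mod_cast Real.rpow_natCast |v| (k + 1)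
  rw [this]
  exact inv_anti₀ (by positivity) h1

lemma ne_of_re (b v : ℝ) (j : ℕ) (h : b + j ≠ 0) : (b + v * I + j : ℂ) ≠ 0 := by
  intro h0
  apply h
  simpa using congrArg Complex.re h0

lemma KK_cont (k : ℕ) (b : ℝ) (hb : ∀ j : ℕ, b + j ≠ 0) :
    Continuous fun v : ℝ => KK k (b + v * I) := by
  unfold KK
  apply Continuous.div continuous_const
  · fun_prop
  · intro v
    rw [Finset.prod_ne_zero_iff]
    intro j _
    exact ne_of_re b v j (hb j)

lemma int_jap (p : ℝ) (hp : 1 < p) : Integrable (fun v : ℝ => (1 + |v|) ^ (-p)) := by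
  have := integrable_one_add_norm (E := ℝ) (μ := volume) (r := p) (by simpa using hp)
  simpa using this

lemma KK_one (k : ℕ) (v : ℝ) :
    ‖KK k (1 + v * I)‖ ≤ k.factorial * 2 ^ (k + 1) * (1 + |v|) ^ (-((k : ℝ) + 1)) := by
  have := KK_bound k 1 v 1 one_pos le_rfl (fun j => by rw [abs_of_nonneg (by positivity)]; simp)
  simpa using this

lemma KK_one_cont (k : ℕ) : Continuous fun v : ℝ => KK k (1 + v * I) := by
  have := KK_cont k 1 (fun j => by positivity)
  simpa using this

lemma KK_one_int (k : ℕ) (hk : 1 ≤ k) : Integrable (fun v : ℝ => KK k (1 + v * I)) := by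
  have hk' : (1 : ℝ) ≤ k := by exact_mod_cast hk
  refine ((int_jap ((k : ℝ) + 1) (by linarith)).const_mul
    (k.factorial * 2 ^ (k + 1))).mono' (KK_one_cont k).aestronglyMeasurable ?_
  exact Eventually.of_forall fun v => KK_one k v

lemma MM_zero (k : ℕ) (hk : 1 ≤ k) (u : ℝ) (hu : 1 ≤ u) : MM k u = 0 := by
  unfold MM
  rw [max_eq_left (by linarith)]
  simp; omega

lemma MM_cont (k : ℕ) : Continuous (MM k) := by unfold MM; fun_prop

lemma mellin_MM (k : ℕ) (hk : 1 ≤ k) (w : ℂ) (hw : 0 < w.re) :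
    MellinConvergent (fun u => (MM k u : ℂ)) w ∧ mellin (fun u => (MM k u : ℂ)) w = KK k w := by
  have h0 : Set.EqOn (fun t : ℝ => (t : ℂ) ^ (w - 1) • (MM k t : ℂ))
      (fun t : ℝ => (t : ℂ) ^ (w - 1) * (1 - (t : ℂ)) ^ (((k : ℂ) + 1) - 1)) (Ioc 0 1) := by
    intro t ht
    simp only [smul_eq_mul, MM, add_sub_cancel_right, cpow_natCast]
    rw [max_eq_right (by linarith [ht.2])]
    push_cast; rfl
  have h1 : Set.EqOn (fun t : ℝ => (t : ℂ) ^ (w - 1) • (MM k t : ℂ)) 0 (Ioi 1) := by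
    intro t ht
    simp [MM_zero k hk t (le_of_lt ht)]
  have hU : Ioi (0 : ℝ) = Ioc 0 1 ∪ Ioi 1 := (Ioc_union_Ioi_eq_Ioi zero_le_one).symm
  have hB := Complex.betaIntegral_convergent (u := w) (v := (k : ℂ) + 1) hw (by
    simp; positivity)
  rw [intervalIntegrable_iff_integrableOn_Ioc_of_le zero_le_one] at hB
  have i0 : IntegrableOn (fun t : ℝ => (t : ℂ) ^ (w - 1) • (MM k t : ℂ)) (Ioc 0 1) :=
    hB.congr_fun h0.symm measurableSet_Ioc
  have i1 : IntegrableOn (fun t : ℝ => (t : ℂ) ^ (w - 1) • (MM k t : ℂ)) (Ioi 1) :=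
    integrableOn_zero.congr_fun h1.symm measurableSet_Ioi
  constructor
  · unfold MellinConvergent
    rw [hU]; exact i0.union i1
  · unfold mellin
    rw [hU, setIntegral_union (by
      rw [Set.disjoint_left]; intro x hx hx'; exact absurd hx.2 (not_le.2 hx')) measurableSet_Ioi i0 i1,
      setIntegral_congr_fun measurableSet_Ioi h1, setIntegral_congr_fun measurableSet_Ioc h0]
    have := Complex.betaIntegral_eval_nat_add_one_right hw k
    unfold Complex.betaIntegral at this
    rw [intervalIntegral.integral_of_le zero_le_one] at this
    rw [this]
    simp [KK]

lemma perron (k : ℕ) (hk : 1 ≤ k) (u : ℝ) (hu : 0 < u) :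
    (MM k u : ℂ) = (1 / (2 * Real.pi) : ℂ) * ∫ v : ℝ, (u : ℂ) ^ (-(1 + v * I : ℂ)) * KK k (1 + v * I) := by
  have hm : ∀ v : ℝ, mellin (fun u => (MM k u : ℂ)) (((1 : ℝ) : ℂ) + v * I) = KK k (1 + v * I) := by
    intro v
    rw [(mellin_MM k hk _ (by simp)).2]; simp
  have := mellinInv_mellin_eq 1 (fun u => (MM k u : ℂ)) hu
    (mellin_MM k hk _ (by simp)).1 (by
      unfold Complex.VerticalIntegrable
      simp_rw [hm]
      exact KK_one_int k hk) (by
      have := MM_cont k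
      fun_prop)
  rw [← this]
  unfold mellinInv
  simp_rw [hm]
  simp

end SPS

namespace SPS
open MeasureTheory Set

/-- The inverse Mellin line integral. -/
noncomputable def LI (k : ℕ) (s : ℂ) (x : ℝ) (P : ℂ → ℂ) : ℂ :=
  (1 / (2 * Real.pi) : ℂ) *
    ∫ v : ℝ, P (s + (1 + v * I)) * ((x : ℂ) ^ (1 + v * I : ℂ) * KK k (1 + v * I))

lemma norm_x_cpow (x : ℝ) (hx : 0 < x) (v : ℝ) : ‖(x : ℂ) ^ (1 + v * I : ℂ)‖ = x := by
  rw [Complex.norm_cpow_eq_rpow_re_of_pos hx]; simp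

lemma fubini {α : Type*} [MeasurableSpace α] (μ : Measure α) [SFinite μ] (g lam : α → ℝ)
    (hg : Measurable g) (hlm : Measurable lam) (hl : ∀ y, 0 < lam y) (k : ℕ) (hk : 1 ≤ k)
    (s : ℂ) (x : ℝ) (hx : 0 < x) (hint : Integrable (fun y => g y * lam y ^ (-(s.re + 1))) μ) :
    ∫ y, ((g y * MM k (lam y / x) : ℝ) : ℂ) * (lam y : ℂ) ^ (-s) ∂μ =
      LI k s x (fun z => ∫ y, (g y : ℂ) * (lam y : ℂ) ^ (-z) ∂μ) := by
  let F : α → ℝ → ℂ := fun y v => (g y : ℂ) * (lam y : ℂ) ^ (-(s + (1 + v * I))) *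
    ((x : ℂ) ^ (1 + v * I : ℂ) * KK k (1 + v * I))
  have hF : Integrable (Function.uncurry F) (μ.prod volume) := by
    have h1 := hint.norm.mul_prod ((KK_one_int k hk).norm.const_mul x)
    refine h1.mono' ?_ ?_
    · apply Measurable.aestronglyMeasurable
      have hK : Measurable fun v : ℝ => KK k (1 + v * I) := (KK_one_cont k).measurable
      have hK2 : Measurable fun p : α × ℝ => KK k (1 + p.2 * I) := hK.comp measurable_snd
      have hx2 : Measurable fun v : ℝ => (x : ℂ) ^ (1 + v * I : ℂ) := by fun_prop
      have hx3 : Measurable fun p : α × ℝ => (x : ℂ) ^ (1 + p.2 * I : ℂ) := hx2.comp measurable_snd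
      simp only [Function.uncurry_def, F]
      refine Measurable.mul (Measurable.mul ?_ ?_) (hx3.mul hK2)
      · fun_prop
      · apply Measurable.pow <;> fun_prop
    · refine Eventually.of_forall fun p => ?_
      simp only [Function.uncurry_def, F]
      rw [norm_mul, norm_mul, norm_mul, norm_x_cpow x hx, norm_mul,
        Complex.norm_cpow_eq_rpow_re_of_pos (hl _), Complex.norm_real,
        Real.norm_of_nonneg (Real.rpow_nonneg (hl p.1).le _)]
      simp
  unfold LI
  have e2 : ∀ v : ℝ, (∫ y, (g y : ℂ) * (lam y : ℂ) ^ (-(s + (1 + v * I))) ∂μ) *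
      ((x : ℂ) ^ (1 + v * I : ℂ) * KK k (1 + v * I)) = ∫ y, F y v ∂μ := by
    intro v
    rw [← integral_mul_const]
  simp_rw [e2]
  rw [← integral_integral_swap hF, ← integral_const_mul]
  congr 1
  ext y
  have hy : (0 : ℝ) < lam y / x := div_pos (hl y) hx
  push_cast
  rw [perron k hk _ hy]
  have hl0 : (lam y : ℂ) ≠ 0 := by exact_mod_cast (hl y).ne'
  have hx0 : (x : ℂ) ≠ 0 := by exact_mod_cast hx.ne'
  have e3 : ∀ v : ℝ, F y v = ((g y : ℂ) * (lam y : ℂ) ^ (-s)) *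
      (((lam y / x : ℝ) : ℂ) ^ (-(1 + v * I : ℂ)) * KK k (1 + v * I)) := by
    intro v
    simp only [F]
    have : ((lam y / x : ℝ) : ℂ) ^ (-(1 + v * I : ℂ)) =
        (lam y : ℂ) ^ (-(1 + v * I : ℂ)) * (x : ℂ) ^ (1 + v * I : ℂ) := by
      rw [div_eq_mul_inv, Complex.ofReal_mul, Complex.mul_cpow_ofReal_nonneg (hl y).le (by positivity)]
      congr 1
      rw [Complex.ofReal_inv, Complex.inv_cpow, Complex.cpow_neg, inv_inv]
      rw [Complex.arg_ofReal_of_nonneg hx.le]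
      exact Real.pi_pos.ne
    rw [this, neg_add, Complex.cpow_add _ _ hl0]
    ring
  simp_rw [e3]
  rw [integral_const_mul]
  ring

/-- Incomplete polar integral. -/
noncomputable def DD (X : ℝ) (k i : ℕ) (q : ℂ) : ℂ :=
  ∫ u in (0 : ℝ)..X, (1 - cexp (u - X)) ^ k * (u : ℂ) ^ i * cexp (-q * u)

lemma DD_ibp (X : ℝ) (k i : ℕ) (q : ℂ) (hq : q ≠ 0) :
    DD X k i q = (1 / q) * (-(0 ^ k * (X : ℂ) ^ i * cexp (-q * X)) + (1 - cexp (-X)) ^ k * 0 ^ i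
      - cexp (-X) * (k * DD X (k - 1) i (q - 1)) + i * DD X k (i - 1) q) := by
  have h := intervalIntegral.integral_mul_deriv_eq_deriv_mul (a := 0) (b := X)
    (u := fun u : ℝ => (1 - cexp (u - X)) ^ k * (u : ℂ) ^ i)
    (v := fun u : ℝ => -(cexp (-q * u) / q))
    (u' := fun u : ℝ => (k * (1 - cexp (u - X)) ^ (k - 1) * (-cexp (u - X))) * (u : ℂ) ^ i +
      (1 - cexp (u - X)) ^ k * (i * (u : ℂ) ^ (i - 1)))
    (v' := fun u : ℝ => cexp (-q * u))
    (by
      intro u _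
      have h0 : HasDerivAt (fun u : ℝ => (u : ℂ)) 1 u := Complex.ofRealCLM.hasDerivAt
      have h1 : HasDerivAt (fun u : ℝ => 1 - cexp (u - X)) (-cexp (u - X)) u := by
        simpa using ((h0.sub_const (X : ℂ)).cexp.const_sub 1)
      have h2 := (h1.pow k).mul (h0.pow i)
      simp only [mul_one] at h2
      exact h2)
    (by
      intro u _
      have h0 : HasDerivAt (fun u : ℝ => (u : ℂ)) 1 u := Complex.ofRealCLM.hasDerivAt
      have h1 := (((h0.const_mul (-q)).cexp).div_const q).neg
      have e : -(cexp (-q * u) * (-q * 1) / q) = cexp (-q * u) := by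
        rw [mul_one, mul_neg, neg_div, neg_neg, mul_div_cancel_right₀ _ hq]
      rw [e] at h1
      exact h1)
    (by apply Continuous.intervalIntegrable; fun_prop)
    (by apply Continuous.intervalIntegrable; fun_prop)
  have h3 : DD X k i q = ∫ u in (0 : ℝ)..X, ((1 - cexp (u - X)) ^ k * (u : ℂ) ^ i) * cexp (-q * u) := rfl
  rw [h3, h]
  have h4 : (∫ u in (0 : ℝ)..X, ((k * (1 - cexp (u - X)) ^ (k - 1) * (-cexp (u - X))) * (u : ℂ) ^ i +
      (1 - cexp (u - X)) ^ k * (i * (u : ℂ) ^ (i - 1))) * (-(cexp (-q * u) / q))) =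
      (cexp (-X) * k / q) * DD X (k - 1) i (q - 1) + (-i / q) * DD X k (i - 1) q := by
    unfold DD
    rw [← intervalIntegral.integral_const_mul, ← intervalIntegral.integral_const_mul,
      ← intervalIntegral.integral_add (by apply Continuous.intervalIntegrable; fun_prop)
        (by apply Continuous.intervalIntegrable; fun_prop)]
    congr 1
    ext u
    have e1 : cexp (-(q - 1) * u) = cexp (-q * u) * cexp u := by rw [← Complex.exp_add]; ring_nf
    have e2 : cexp (u - X) = cexp u * cexp (-X) := by rw [← Complex.exp_add]; ring_nf
    rw [e1]
    generalize hA : (1 - cexp (u - X)) ^ (k - 1) = A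
    generalize hB : (1 - cexp (u - X)) ^ k = B
    rw [e2]
    ring
  rw [h4]
  simp
  ring

lemma DD_bound (n : ℕ) : ∀ k i : ℕ, k + i ≤ n → ∃ c : ℝ, 0 ≤ c ∧ ∀ X : ℝ, 0 ≤ X → ∀ q : ℂ, 1 ≤ |q.im| →
    ‖DD X k i q‖ ≤ c * (1 + Real.exp (-q.re * X) * (1 + X) ^ i / |q.im| ^ (k + 1)) := by
  induction n with
  | zero => 
    intro k i h
    obtain ⟨rfl, rfl⟩ : k = 0 ∧ i = 0 := by omega
    refine ⟨1, zero_le_one, fun X hX q hq => ?_⟩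
    have hqn : |q.im| ≤ ‖q‖ := Complex.abs_im_le_norm q
    have hq0 : q ≠ 0 := by rintro rfl; simp at hq; linarith
    rw [DD_ibp X _ _ q hq0]
    simp only [pow_zero, mul_one, Nat.cast_zero, zero_mul, mul_zero, sub_zero, add_zero, norm_mul, norm_div, norm_one]
    have e1 : ‖-(1 * cexp (-q * X)) + 1‖ ≤ Real.exp (-q.re * X) + 1 := by
      refine (norm_add_le _ _).trans ?_
      simp [Complex.norm_exp]
    have : 1 / ‖q‖ ≤ 1 / |q.im| := one_div_le_one_div_of_le (by linarith) hqn
    have h2 : 1 / |q.im| ≤ 1 := by rw [div_le_one (by linarith)]; exact hq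
    calc _ ≤ 1 / |q.im| * (Real.exp (-q.re * X) + 1) := by gcongr
      _ ≤ _ := by
        simp only [zero_add, pow_one, one_mul]
        rw [mul_add, mul_one, add_comm, one_div_mul_eq_div]
        linarith
  | succ n ih =>
    intro k i h
    have A : ∃ c : ℝ, 0 ≤ c ∧ ∀ X : ℝ, 0 ≤ X → ∀ q : ℂ, 1 ≤ |q.im| →
        ‖(k : ℂ) * DD X (k - 1) i (q - 1)‖ ≤
          c * (1 + Real.exp X * (Real.exp (-q.re * X) * (1 + X) ^ i / |q.im| ^ k)) := by
      rcases k with _ | k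
      · exact ⟨0, le_rfl, fun X hX q hq => by simp⟩
      · obtain ⟨c, hc, hb⟩ := ih k i (by omega)
        refine ⟨((k + 1 : ℕ) : ℝ) * c, by positivity, fun X hX q hq => ?_⟩
        have := hb X hX (q - 1) (by simpa using hq)
        rw [norm_mul, Complex.norm_natCast, mul_assoc]
        have e : Real.exp (-(q - 1).re * X) = Real.exp X * Real.exp (-q.re * X) := by
          rw [← Real.exp_add]; congr 1; simp; ring
        rw [e] at this
        simp only [Nat.add_sub_cancel]
        gcongr
        refine this.trans (le_of_eq ?_)
        simp only [sub_im, one_im, sub_zero]; ring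
    have B : ∃ c : ℝ, 0 ≤ c ∧ ∀ X : ℝ, 0 ≤ X → ∀ q : ℂ, 1 ≤ |q.im| →
        ‖(i : ℂ) * DD X k (i - 1) q‖ ≤
          c * (1 + (Real.exp (-q.re * X) * (1 + X) ^ i / |q.im| ^ (k + 1))) := by
      rcases i with _ | i
      · exact ⟨0, le_rfl, fun X hX q hq => by simp⟩
      · obtain ⟨c, hc, hb⟩ := ih k i (by omega)
        refine ⟨((i + 1 : ℕ) : ℝ) * c, by positivity, fun X hX q hq => ?_⟩
        have := hb X hX q hq
        rw [norm_mul, Complex.norm_natCast, mul_assoc]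
        simp only [Nat.add_sub_cancel]
        gcongr
        refine this.trans ?_
        gcongr
        · linarith
        · omega
    obtain ⟨c1, hc1, hA⟩ := A
    obtain ⟨c2, hc2, hB⟩ := B
    refine ⟨1 + c1 + c2, by positivity, fun X hX q hq => ?_⟩
    have hqn : |q.im| ≤ ‖q‖ := Complex.abs_im_le_norm q
    have hq0 : q ≠ 0 := by rintro rfl; simp at hq; linarith
    have hA := hA X hX q hq
    have hB := hB X hX q hq
    set τ := |q.im| with hτ
    have hτ0 : 0 < τ := by linarith
    set E := Real.exp (-q.re * X) * (1 + X) ^ i with hE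
    have hE0 : 0 ≤ E := by positivity
    have hexp : Real.exp (-X) ≤ 1 := by simpa using hX
    have t1 : ‖(0 : ℂ) ^ k * (X : ℂ) ^ i * cexp (-q * X)‖ ≤ E / τ ^ k := by
      rcases k with _ | k
      · simp only [pow_zero, one_mul, norm_mul, norm_pow, Complex.norm_real, Real.norm_of_nonneg hX,
          Complex.norm_exp, div_one, hE]
        rw [mul_comm]
        gcongr
        · simp
        · linarith
      · simp; positivity
    have t2 : ‖(1 - cexp (-X)) ^ k * (0 : ℂ) ^ i‖ ≤ 1 := by
      rw [norm_mul, norm_pow, norm_pow]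
      apply mul_le_one₀
      · apply pow_le_one₀ (norm_nonneg _)
        have : (1 - cexp (-X)) = ((1 - Real.exp (-X) : ℝ) : ℂ) := by push_cast; rfl
        rw [this, Complex.norm_real, Real.norm_of_nonneg (by linarith)]
        linarith [Real.exp_pos (-X)]
      · positivity
      · exact pow_le_one₀ (norm_nonneg _) (by simp)
    have t3 : ‖cexp (-X) * ((k : ℂ) * DD X (k - 1) i (q - 1))‖ ≤ c1 * (1 + E / τ ^ k) := by
      rw [norm_mul, Complex.norm_exp]
      simp only [neg_re, ofReal_re]
      calc _ ≤ Real.exp (-X) * (c1 * (1 + Real.exp X * (E / τ ^ k))) := by gcongr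
        _ = c1 * (Real.exp (-X) + (Real.exp (-X) * Real.exp X) * (E / τ ^ k)) := by ring
        _ ≤ _ := by
          rw [← Real.exp_add]; simp only [neg_add_cancel, Real.exp_zero, one_mul]; gcongr
    rw [DD_ibp X k i q hq0, norm_mul]
    have hY : E / τ ^ k / τ = E / τ ^ (k + 1) := by rw [pow_succ]; field_simp
    have hYk : E / τ ^ (k + 1) ≤ E / τ ^ k := by
      rw [← hY]; exact div_le_self (by positivity) hq
    have tot : ‖-(0 ^ k * (X : ℂ) ^ i * cexp (-q * X)) + (1 - cexp (-X)) ^ k * 0 ^ i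
      - cexp (-X) * (k * DD X (k - 1) i (q - 1)) + i * DD X k (i - 1) q‖ ≤
        (1 + c1 + c2) * (1 + E / τ ^ k) := by
      refine (norm_add_le _ _).trans ?_
      have := norm_sub_le (-(0 ^ k * (X : ℂ) ^ i * cexp (-q * X)) + (1 - cexp (-X)) ^ k * 0 ^ i) (cexp (-X) * (k * DD X (k - 1) i (q - 1)))
      have h5 := norm_add_le (-(0 ^ k * (X : ℂ) ^ i * cexp (-q * X))) ((1 - cexp (-X)) ^ k * 0 ^ i)
      rw [norm_neg] at h5
      have : c2 * (1 + E / τ ^ (k + 1)) ≤ c2 * (1 + E / τ ^ k) := by gcongr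
      linarith
    have hn : ‖1 / q‖ ≤ 1 / τ := by
      rw [norm_div, norm_one]; exact one_div_le_one_div_of_le hτ0 hqn
    calc _ ≤ 1 / τ * ((1 + c1 + c2) * (1 + E / τ ^ k)) := by gcongr
      _ = (1 + c1 + c2) * (1 / τ + E / τ ^ k / τ) := by ring
      _ ≤ _ := by
        rw [hY]
        have : 1 / τ ≤ 1 := by rw [div_le_one hτ0]; exact hq
        gcongr
end SPS

namespace SPS
open MeasureTheory Set

lemma LI_int (k : ℕ) (hk : 1 ≤ k) (s : ℂ) (x : ℝ) (hx : 0 < x) (P : ℂ → ℂ)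
    (hc : Continuous fun v : ℝ => P (s + (1 + v * I))) (B : ℝ)
    (hB : ∀ v : ℝ, ‖P (s + (1 + v * I))‖ ≤ B) :
    Integrable fun v : ℝ => P (s + (1 + v * I)) * ((x : ℂ) ^ (1 + v * I : ℂ) * KK k (1 + v * I)) := by
  have hx0 : (x : ℂ) ≠ 0 := by exact_mod_cast hx.ne'
  have hcx : Continuous fun v : ℝ => (x : ℂ) ^ (1 + v * I : ℂ) := by
    apply Continuous.const_cpow (by fun_prop) (Or.inl hx0)
  refine ((KK_one_int k hk).norm.const_mul (B * x)).mono' ?_ ?_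
  · exact (hc.mul (hcx.mul (KK_one_cont k))).aestronglyMeasurable
  · refine Eventually.of_forall fun v => ?_
    rw [norm_mul, norm_mul, norm_x_cpow x hx, mul_assoc]
    gcongr
    exact hB v

lemma gamma_int (q : ℂ) (hq : 0 < q.re) (i : ℕ) :
    IntegrableOn (fun u : ℝ => (u : ℂ) ^ i * cexp (-q * u)) (Ioi 0) := by
  have h := integrableOn_rpow_mul_exp_neg_mul_rpow (p := 1) (s := i) (b := q.re)
    (by linarith [(Nat.cast_nonneg i : (0 : ℝ) ≤ i)]) one_pos hq
  refine h.mono' ?_ ?_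
  · apply Continuous.aestronglyMeasurable; fun_prop
  · filter_upwards [ae_restrict_mem measurableSet_Ioi] with u hu
    rw [norm_mul, norm_pow, Complex.norm_real, Real.norm_of_nonneg (le_of_lt hu), Complex.norm_exp]
    simp

lemma gamma_eval (q : ℂ) (hq : 0 < q.re) (i : ℕ) :
    ∫ u in Ioi (0 : ℝ), (u : ℂ) ^ i * cexp (-q * u) = i.factorial / q ^ (i + 1) := by
  have hq0 : q ≠ 0 := by rintro rfl; simp at hq
  have tend : ∀ i : ℕ, Tendsto (fun u : ℝ => (u : ℂ) ^ i * cexp (-q * u)) atTop (nhds 0) := by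
    intro i
    rw [tendsto_zero_iff_norm_tendsto_zero]
    refine (tendsto_rpow_mul_exp_neg_mul_atTop_nhds_zero i q.re hq).congr' ?_
    filter_upwards [eventually_gt_atTop 0] with u hu
    rw [norm_mul, norm_pow, Complex.norm_real, Real.norm_of_nonneg (le_of_lt hu), Complex.norm_exp]
    simp
  induction i with
  | zero =>
    have h := integral_Ioi_of_hasDerivAt_of_tendsto' (a := 0) (m := 0)
      (f := fun u : ℝ => cexp (-q * u) / (-q)) (f' := fun u : ℝ => (u : ℂ) ^ 0 * cexp (-q * u))
      (by
        intro u _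
        have h0 : HasDerivAt (fun u : ℝ => (u : ℂ)) 1 u := Complex.ofRealCLM.hasDerivAt
        have h1 := ((h0.const_mul (-q)).cexp).div_const (-q)
        have e : (cexp (-q * u) * (-q * 1) / (-q)) = (u : ℂ) ^ 0 * cexp (-q * u) := by
          rw [mul_one, mul_div_cancel_right₀ _ (neg_ne_zero.2 hq0), pow_zero, one_mul]
        rw [e] at h1
        exact h1)
      (gamma_int q hq 0) (by simpa using (tend 0).div_const (-q))
    rw [h]; simp
  | succ i ih =>
    have h := integral_Ioi_of_hasDerivAt_of_tendsto' (a := 0) (m := 0)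
      (f := fun u : ℝ => (u : ℂ) ^ (i + 1) * cexp (-q * u))
      (f' := fun u : ℝ => ((i + 1 : ℕ) : ℂ) * ((u : ℂ) ^ i * cexp (-q * u)) -
        q * ((u : ℂ) ^ (i + 1) * cexp (-q * u)))
      (by
        intro u _
        have h0 : HasDerivAt (fun u : ℝ => (u : ℂ)) 1 u := Complex.ofRealCLM.hasDerivAt
        have h1 := (h0.pow (i + 1)).mul ((h0.const_mul (-q)).cexp)
        have e : (((i + 1 : ℕ) : ℂ) * (u : ℂ) ^ (i + 1 - 1) * 1 * cexp (-q * u) +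
          (u : ℂ) ^ (i + 1) * (cexp (-q * u) * (-q * 1))) = ((i + 1 : ℕ) : ℂ) * ((u : ℂ) ^ i * cexp (-q * u)) -
        q * ((u : ℂ) ^ (i + 1) * cexp (-q * u)) := by
          simp only [Nat.add_sub_cancel]; ring
        rw [← e]
        exact h1)
      (((gamma_int q hq i).const_mul _).sub ((gamma_int q hq (i + 1)).const_mul _)) (tend (i + 1))
    rw [integral_sub ((gamma_int q hq i).const_mul _) ((gamma_int q hq (i + 1)).const_mul _),
      integral_const_mul, integral_const_mul, ih] at h
    simp only [ofReal_zero, ne_eq, Nat.add_eq_zero_iff, one_ne_zero, and_false, not_false_eq_true, zero_pow, zero_mul, sub_zero] at h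
    have h2 := sub_eq_zero.1 h
    rw [eq_div_iff (pow_ne_zero _ hq0), pow_succ, Nat.factorial_succ]
    calc _ = (q * ∫ u in Ioi (0 : ℝ), (u : ℂ) ^ (i + 1) * cexp (-q * u)) * q ^ (i + 1) := by ring
      _ = _ := by
        rw [← h2]; push_cast; field_simp

lemma exp_cpow (u : ℝ) (z : ℂ) : ((Real.exp u : ℝ) : ℂ) ^ z = cexp (z * u) := by
  rw [Complex.cpow_def_of_ne_zero (by exact_mod_cast (Real.exp_pos u).ne'), ← Complex.ofReal_log (Real.exp_pos u).le, Real.log_exp, mul_comm]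

lemma LI_atom (k : ℕ) (hk : 1 ≤ k) (s : ℂ) (x p : ℝ) (hx : 1 ≤ x) (hp : p < s.re + 1) (i : ℕ) :
    LI k s x (fun z => 1 / (z - p) ^ (i + 1)) = (1 / (i.factorial : ℂ)) * DD (Real.log x) k i (s - p) := by
  have hx0 : 0 < x := by linarith
  have hX : 0 ≤ Real.log x := Real.log_nonneg hx
  have h := fubini (volume.restrict (Ioi (0 : ℝ))) (fun u => u ^ i * Real.exp (p * u)) Real.exp
    (by fun_prop) (by fun_prop) Real.exp_pos k hk s x hx0 (by
      have h := integrableOn_rpow_mul_exp_neg_mul_rpow (p := 1) (s := i) (b := s.re + 1 - p)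
        (by linarith [(Nat.cast_nonneg i : (0 : ℝ) ≤ i)]) one_pos (by linarith)
      refine h.congr_fun ?_ measurableSet_Ioi
      intro u hu
      simp only [Real.rpow_natCast, Real.rpow_one]
      rw [mul_assoc, ← Real.exp_mul, ← Real.exp_add]
      congr 2; ring)
  have e1 : LI k s x (fun z => ∫ u in Ioi (0 : ℝ), ((u ^ i * Real.exp (p * u) : ℝ) : ℂ) * ((Real.exp u : ℝ) : ℂ) ^ (-z)) =
      i.factorial * LI k s x (fun z => 1 / (z - p) ^ (i + 1)) := by
    unfold LI
    rw [mul_left_comm]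
    congr 1
    rw [← integral_const_mul]
    congr 1
    ext v
    simp only
    rw [← mul_assoc (i.factorial : ℂ), mul_one_div, ← gamma_eval _ (by simp; linarith) i]
    congr 2
    ext u
    rw [exp_cpow]
    push_cast
    rw [mul_assoc, ← Complex.exp_add]
    congr 2; ring
  have e2 : (∫ u in Ioi (0 : ℝ), ((u ^ i * Real.exp (p * u) * MM k (Real.exp u / x) : ℝ) : ℂ) * ((Real.exp u : ℝ) : ℂ) ^ (-s)) =
      DD (Real.log x) k i (s - p) := by
    unfold DD
    rw [intervalIntegral.integral_of_le hX]
    rw [setIntegral_eq_of_subset_of_forall_sdiff_eq_zero (s := Ioc 0 (Real.log x)) (t := Ioi 0) measurableSet_Ioi (fun u hu => hu.1)]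
    · apply setIntegral_congr_fun measurableSet_Ioc
      intro u hu
      simp only
      rw [exp_cpow]
      have : Real.exp u / x = Real.exp (u - Real.log x) := by
        rw [Real.exp_sub, Real.exp_log hx0]
      rw [this, MM, max_eq_right (by
        have : Real.exp (u - Real.log x) ≤ 1 := by rw [Real.exp_le_one_iff]; linarith [hu.2]
        linarith)]
      push_cast
      have e : cexp (-(s - p) * u) = cexp (p * u) * cexp (-s * u) := by rw [← Complex.exp_add]; ring_nf
      rw [e]; ring
    · intro u hu
      have : Real.log x < u := by
        by_contra hcon
        exact hu.2 ⟨hu.1, not_lt.1 hcon⟩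
      rw [MM_zero k hk]
      · simp
      · rw [le_div_iff₀ hx0, one_mul]
        exact (Real.log_le_iff_le_exp hx0).1 this.le
  rw [e1, e2] at h
  rw [h, ← mul_assoc, one_div_mul_cancel (by exact_mod_cast i.factorial_ne_zero), one_mul]

/-- Tame functions. -/
def Good (σ₀ : ℝ) (k : ℕ) (P : ℂ → ℂ) : Prop :=
  (∀ z : ℂ, (z.re ≤ 0 ∨ z.im ≠ 0 ∨ 1 < z.re) → ContinuousAt P z) ∧
  (∃ B : ℝ, ∀ z : ℂ, (1 ≤ |z.im| ∨ 1 + σ₀ ≤ z.re) → ‖P z‖ ≤ B) ∧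
  (∃ C : ℝ, ∀ x : ℝ, 2 ≤ x → ∀ σ t : ℝ, σ₀ ≤ σ → x ^ ((1 - σ₀) / (k + 1)) ≤ t →
    ‖LI k (σ + t * I) x P‖ ≤ C)

lemma Good.int {σ₀ : ℝ} (hσ₀ : 0 < σ₀) {k : ℕ} (hk : 1 ≤ k) {P : ℂ → ℂ} (h : Good σ₀ k P) (s : ℂ) (hs : σ₀ ≤ s.re)
    (x : ℝ) (hx : 0 < x) :
    Integrable fun v : ℝ => P (s + (1 + v * I)) * ((x : ℂ) ^ (1 + v * I : ℂ) * KK k (1 + v * I)) := by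
  obtain ⟨h1, ⟨B, hB⟩, -⟩ := h
  refine LI_int k hk s x hx P ?_ B ?_
  · rw [continuous_iff_continuousAt]
    intro v
    refine ContinuousAt.comp (f := fun v : ℝ => s + (1 + v * I)) (g := P) (h1 _ ?_) (by fun_prop)
    right; right; simp; linarith
  · intro v
    apply hB
    right; simp; linarith

lemma Good.zero (σ₀ : ℝ) (k : ℕ) : Good σ₀ k 0 := by
  refine ⟨fun z _ => continuousAt_const, ⟨0, fun z _ => by simp⟩, ⟨0, fun x _ σ t _ _ => by simp [LI]⟩⟩

lemma Good.add {σ₀ : ℝ} (hσ₀ : 0 < σ₀) {k : ℕ} (hk : 1 ≤ k) {P Q : ℂ → ℂ} (h : Good σ₀ k P) (h' : Good σ₀ k Q) :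
    Good σ₀ k (P + Q) := by
  have hi := h.int hσ₀ hk
  have hi' := h'.int hσ₀ hk
  obtain ⟨h1, ⟨B, hB⟩, ⟨C, hC⟩⟩ := h
  obtain ⟨h1', ⟨B', hB'⟩, ⟨C', hC'⟩⟩ := h'
  refine ⟨fun z hz => (h1 z hz).add (h1' z hz), ⟨B + B', fun z hz => ?_⟩, ⟨C + C', fun x hx σ t hσ ht => ?_⟩⟩
  · exact (norm_add_le _ _).trans (add_le_add (hB z hz) (hB' z hz))
  · have : LI k (σ + t * I) x (P + Q) = LI k (σ + t * I) x P + LI k (σ + t * I) x Q := by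
      unfold LI
      rw [← mul_add, ← integral_add (hi _ (by simpa using hσ) x (by linarith)) (hi' _ (by simpa using hσ) x (by linarith))]
      simp [add_mul]
    rw [this]
    exact (norm_add_le _ _).trans (add_le_add (hC x hx σ t hσ ht) (hC' x hx σ t hσ ht))

lemma Good.smul {σ₀ : ℝ} {k : ℕ} {P : ℂ → ℂ} (c : ℂ) (h : Good σ₀ k P) :
    Good σ₀ k (c • P) := by
  obtain ⟨h1, ⟨B, hB⟩, ⟨C, hC⟩⟩ := h
  refine ⟨fun z hz => (h1 z hz).const_smul c, ⟨‖c‖ * B, fun z hz => ?_⟩, ⟨‖c‖ * C, fun x hx σ t hσ ht => ?_⟩⟩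
  · simp only [Pi.smul_apply, norm_smul]
    gcongr; exact hB z hz
  · have : LI k (σ + t * I) x (c • P) = c * LI k (σ + t * I) x P := by
      unfold LI
      simp_rw [Pi.smul_apply, smul_eq_mul, mul_assoc c]
      rw [integral_const_mul]
      ring
    rw [this, norm_mul]
    gcongr; exact hC x hx σ t hσ ht

lemma pow_le_exp (i : ℕ) (p : ℝ) (hp : 0 < p) (hp1 : p < 1) :
    ∃ C : ℝ, 0 < C ∧ ∀ X : ℝ, 0 ≤ X → (1 + X) ^ i ≤ C * Real.exp ((1 - p) * X) := by
  set ε := (1 - p) / (i + 1) with hε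
  have hi : (0 : ℝ) ≤ i := Nat.cast_nonneg i
  have h0 : 0 < ε := by apply div_pos <;> linarith
  have h1 : ε ≤ 1 := by rw [hε, div_le_one (by linarith)]; linarith
  refine ⟨(1 / ε) ^ i, by positivity, fun X hX => ?_⟩
  have h2 : 1 + X ≤ (1 / ε) * Real.exp (ε * X) := by
    have := Real.add_one_le_exp (ε * X)
    rw [one_div, ← div_eq_inv_mul, le_div_iff₀ h0]
    nlinarith
  calc (1 + X) ^ i ≤ ((1 / ε) * Real.exp (ε * X)) ^ i := by gcongr
    _ = (1 / ε) ^ i * Real.exp (i * (ε * X)) := by rw [mul_pow, ← Real.exp_nat_mul]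
    _ ≤ _ := by
      have : i * ε ≤ 1 - p := by
        rw [hε, mul_div_assoc', div_le_iff₀ (by linarith)]; nlinarith
      rw [← mul_assoc]
      gcongr

lemma Good.atom {σ₀ : ℝ} (hσ₀ : 0 < σ₀) (hσ₀' : σ₀ < 1) {k : ℕ} (hk : 1 ≤ k) (p : ℝ) (hp : 0 < p) (i : ℕ)
    (hpi : p < 1 ∨ (p = 1 ∧ i = 0)) : Good σ₀ k (fun z => 1 / (z - p) ^ (i + 1)) := by
  have hp1 : p ≤ 1 := by rcases hpi with h | h <;> linarith [h]
  refine ⟨fun z hz => ?_, ⟨(1 / σ₀) ^ (i + 1), fun z hz => ?_⟩, ?_⟩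
  · apply ContinuousAt.div continuousAt_const (by fun_prop)
    apply pow_ne_zero
    intro h0
    have hre : z.re - p = 0 := by simpa using congrArg Complex.re h0
    have him : z.im = 0 := by simpa using congrArg Complex.im h0
    rcases hz with h | h | h
    · linarith
    · exact h him
    · linarith
  · have : σ₀ ≤ ‖z - p‖ := by
      rcases hz with h | h
      · have := Complex.abs_im_le_norm (z - p)
        simp at this; linarith
      · have := (le_abs_self _).trans (Complex.abs_re_le_norm (z - p))
        simp at this; linarith
    rw [norm_div, norm_one, norm_pow, one_div_pow]
    gcongr
  · obtain ⟨c, hc, hD⟩ := DD_bound (k + i) k i le_rfl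
    obtain ⟨C, hC, hCX⟩ : ∃ C : ℝ, 0 < C ∧ ∀ X : ℝ, 0 ≤ X → (1 + X) ^ i ≤ C * Real.exp ((1 - p) * X) := by
      rcases hpi with h | ⟨rfl, rfl⟩
      · exact pow_le_exp i p hp h
      · exact ⟨1, one_pos, fun X hX => by simp⟩
    refine ⟨‖(1 / (i.factorial : ℂ))‖ * (c * (1 + C)), fun x hx σ t hσ ht => ?_⟩
    have hx1 : 1 ≤ x := by linarith
    have hx0 : 0 < x := by linarith
    have ht1 : 1 ≤ t := (Real.one_le_rpow hx1 (div_nonneg (by linarith) (by positivity))).trans ht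
    rw [LI_atom k hk _ x p hx1 (by simp; linarith), norm_mul]
    gcongr
    have hX := Real.log_nonneg hx1
    have := hD (Real.log x) hX (σ + t * I - p) (by simpa using ht1.trans (le_abs_self t))
    refine this.trans ?_
    simp only [sub_re, add_re, ofReal_re, mul_re, I_re, mul_zero, ofReal_im, I_im, mul_one, sub_self, add_zero,
      sub_im, add_im, mul_im, zero_add, sub_zero, abs_of_pos (by linarith : 0 < t)]
    gcongr
    rw [div_le_iff₀ (by positivity)]
    have h3 : x ^ (1 - σ₀) ≤ t ^ (k + 1) := by
      have : (x ^ ((1 - σ₀) / (k + 1))) ^ (k + 1) = x ^ (1 - σ₀) := by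
        rw [← Real.rpow_natCast, ← Real.rpow_mul hx0.le]
        congr 1; push_cast; field_simp
      rw [← this]; gcongr
    calc _ ≤ Real.exp (-(σ - p) * Real.log x) * (C * Real.exp ((1 - p) * Real.log x)) := by
          gcongr; exact hCX _ hX
      _ = C * Real.exp ((1 - σ) * Real.log x) := by
          rw [mul_left_comm, ← Real.exp_add]; congr 2; ring
      _ ≤ C * Real.exp ((1 - σ₀) * Real.log x) := by gcongr
      _ = C * x ^ (1 - σ₀) := by rw [Real.rpow_def_of_pos hx0, mul_comm (Real.log x)]
      _ ≤ _ := by gcongr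

end SPS

namespace SPS
open MeasureTheory Set Topology

lemma laurent (V : Submodule ℂ (ℂ → ℂ)) (U : Set ℂ) (hU : IsOpen U) (p : ℂ) (hp : p ∈ U) (m : ℕ) :
    ∀ (f : ℂ → ℂ), DifferentiableOn ℂ f (U \ {p}) →
    (∃ L : ℂ, Tendsto (fun s : ℂ => (s - p) ^ m * f s) (𝓝[≠] p) (𝓝 L)) →
    (∀ i < m, (fun z : ℂ => 1 / (z - p) ^ (i + 1)) ∈ V) →
    ∃ P ∈ V, ∃ h : ℂ → ℂ, DifferentiableOn ℂ h U ∧ (∀ z ≠ p, h z = f z - P z) ∧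
      ∀ z ≠ p, ContinuousAt P z := by
  have hUn : U ∈ 𝓝 p := hU.mem_nhds hp
  have key : ∀ (f : ℂ → ℂ) (L : ℂ), DifferentiableOn ℂ f (U \ {p}) → Tendsto f (𝓝[≠] p) (𝓝 L) →
      DifferentiableOn ℂ (Function.update f p L) U := by
    intro f L hf hL
    rw [← Complex.differentiableOn_compl_singleton_and_continuousAt_iff hUn]
    refine ⟨hf.congr fun z hz => ?_, continuousAt_update_same.2 hL⟩
    rw [Function.update_of_ne hz.2]
  induction m with
  | zero =>
    rintro f hf ⟨L, hL⟩ -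
    refine ⟨0, V.zero_mem, Function.update f p L, key f L hf (by simpa using hL), ?_, ?_⟩
    · intro z hz; rw [Function.update_of_ne hz]; simp
    · intro z _; exact continuousAt_const
  | succ m ih =>
    rintro f hf ⟨L, hL⟩ hV
    have hg := key (fun s : ℂ => (s - p) ^ (m + 1) * f s) L
      (DifferentiableOn.mul (by fun_prop) hf) hL
    set g := Function.update (fun s : ℂ => (s - p) ^ (m + 1) * f s) p L with hgdef
    have hd : ContinuousAt (dslope g p) p :=
      continuousAt_dslope_same.2 (hg.differentiableAt hUn)
    obtain ⟨P, hP, h, hh, hhP, hPc⟩ := ih (fun z => f z - L * (1 / (z - p) ^ (m + 1)))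
      (by
        apply hf.sub
        apply DifferentiableOn.const_mul
        apply DifferentiableOn.div (by fun_prop) (by fun_prop)
        intro z hz
        exact pow_ne_zero _ (sub_ne_zero.2 hz.2))
      ⟨deriv g p, by
        have := hd.tendsto
        rw [dslope_same] at this
        refine (this.mono_left nhdsWithin_le_nhds).congr' ?_
        filter_upwards [self_mem_nhdsWithin] with z hz
        have hz' : z ≠ p := hz
        have hz0 : z - p ≠ 0 := sub_ne_zero.2 hz'
        rw [dslope_of_ne _ hz', slope_def_field, hgdef, Function.update_self, Function.update_of_ne hz']
        field_simp
        ring⟩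
      (fun i hi => hV i (by omega))
    refine ⟨P + L • (fun z : ℂ => 1 / (z - p) ^ (m + 1)), V.add_mem hP (V.smul_mem _ (hV m (by omega))), h, hh, ?_, ?_⟩
    · intro z hz
      rw [hhP z hz]
      simp; ring
    · intro z hz
      apply (hPc z hz).add
      apply ContinuousAt.const_smul
      apply ContinuousAt.div continuousAt_const (by fun_prop)
      exact pow_ne_zero _ (sub_ne_zero.2 hz)

lemma laurent_all (V : Submodule ℂ (ℂ → ℂ)) (U : Set ℂ) (hU : IsOpen U) (S : Finset ℂ) :
    ∀ (f : ℂ → ℂ), (∀ p ∈ S, p ∈ U) → DifferentiableOn ℂ f (U \ S) →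
    (∀ p ∈ S, ∃ (m : ℕ) (L : ℂ), Tendsto (fun s : ℂ => (s - p) ^ m * f s) (𝓝[≠] p) (𝓝 L) ∧
      (∀ i < m, (fun z : ℂ => 1 / (z - p) ^ (i + 1)) ∈ V)) →
    ∃ P ∈ V, ∃ h : ℂ → ℂ, DifferentiableOn ℂ h U ∧ (∀ z, z ∉ S → h z = f z - P z) := by
  induction S using Finset.induction_on with
  | empty =>
    intro f _ hf _
    exact ⟨0, V.zero_mem, f, by simpa using hf, by simp⟩
  | insert p S hpS ih =>
    intro f hSU hf hord
    obtain ⟨m, L, hL, hV⟩ := hord p (Finset.mem_insert_self _ _)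
    have hU' : IsOpen (U \ (S : Set ℂ)) := hU.sdiff S.finite_toSet.isClosed
    obtain ⟨P, hP, h, hh, hhP, hPc⟩ := laurent V (U \ S) hU' p
      ⟨hSU p (Finset.mem_insert_self _ _), by simpa using hpS⟩ m f
      (hf.mono (by intro z hz; refine ⟨hz.1.1, ?_⟩; have := hz.1.2; have := hz.2; simp_all)) ⟨L, hL⟩ hV
    obtain ⟨P', hP', h', hh', hhP'⟩ := ih h (fun q hq => hSU q (Finset.mem_insert_of_mem hq)) hh (by
      intro q hq
      obtain ⟨m, L, hL, hV⟩ := hord q (Finset.mem_insert_of_mem hq)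
      have hqp : q ≠ p := by rintro rfl; exact hpS hq
      refine ⟨m, L - (q - q) ^ m * P q, ?_, hV⟩
      have hc : ContinuousAt (fun s : ℂ => (s - q) ^ m * P s) q :=
        ContinuousAt.mul (by fun_prop) (hPc q hqp)
      refine (hL.sub (hc.tendsto.mono_left nhdsWithin_le_nhds)).congr' ?_
      have : ∀ᶠ z in 𝓝[≠] q, z ≠ p := nhdsWithin_le_nhds (isOpen_ne.mem_nhds hqp)
      filter_upwards [this] with z hz
      rw [hhP z hz]; ring)
    refine ⟨P + P', V.add_mem hP hP', h', hh', fun z hz => ?_⟩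
    simp only [Finset.mem_insert, not_or] at hz
    rw [hhP' z hz.2, hhP z hz.1]
    simp; ring

end SPS

namespace SPS
open MeasureTheory Set Topology

lemma int_inv (b T : ℝ) (hb : b ≠ 0) :
    ∫ v in (-T)..T, (1 / ((b : ℂ) + v * I) : ℂ) = ((2 * Real.arctan (T / b) : ℝ) : ℂ) := by
  have hpos : ∀ v : ℝ, b ^ 2 + v ^ 2 ≠ 0 := fun v => by positivity
  have hne : ∀ v : ℝ, (b : ℂ) + v * I ≠ 0 := fun v h => by
    have := congrArg Complex.re h; simp at this; exact hb this
  have hder : ∀ v ∈ uIcc (-T) T, HasDerivAt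
      (fun v : ℝ => ((Real.arctan (v / b) : ℝ) : ℂ) - I / 2 * ((Real.log (b ^ 2 + v ^ 2) : ℝ) : ℂ))
      (1 / ((b : ℂ) + v * I)) v := by
    intro v _
    have h1 : HasDerivAt (fun v : ℝ => Real.arctan (v / b)) (1 / (1 + (v / b) ^ 2) * (1 / b)) v :=
      ((hasDerivAt_id v).div_const b).arctan
    have h2 : HasDerivAt (fun v : ℝ => Real.log (b ^ 2 + v ^ 2)) ((2 * v) / (b ^ 2 + v ^ 2)) v := by
      have : HasDerivAt (fun v : ℝ => b ^ 2 + v ^ 2) (2 * v) v := by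
        simpa using ((hasDerivAt_id v).pow 2).const_add (b ^ 2)
      exact this.log (hpos v)
    have h3 := h1.ofReal_comp.sub (h2.ofReal_comp.const_mul (I / 2))
    refine h3.congr_deriv ?_
    symm
    have e : 1 / (1 + (v / b) ^ 2) * (1 / b) = b / (b ^ 2 + v ^ 2) := by
      have := hpos v
      field_simp
    rw [e, div_eq_iff (hne v)]
    have hp : ((b : ℂ) ^ 2 + v ^ 2) ≠ 0 := by exact_mod_cast hpos v
    push_cast
    field_simp
    ring_nf
    simp only [I_sq]
    ring
  have hc : Continuous fun v : ℝ => (1 / ((b : ℂ) + v * I) : ℂ) := by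
    apply Continuous.div continuous_const (by fun_prop) hne
  rw [intervalIntegral.integral_eq_sub_of_hasDerivAt hder (hc.intervalIntegrable _ _)]
  rw [neg_div, Real.arctan_neg, neg_sq]
  push_cast
  ring

lemma tendsto_inv_line (b : ℝ) (hb : b ≠ 0) :
    Tendsto (fun T : ℝ => ∫ v in (-T)..T, (1 / ((b : ℂ) + v * I) : ℂ)) atTop
      (𝓝 ((if 0 < b then Real.pi else -Real.pi : ℝ) : ℂ)) := by
  simp_rw [int_inv b _ hb]
  apply (Complex.continuous_ofReal.tendsto _).comp
  split_ifs with h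
  · have h1 : Tendsto (fun T : ℝ => T / b) atTop atTop := tendsto_id.atTop_div_const h
    have := ((Real.tendsto_arctan_atTop.mono_right nhdsWithin_le_nhds).comp h1).const_mul 2
    rw [show (2 : ℝ) * (Real.pi / 2) = Real.pi by ring] at this
    exact this
  · have h1 : Tendsto (fun T : ℝ => T / b) atTop atBot :=
      tendsto_id.atTop_div_const_of_neg (lt_of_le_of_ne (not_lt.1 h) hb)
    have := ((Real.tendsto_arctan_atBot.mono_right nhdsWithin_le_nhds).comp h1).const_mul 2
    rw [mul_neg, show (2 : ℝ) * (Real.pi / 2) = Real.pi by ring] at this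
    exact this

/-- Growth hypotheses for the pole-free part. -/
structure Nice (h : ℂ → ℂ) (A r : ℝ) : Prop where
  diff : DifferentiableOn ℂ h {z : ℂ | 0 < z.re}
  cont : ContinuousOn h {z : ℂ | 0 ≤ z.re}
  hA : 0 ≤ A
  hr : 0 ≤ r
  growth : ∀ z : ℂ, 0 ≤ z.re → z.re ≤ 5 / 2 → ‖h z‖ ≤ A * (1 + |z.im|) ^ r

lemma Nice.bd {h : ℂ → ℂ} {A r : ℝ} (N : Nice h A r) (s : ℂ) (b v : ℝ) (h0 : 0 ≤ s.re + b)
    (h1 : s.re + b ≤ 5 / 2) :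
    ‖h (s + (b + v * I))‖ ≤ A * ((1 + |s.im|) ^ r * (1 + |v|) ^ r) := by
  refine (N.growth _ (by simpa using h0) (by simpa using h1)).trans ?_
  have hA := N.hA
  rw [← Real.mul_rpow (by positivity) (by positivity)]
  gcongr
  · exact N.hr
  · have : (s + (b + v * I)).im = s.im + v := by simp
    rw [this]
    have := abs_add_le s.im v
    nlinarith [abs_nonneg s.im, abs_nonneg v, mul_nonneg (abs_nonneg s.im) (abs_nonneg v)]

lemma Nice.line_cont {h : ℂ → ℂ} {A r : ℝ} (N : Nice h A r) (s : ℂ) (b x : ℝ) (hx : 0 < x)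
    (h0 : 0 ≤ s.re + b) (k : ℕ) (hb : ∀ j : ℕ, b + j ≠ 0) :
    Continuous fun v : ℝ => h (s + (b + v * I)) * ((x : ℂ) ^ (b + v * I : ℂ) * KK k (b + v * I)) := by
  have hx0 : (x : ℂ) ≠ 0 := by exact_mod_cast hx.ne'
  apply Continuous.mul
  · exact N.cont.comp_continuous (by fun_prop) (fun v => by simpa using h0)
  · apply Continuous.mul
    · exact Continuous.const_cpow (by fun_prop) (Or.inl hx0)
    · exact KK_cont k b hb

lemma Nice.line_bd {h : ℂ → ℂ} {A r : ℝ} (N : Nice h A r) (s : ℂ) (b x : ℝ) (hx : 0 < x)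
    (h0 : 0 ≤ s.re + b) (h1 : s.re + b ≤ 5 / 2) (k : ℕ) (δ : ℝ) (hδ : 0 < δ) (hδ1 : δ ≤ 1)
    (hb : ∀ j : ℕ, δ ≤ |b + j|) (v : ℝ) :
    ‖h (s + (b + v * I)) * ((x : ℂ) ^ (b + v * I : ℂ) * KK k (b + v * I))‖ ≤
      (A * (1 + |s.im|) ^ r * (x ^ b * (k.factorial * (2 / δ) ^ (k + 1)))) *
        (1 + |v|) ^ (-((k : ℝ) + 1 - r)) := by
  rw [norm_mul, norm_mul, Complex.norm_cpow_eq_rpow_re_of_pos hx]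
  have e : ((b : ℂ) + v * I).re = b := by simp
  rw [e]
  have hA := N.hA
  calc _ ≤ (A * ((1 + |s.im|) ^ r * (1 + |v|) ^ r)) *
        (x ^ b * (k.factorial * (2 / δ) ^ (k + 1) * (1 + |v|) ^ (-((k : ℝ) + 1)))) := by
        gcongr
        · exact N.bd s b v h0 h1
        · exact KK_bound k b v δ hδ hδ1 hb
    _ = _ := by
        rw [show -((k : ℝ) + 1 - r) = r + (-((k : ℝ) + 1)) by ring, Real.rpow_add (by positivity)]
        ring

lemma Nice.line_int {h : ℂ → ℂ} {A r : ℝ} (N : Nice h A r) (s : ℂ) (b x : ℝ) (hx : 0 < x)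
    (h0 : 0 ≤ s.re + b) (h1 : s.re + b ≤ 5 / 2) (k : ℕ) (hk : r < k) (δ : ℝ) (hδ : 0 < δ) (hδ1 : δ ≤ 1)
    (hb : ∀ j : ℕ, δ ≤ |b + j|) :
    Integrable fun v : ℝ => h (s + (b + v * I)) * ((x : ℂ) ^ (b + v * I : ℂ) * KK k (b + v * I)) := by
  refine ((int_jap ((k : ℝ) + 1 - r) (by linarith)).const_mul _).mono'
    (N.line_cont s b x hx h0 k fun j hj => ?_).aestronglyMeasurable
    (Eventually.of_forall fun v => N.line_bd s b x hx h0 h1 k δ hδ hδ1 hb v)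
  have := hb j; rw [hj] at this; simp at this; linarith

/-- The integrand times `w`. -/
noncomputable def PH (h : ℂ → ℂ) (s : ℂ) (x : ℝ) (k : ℕ) (w : ℂ) : ℂ :=
  h (s + w) * ((x : ℂ) ^ w * ((k.factorial : ℂ) / ∏ j ∈ Finset.range k, (w + ((j + 1 : ℕ) : ℂ))))

lemma PH_zero (h : ℂ → ℂ) (s : ℂ) (x : ℝ) (k : ℕ) : PH h s x k 0 = h s := by
  unfold PH
  have : ∏ j ∈ Finset.range k, ((0 : ℂ) + ((j + 1 : ℕ) : ℂ)) = (k.factorial : ℂ) := by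
    rw [← Finset.prod_range_add_one_eq_factorial]
    push_cast; simp
  rw [this, div_self (by exact_mod_cast k.factorial_ne_zero)]
  simp

lemma PH_div (h : ℂ → ℂ) (s : ℂ) (x : ℝ) (k : ℕ) (w : ℂ) :
    PH h s x k w / w = h (s + w) * ((x : ℂ) ^ w * KK k w) := by
  unfold PH KK
  rw [Finset.prod_range_succ', Nat.cast_zero, add_zero, ← div_div]
  ring

lemma PH_dslope (h : ℂ → ℂ) (s : ℂ) (x : ℝ) (k : ℕ) (w : ℂ) (hw : w ≠ 0) :
    dslope (PH h s x k) 0 w = h (s + w) * ((x : ℂ) ^ w * KK k w) - h s * (1 / w) := by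
  rw [dslope_of_ne _ hw, slope_def_field, PH_zero, ← PH_div]
  simp; ring

lemma Nice.shift {h : ℂ → ℂ} {A r : ℝ} (N : Nice h A r) (s : ℂ) (σ₀ x : ℝ) (hσ₀ : 0 < σ₀)
    (hσ₀' : σ₀ < 1) (hx : 1 ≤ x) (hs : σ₀ ≤ s.re) (hs' : s.re ≤ 3 / 2) (k : ℕ) (hk : r < k) :
    LI k s x h = h s + (1 / (2 * Real.pi) : ℂ) * ∫ v : ℝ, h (s + (((-σ₀ : ℝ) : ℂ) + v * I)) *
      ((x : ℂ) ^ (((-σ₀ : ℝ) : ℂ) + v * I : ℂ) * KK k (((-σ₀ : ℝ) : ℂ) + v * I)) := by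
  have hx0 : (x : ℂ) ≠ 0 := by exact_mod_cast (by linarith : x ≠ 0)
  set φ := PH h s x k with hφ
  set G : ℝ → ℝ → ℂ := fun b v =>
    h (s + ((b : ℂ) + v * I)) * ((x : ℂ) ^ ((b : ℂ) + v * I : ℂ) * KK k ((b : ℂ) + v * I)) with hG
  have hne : ∀ w : ℂ, -1 < w.re → ∏ j ∈ Finset.range k, (w + ((j + 1 : ℕ) : ℂ)) ≠ 0 := by
    intro w hw
    refine Finset.prod_ne_zero_iff.2 fun j _ hj => ?_
    have := congrArg Complex.re hj
    simp at this
    have : (0 : ℝ) ≤ j := by positivity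
    linarith
  have hφd : DifferentiableOn ℂ φ {w : ℂ | -σ₀ < w.re} := by
    apply DifferentiableOn.mul
    · exact N.diff.comp (by fun_prop) (fun w hw => by
        simp only [mem_ofPred_eq, add_re] at hw ⊢; linarith)
    · apply DifferentiableOn.mul
      · exact (DifferentiableOn.const_cpow differentiableOn_id (Or.inl hx0))
      · apply DifferentiableOn.div (by fun_prop)
        · apply DifferentiableOn.fun_finsetProd
          intro j _; fun_prop
        · intro w hw
          exact hne w (by simp only [mem_ofPred_eq] at hw; linarith)
  have hφc : ContinuousOn φ {w : ℂ | -σ₀ ≤ w.re} := by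
    apply ContinuousOn.mul
    · exact N.cont.comp (by fun_prop) (fun w hw => by
        simp only [mem_ofPred_eq, add_re] at hw ⊢; linarith)
    · apply ContinuousOn.mul
      · exact (ContinuousOn.const_cpow continuousOn_id (Or.inl hx0))
      · apply ContinuousOn.div (by fun_prop)
        · apply continuousOn_finsetProd
          intro j _; fun_prop
        · intro w hw
          exact hne w (by simp only [mem_ofPred_eq] at hw; linarith)
  have hopen : IsOpen {w : ℂ | -σ₀ < w.re} := isOpen_lt continuous_const continuous_re
  have hmem : {w : ℂ | -σ₀ < w.re} ∈ 𝓝 (0 : ℂ) := hopen.mem_nhds (by simpa using hσ₀)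
  have hmem' : {w : ℂ | -σ₀ ≤ w.re} ∈ 𝓝 (0 : ℂ) :=
    mem_of_superset hmem fun w (hw : -σ₀ < w.re) => le_of_lt hw
  have hDd : DifferentiableOn ℂ (dslope φ 0) {w : ℂ | -σ₀ < w.re} :=
    (Complex.differentiableOn_dslope hmem).2 hφd
  have hDc : ContinuousOn (dslope φ 0) {w : ℂ | -σ₀ ≤ w.re} :=
    (continuousOn_dslope hmem').2 ⟨hφc, hφd.differentiableAt hmem⟩
  have hrect : ∀ T : ℝ, (∫ u : ℝ in (-σ₀)..1, dslope φ 0 (u + (-T : ℝ) * I)) -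
      (∫ u : ℝ in (-σ₀)..1, dslope φ 0 (u + T * I)) +
      I • (∫ v : ℝ in (-T)..T, dslope φ 0 ((1 : ℝ) + v * I)) -
      I • (∫ v : ℝ in (-T)..T, dslope φ 0 ((-σ₀ : ℝ) + v * I)) = 0 := by
    intro T
    have := Complex.integral_boundary_rect_eq_zero_of_continuousOn_of_differentiableOn
      (dslope φ 0) ⟨-σ₀, -T⟩ ⟨1, T⟩ (hDc.mono ?_) (hDd.mono ?_)
    · simpa using this
    · intro w hw
      have := hw.1
      simp only [mem_preimage] at this
      rw [uIcc_of_le (by linarith)] at this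
      exact this.1
    · intro w hw
      have := hw.1
      simp only [mem_preimage] at this
      rw [min_eq_left (by linarith)] at this
      exact this.1
  -- vertical sides
  have hvert : ∀ b : ℝ, b ≠ 0 → Integrable (G b) → Tendsto
      (fun T : ℝ => ∫ v : ℝ in (-T)..T, dslope φ 0 (b + v * I)) atTop
      (𝓝 ((∫ v, G b v) - h s * ((if 0 < b then Real.pi else -Real.pi : ℝ) : ℂ))) := by
    intro b hb hi
    have hwne : ∀ v : ℝ, (b : ℂ) + v * I ≠ 0 := fun v h => by
      have := congrArg Complex.re h; simp at this; exact hb this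
    have e : ∀ T : ℝ, ∫ v : ℝ in (-T)..T, dslope φ 0 (b + v * I) =
        (∫ v : ℝ in (-T)..T, G b v) - h s * ∫ v in (-T)..T, (1 / ((b : ℂ) + v * I) : ℂ) := by
      intro T
      have hc : Continuous fun v : ℝ => (1 / ((b : ℂ) + v * I) : ℂ) :=
        Continuous.div continuous_const (by fun_prop) hwne
      rw [← intervalIntegral.integral_const_mul, ← intervalIntegral.integral_sub
        hi.intervalIntegrable ((hc.intervalIntegrable _ _).const_mul _)]
      congr 1; ext v
      rw [hφ, PH_dslope _ _ _ _ _ (hwne v)]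
    simp_rw [e]
    exact (intervalIntegral_tendsto_integral hi tendsto_neg_atTop_atBot tendsto_id).sub
      ((tendsto_inv_line b hb).const_mul _)
  -- horizontal sides
  set D : ℝ := A * ((1 + |s.im|) ^ r * 2 ^ r) * (x * k.factorial) + ‖h s‖ with hD
  have hhor : ∀ T : ℝ, 1 ≤ |T| → ‖∫ u : ℝ in (-σ₀)..1, dslope φ 0 (u + T * I)‖ ≤ D * |T|⁻¹ * |1 - (-σ₀)| := by
    intro T hT
    apply intervalIntegral.norm_integral_le_of_norm_le_const
    intro u hu
    rw [uIoc_of_le (by linarith)] at hu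
    have hT0 : 0 < |T| := by linarith
    have hTne : (u : ℂ) + T * I ≠ 0 := fun h => by
      have := congrArg Complex.im h; simp at this; simp [this] at hT0
    have hTn : |T| ≤ ‖(u : ℂ) + T * I‖ := by
      simpa using Complex.abs_im_le_norm ((u : ℂ) + T * I)
    rw [hφ, PH_dslope _ _ _ _ _ hTne]
    refine (norm_sub_le _ _).trans ?_
    rw [hD, add_mul]
    have hA := N.hA
    apply add_le_add
    · rw [norm_mul, norm_mul, Complex.norm_cpow_eq_rpow_re_of_pos (by linarith)]
      have e : ((u : ℂ) + T * I).re = u := by simp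
      rw [e]
      calc _ ≤ (A * ((1 + |s.im|) ^ r * (1 + |T|) ^ r)) *
            (x * (k.factorial * |T| ^ (-((k : ℝ) + 1)))) := by
            gcongr
            · exact N.bd s u T (by linarith [hu.1]) (by linarith [hu.2])
            · exact (Real.rpow_le_rpow_of_exponent_le hx hu.2).trans_eq (Real.rpow_one x)
            · exact KK_bound_im k u T hT0
        _ ≤ (A * ((1 + |s.im|) ^ r * (2 ^ r * |T| ^ r))) *
            (x * (k.factorial * |T| ^ (-((k : ℝ) + 1)))) := by
            rw [← Real.mul_rpow (by norm_num) hT0.le]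
            gcongr
            · exact N.hr
            · linarith
        _ = A * ((1 + |s.im|) ^ r * 2 ^ r) * (x * k.factorial) * |T| ^ (r - ((k : ℝ) + 1)) := by
            rw [sub_eq_add_neg, Real.rpow_add hT0]; ring
        _ ≤ A * ((1 + |s.im|) ^ r * 2 ^ r) * (x * k.factorial) * |T|⁻¹ := by
            rw [← Real.rpow_neg_one]
            gcongr
            linarith
    · rw [norm_mul, norm_div, norm_one, one_div]
      gcongr
  have hlim0 : Tendsto (fun T : ℝ => D * |T|⁻¹ * |1 - (-σ₀)|) atTop (𝓝 0) := by
    have := ((tendsto_inv_atTop_zero.comp tendsto_abs_atTop_atTop).const_mul D).mul_const |1 - (-σ₀)|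
    simpa using this
  have hh1 : Tendsto (fun T : ℝ => ∫ u : ℝ in (-σ₀)..1, dslope φ 0 (u + T * I)) atTop (𝓝 0) := by
    refine squeeze_zero_norm' ?_ hlim0
    filter_upwards [eventually_ge_atTop 1] with T hT
    exact hhor T (hT.trans (le_abs_self T))
  have hh2 : Tendsto (fun T : ℝ => ∫ u : ℝ in (-σ₀)..1, dslope φ 0 (u + (-T : ℝ) * I)) atTop (𝓝 0) := by
    refine squeeze_zero_norm' ?_ hlim0
    filter_upwards [eventually_ge_atTop 1] with T hT
    have := hhor (-T) (by rw [abs_neg]; exact hT.trans (le_abs_self T))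
    rwa [abs_neg] at this
  have hI1 : Integrable (G 1) := by
    refine N.line_int s 1 x (by linarith) (by linarith) (by linarith) k hk 1 one_pos le_rfl fun j => ?_
    rw [abs_of_nonneg (by positivity)]
    have : (0 : ℝ) ≤ j := by positivity
    linarith
  have hI2 : Integrable (G (-σ₀)) := by
    refine N.line_int s (-σ₀) x (by linarith) (by linarith) (by linarith) k hk (min σ₀ (1 - σ₀))
      (lt_min hσ₀ (by linarith)) ((min_le_left _ _).trans hσ₀'.le) fun j => ?_
    rcases Nat.eq_zero_or_pos j with rfl | hj
    · refine (min_le_left _ _).trans ?_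
      simp [abs_of_pos hσ₀]
    · refine (min_le_right _ _).trans (le_trans ?_ (le_abs_self _))
      have : (1 : ℝ) ≤ j := by exact_mod_cast hj
      linarith
  have hfin := ((hh2.sub hh1).add ((hvert 1 one_ne_zero hI1).const_smul I)).sub
    ((hvert (-σ₀) (by linarith) hI2).const_smul I)
  have hfin0 := tendsto_nhds_unique hfin (tendsto_const_nhds.congr fun T => (hrect T).symm)
  rw [if_pos one_pos, if_neg (by linarith)] at hfin0
  simp only [sub_zero, zero_add, smul_eq_mul] at hfin0
  have hfin1 : (∫ v, G 1 v) = (∫ v, G (-σ₀) v) + 2 * Real.pi * h s := by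
    have : I * ((∫ v, G 1 v) - ((∫ v, G (-σ₀) v) + 2 * Real.pi * h s)) = 0 := by
      rw [← hfin0]; push_cast; ring
    exact sub_eq_zero.1 ((mul_eq_zero.1 this).resolve_left I_ne_zero)
  have hpi : (Real.pi : ℂ) ≠ 0 := by exact_mod_cast Real.pi_ne_zero
  have hLI : LI k s x h = (1 / (2 * Real.pi) : ℂ) * ∫ v, G 1 v := by
    unfold LI; simp [hG]
  rw [hLI, hfin1, mul_add, add_comm]
  congr 1
  field_simp

lemma Nice.final {h : ℂ → ℂ} {A r : ℝ} (N : Nice h A r) (hr : 0 < r) (σ₀ : ℝ) (hσ₀ : 0 < σ₀)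
    (hσ₀' : σ₀ < 1) (k : ℕ) (hk : r < k) :
    ∃ C : ℝ, ∀ x : ℝ, 1 ≤ x → ∀ s : ℂ, σ₀ ≤ s.re → s.re ≤ 3 / 2 → 1 ≤ s.im → s.im ≤ x ^ (σ₀ / r) →
      ‖LI k s x h - h s‖ ≤ C := by
  have hA := N.hA
  set δ := min σ₀ (1 - σ₀) with hδ
  have hδ0 : 0 < δ := lt_min hσ₀ (by linarith)
  set J := ∫ v : ℝ, (1 + |v|) ^ (-((k : ℝ) + 1 - r)) with hJ
  have hJ0 : 0 ≤ J := integral_nonneg fun v => by positivity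
  refine ⟨‖(1 / (2 * Real.pi) : ℂ)‖ * ((A * 2 ^ r * (k.factorial * (2 / δ) ^ (k + 1))) * J),
    fun x hx s hs hs' ht ht' => ?_⟩
  have hx0 : 0 < x := by linarith
  rw [N.shift s σ₀ x hσ₀ hσ₀' hx hs hs' k hk, add_sub_cancel_left, norm_mul]
  gcongr
  have h1 := norm_integral_le_of_norm_le
    ((int_jap ((k : ℝ) + 1 - r) (by linarith)).const_mul _)
    (Eventually.of_forall (N.line_bd s (-σ₀) x hx0 (by linarith) (by linarith) k δ hδ0
      ((min_le_left _ _).trans hσ₀'.le) (fun j => by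
        rcases Nat.eq_zero_or_pos j with rfl | hj
        · refine (min_le_left _ _).trans ?_
          simp [abs_of_pos hσ₀]
        · refine (min_le_right _ _).trans (le_trans ?_ (le_abs_self _))
          have : (1 : ℝ) ≤ j := by exact_mod_cast hj
          linarith)))
  refine h1.trans ?_
  rw [integral_const_mul, ← hJ]
  refine mul_le_mul_of_nonneg_right ?_ hJ0
  have h2 : (1 + |s.im|) ^ r * x ^ (-σ₀) ≤ 2 ^ r := by
    have h3 : (1 + |s.im|) ^ r ≤ (2 * x ^ (σ₀ / r)) ^ r := by
      gcongr
      rw [abs_of_pos (by linarith)]; linarith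
    rw [Real.mul_rpow (by norm_num) (by positivity), ← Real.rpow_mul hx0.le,
      div_mul_cancel₀ _ hr.ne'] at h3
    calc _ ≤ 2 ^ r * x ^ σ₀ * x ^ (-σ₀) := by gcongr
      _ = 2 ^ r := by rw [mul_assoc, ← Real.rpow_add hx0]; simp
  calc _ = A * ((1 + |s.im|) ^ r * x ^ (-σ₀)) * (k.factorial * (2 / δ) ^ (k + 1)) := by ring
    _ ≤ _ := by gcongr

end SPS

namespace SPS
open MeasureTheory Set Topology

lemma fstar_eq (a lam : ℕ → ℝ) (f : ℂ → ℂ) (ha : ∀ n, 0 < a n) (hlam : ∀ n, 0 < lam n)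
    (htop : Tendsto lam atTop atTop)
    (habs : ∀ s : ℂ, 1 < s.re → Summable fun n => a n * lam n ^ (-s.re))
    (hf : ∀ s : ℂ, 1 < s.re → f s = ∑' n, (a n : ℂ) * ((lam n : ℂ) ^ (-s)))
    (k : ℕ) (hk : 1 ≤ k) (x : ℝ) (hx : 0 < x) (s : ℂ) (hs : 0 < s.re) :
    (∑' n, ((if lam n ≤ x then a n * (1 - lam n / x)^k else 0 : ℝ) : ℂ)
              * ((lam n : ℂ) ^ (-s))) = LI k s x f := by
  have hsum1 := habs (s + 1) (by simp [hs])
  have hfub := fubini (Measure.count : Measure ℕ) a lam (measurable_of_countable _)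
    (measurable_of_countable _) hlam k hk s x hx (by
      rw [integrable_count_iff]
      refine hsum1.congr fun n => ?_
      rw [Real.norm_of_nonneg (mul_nonneg (ha n).le (Real.rpow_nonneg (hlam n).le _))]
      simp)
  have hcnt : ∀ g : ℕ → ℂ, Summable (fun n => ‖g n‖) →
      ∫ n, g n ∂(Measure.count : Measure ℕ) = ∑' n, g n := by
    intro g hg
    rw [integral_countable (integrable_count_iff.2 hg)]
    simp [Measure.real]
  have hterm : ∀ n, (if lam n ≤ x then a n * (1 - lam n / x)^k else 0 : ℝ) = a n * MM k (lam n / x) := by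
    intro n
    split_ifs with h
    · have : lam n / x ≤ 1 := (div_le_one hx).2 h
      unfold MM
      rw [max_eq_right (by linarith)]
    · have : 1 ≤ lam n / x := (one_le_div hx).2 (not_le.1 h).le
      rw [MM_zero k hk _ this, mul_zero]
  rw [hcnt] at hfub
  · simp_rw [hterm]
    rw [hfub]
    unfold LI
    congr 2
    ext v
    have hz : 1 < (s + (1 + v * I)).re := by simp [hs]
    rw [hf _ hz]
    beta_reduce
    rw [hcnt]
    refine (habs _ hz).congr fun n => ?_
    rw [norm_mul, Complex.norm_cpow_eq_rpow_re_of_pos (hlam n), Complex.norm_real,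
      Real.norm_of_nonneg (ha n).le, neg_re]
  · obtain ⟨M, hM⟩ := eventually_atTop.1 (htop.eventually_ge_atTop x)
    refine summable_of_ne_finset_zero (s := Finset.range M) fun n hn => ?_
    have h1 : x ≤ lam n := hM n (by simpa using hn)
    rw [MM_zero k hk _ ((one_le_div hx).2 h1)]
    simp

lemma f_bd (a lam : ℕ → ℝ) (f : ℂ → ℂ) (ha : ∀ n, 0 < a n) (hlam : ∀ n, 0 < lam n)
    (habs : ∀ s : ℂ, 1 < s.re → Summable fun n => a n * lam n ^ (-s.re))
    (hf : ∀ s : ℂ, 1 < s.re → f s = ∑' n, (a n : ℂ) * ((lam n : ℂ) ^ (-s))) :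
    ∃ M : ℝ, 0 ≤ M ∧ ∀ z : ℂ, 3 / 2 ≤ z.re → z.re ≤ 5 / 2 → ‖f z‖ ≤ M := by
  have h1 : Summable fun n => a n * lam n ^ (-(3 / 2 : ℝ)) := by
    simpa using habs ((3 / 2 : ℝ) : ℂ) (by rw [ofReal_re]; norm_num)
  have h2 : Summable fun n => a n * lam n ^ (-(5 / 2 : ℝ)) := by
    simpa using habs ((5 / 2 : ℝ) : ℂ) (by rw [ofReal_re]; norm_num)
  refine ⟨∑' n, (a n * lam n ^ (-(3 / 2 : ℝ)) + a n * lam n ^ (-(5 / 2 : ℝ))), ?_, fun z hz hz' => ?_⟩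
  · refine tsum_nonneg fun n => ?_
    have := ha n; have := hlam n
    positivity
  · rw [hf z (by linarith)]
    refine tsum_of_norm_bounded (h1.add h2).hasSum fun n => ?_
    rw [norm_mul, Complex.norm_cpow_eq_rpow_re_of_pos (hlam n), Complex.norm_real,
      Real.norm_of_nonneg (ha n).le, neg_re, ← mul_add]
    have hl := hlam n
    refine mul_le_mul_of_nonneg_left ?_ (ha n).le
    rcases le_total 1 (lam n) with h | h
    · have := Real.rpow_le_rpow_of_exponent_le h (show -z.re ≤ -(3 / 2) by linarith)
      have : 0 ≤ lam n ^ (-(5 / 2 : ℝ)) := by positivity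
      linarith
    · have := Real.rpow_le_rpow_of_exponent_ge hl h (show -(5 / 2) ≤ -z.re by linarith)
      have : 0 ≤ lam n ^ (-(3 / 2 : ℝ)) := by positivity
      linarith

lemma span_good {σ₀ : ℝ} (hσ₀ : 0 < σ₀) (hσ₀' : σ₀ < 1) {k : ℕ} (hk : 1 ≤ k) (P : ℂ → ℂ)
    (hP : P ∈ Submodule.span ℂ {g : ℂ → ℂ | ∃ (p : ℝ) (i : ℕ), 0 < p ∧ (p < 1 ∨ (p = 1 ∧ i = 0)) ∧
      g = fun z : ℂ => 1 / (z - p) ^ (i + 1)}) : Good σ₀ k P := by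
  induction hP using Submodule.span_induction with
  | mem g hg =>
    obtain ⟨p, i, hp, hpi, rfl⟩ := hg
    exact Good.atom hσ₀ hσ₀' hk p hp i hpi
  | zero => exact Good.zero σ₀ k
  | add g g' _ _ h h' => exact Good.add hσ₀ hk h h'
  | smul c g _ h => exact Good.smul c h

end SPS

theorem smoothed_partial_sum_approximation
    (a lam : ℕ → ℝ) (f : ℂ → ℂ) (r C₀ t₀ ares : ℝ) (K : ℕ) (ρ : Fin K → ℝ)
    (ha : ∀ n, 0 < a n) (hlam : ∀ n, 0 < lam n)
    (hmono : StrictMono lam) (htop : Tendsto lam atTop atTop)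
    (habs : ∀ s : ℂ, 1 < s.re → Summable fun n => a n * lam n ^ (-s.re))
    (hf : ∀ s : ℂ, 1 < s.re → f s = ∑' n, (a n : ℂ) * ((lam n : ℂ) ^ (-s)))
    (hρ : ∀ j, ρ j ∈ Set.Ioo (0:ℝ) 1)
    (hholo : DifferentiableOn ℂ f
      ({s : ℂ | 0 < s.re} \ ({1} ∪ Set.range fun j => ((ρ j : ℝ) : ℂ))))
    (hares : 0 < ares)
    (hpole1 : Tendsto (fun s : ℂ => (s - 1) * f s) (nhdsWithin 1 {(1:ℂ)}ᶜ)
      (nhds (ares : ℂ)))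
    (hord : ∀ j, ∃ (m : ℕ) (L : ℂ), Tendsto (fun s : ℂ => (s - (ρ j : ℂ)) ^ m * f s)
      (nhdsWithin ((ρ j : ℝ) : ℂ) {((ρ j : ℝ) : ℂ)}ᶜ) (nhds L))
    (hcont : ContinuousOn f {s : ℂ | 0 ≤ s.re ∧ s ≠ 1 ∧ ∀ j, s ≠ ((ρ j : ℝ) : ℂ)})
    (hr : 1 ≤ r) (hC₀ : 0 < C₀) (ht₀ : 1 ≤ t₀)
    (hgrowth : ∀ σ t : ℝ, 0 ≤ σ → σ < 3/2 → t₀ ≤ |t| →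
      ‖f (σ + t * Complex.I)‖ ≤ C₀ * |t| ^ r)
    (σ₀ : ℝ) (hσ₀ : 0 < σ₀) (hσ₀' : σ₀ < 1) (k : ℕ) (hk : r < (k : ℝ)) :
    ∃ C : ℝ, 0 < C ∧ ∀ x : ℝ, 2 ≤ x → ∀ σ t : ℝ,
      σ₀ ≤ σ → σ ≤ 3/2 → x ^ ((1 - σ₀)/(k + 1)) ≤ t → t ≤ x ^ (σ₀/r) →
      ‖
          ((∑' n, ((if lam n ≤ x then a n * (1 - lam n / x)^k else 0 : ℝ) : ℂ)
              * ((lam n : ℂ) ^ (-(σ + t * Complex.I))))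
            - f (σ + t * Complex.I) : ℂ)‖ ≤ C := by
  have hk1 : 1 ≤ k := by
    have : (1 : ℝ) < k := by linarith
    exact_mod_cast this.le
  set S : Finset ℂ := insert 1 (Finset.univ.image fun j => ((ρ j : ℝ) : ℂ)) with hS
  have hSm : ∀ z : ℂ, z ∈ S ↔ z = 1 ∨ ∃ j, ((ρ j : ℝ) : ℂ) = z := by
    intro z; simp [hS]
  have hSc : (S : Set ℂ) = {1} ∪ Set.range fun j => ((ρ j : ℝ) : ℂ) := by
    ext z; simp [hS]
  have hSre : ∀ z ∈ S, 0 < z.re ∧ z.re ≤ 1 ∧ z.im = 0 := by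
    intro z hz
    rcases (hSm z).1 hz with rfl | ⟨j, rfl⟩
    · simp
    · refine ⟨?_, ?_, ofReal_im _⟩
      · rw [ofReal_re]; exact (hρ j).1
      · rw [ofReal_re]; exact (hρ j).2.le
  have hUo : IsOpen {z : ℂ | 0 < z.re} := isOpen_lt continuous_const continuous_re
  obtain ⟨P, hPV, h, hhd, hhP⟩ := SPS.laurent_all
    (Submodule.span ℂ {g : ℂ → ℂ | ∃ (p : ℝ) (i : ℕ), 0 < p ∧ (p < 1 ∨ (p = 1 ∧ i = 0)) ∧
      g = fun z : ℂ => 1 / (z - p) ^ (i + 1)}) {z : ℂ | 0 < z.re} hUo S f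
    (fun p hp => (hSre p hp).1) (by rw [hSc]; exact hholo) (by
      intro p hp
      rcases (hSm p).1 hp with rfl | ⟨j, rfl⟩
      · refine ⟨1, ares, by simpa using hpole1, fun i hi => Submodule.subset_span ?_⟩
        refine ⟨1, i, one_pos, Or.inr ⟨rfl, by omega⟩, by simp⟩
      · obtain ⟨m, L, hL⟩ := hord j
        refine ⟨m, L, hL, fun i hi => Submodule.subset_span ?_⟩
        exact ⟨ρ j, i, (hρ j).1, Or.inl (hρ j).2, rfl⟩)
  have hG := SPS.span_good hσ₀ hσ₀' hk1 P hPV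
  obtain ⟨hPc, ⟨B, hB⟩, ⟨CP, hCP⟩⟩ := id hG
  have hhc : ContinuousOn h {z : ℂ | 0 ≤ z.re} := by
    intro z hz
    have hz0 : 0 ≤ z.re := hz
    rcases hz0.lt_or_eq with hlt | heq
    · exact (hhd.differentiableAt (hUo.mem_nhds hlt)).continuousAt.continuousWithinAt
    · have hzS : z ∉ S := fun hzS => by have := (hSre z hzS).1; linarith
      have hSn : ((S : Set ℂ))ᶜ ∈ nhds z := S.finite_toSet.isClosed.isOpen_compl.mem_nhds hzS
      have h1 : ContinuousWithinAt f {z : ℂ | 0 ≤ z.re} z := by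
        have hzz : z ≠ 1 ∧ ∀ j, z ≠ ((ρ j : ℝ) : ℂ) := by
          rw [hSm] at hzS; push Not at hzS
          exact ⟨hzS.1, fun j hj => hzS.2 j hj.symm⟩
        refine (hcont z ⟨hz0, hzz⟩).mono_of_mem_nhdsWithin ?_
        filter_upwards [self_mem_nhdsWithin, nhdsWithin_le_nhds hSn] with w hw hw'
        have hw2 : w ∉ S := hw'
        rw [hSm] at hw2; push Not at hw2
        exact ⟨hw, hw2.1, fun j hj => hw2.2 j hj.symm⟩
      have h2 : ContinuousWithinAt (fun w => f w - P w) {z : ℂ | 0 ≤ z.re} z :=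
        h1.sub (hPc z (Or.inl heq.symm.le)).continuousWithinAt
      refine h2.congr_of_eventuallyEq ?_ (hhP z hzS)
      filter_upwards [nhdsWithin_le_nhds hSn] with w hw
      exact hhP w hw
  obtain ⟨M, hM0, hM⟩ := SPS.f_bd a lam f ha hlam habs hf
  have hcomp : IsCompact (Set.Icc (0 : ℝ) (5 / 2) ×ℂ Set.Icc (-t₀) t₀) :=
    isCompact_Icc.reProdIm isCompact_Icc
  obtain ⟨M', hM'⟩ := hcomp.exists_bound_of_continuousOn
    (hhc.mono fun z hz => (show 0 ≤ z.re from hz.1.1))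
  have hB0 : 0 ≤ B := (norm_nonneg _).trans (hB 2 (Or.inr (by simp; linarith)))
  have N : SPS.Nice h (C₀ + M + B + |M'|) r := by
    refine ⟨hhd, hhc, by positivity, by linarith, fun z hz0 hz1 => ?_⟩
    have hone : 1 ≤ (1 + |z.im|) ^ r :=
      Real.one_le_rpow (by linarith [abs_nonneg z.im]) (by linarith)
    have hM'0 := abs_nonneg M'
    rcases le_total t₀ |z.im| with ht | ht
    · have hzS : z ∉ S := fun hzS => by
        rw [(hSre z hzS).2.2] at ht; simp at ht; linarith
      have h1 : ‖f z‖ ≤ (C₀ + M) * (1 + |z.im|) ^ r := by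
        rcases lt_or_ge z.re (3 / 2) with hlt | hge
        · have := hgrowth z.re z.im hz0 hlt ht
          rw [re_add_im] at this
          have h3 : |z.im| ^ r ≤ (1 + |z.im|) ^ r := by
            gcongr
            linarith
          have := mul_le_mul_of_nonneg_left h3 hC₀.le
          have := mul_nonneg hM0 (by linarith : (0 : ℝ) ≤ (1 + |z.im|) ^ r)
          linarith
        · have := hM z hge hz1
          nlinarith
      have h2 : ‖P z‖ ≤ B := hB z (Or.inl (by linarith))
      rw [hhP z hzS]
      refine (norm_sub_le _ _).trans ?_
      nlinarith
    · have h1 := hM' z ⟨⟨hz0, hz1⟩, abs_le.1 ht⟩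
      have := le_abs_self M'
      have : 0 ≤ C₀ + M + B := by positivity
      nlinarith
  obtain ⟨CN, hCN⟩ := N.final (by linarith) σ₀ hσ₀ hσ₀' k hk
  refine ⟨|CN + CP + B| + 1, by positivity, fun x hx σ t hσ hσ' ht ht' => ?_⟩
  have hx0 : 0 < x := by linarith
  have ht1 : 1 ≤ t := le_trans (Real.one_le_rpow (by linarith)
    (div_nonneg (by linarith) (by positivity))) ht
  set s : ℂ := σ + t * I with hs
  have hsre : s.re = σ := by simp [hs]
  have hsim : s.im = t := by simp [hs]
  rw [SPS.fstar_eq a lam f ha hlam htop habs hf k hk1 x hx0 s (by rw [hsre]; linarith)]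
  have hLI : SPS.LI k s x f = SPS.LI k s x h + SPS.LI k s x P := by
    have i1 := N.line_int s 1 x hx0 (by rw [hsre]; linarith) (by rw [hsre]; linarith) k hk 1
      one_pos le_rfl (fun j => by
        rw [abs_of_nonneg (by positivity)]
        have : (0 : ℝ) ≤ j := by positivity
        linarith)
    rw [ofReal_one] at i1
    have i2 := hG.int hσ₀ hk1 s (by rw [hsre]; exact hσ) x hx0
    unfold SPS.LI
    rw [← mul_add, ← MeasureTheory.integral_add i1 i2]
    congr 2
    ext v
    have hnS : s + (1 + v * I) ∉ S := fun hz => by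
      have := (hSre _ hz).2.1
      simp [hsre] at this
      linarith
    rw [hhP _ hnS]
    ring
  have hsS : s ∉ S := fun hz => by
    have := (hSre _ hz).2.2
    rw [hsim] at this
    linarith
  have e : SPS.LI k s x f - f s = (SPS.LI k s x h - h s) + SPS.LI k s x P - P s := by
    rw [hLI, hhP s hsS]; ring
  rw [e]
  have b1 := hCN x (by linarith) s (by rw [hsre]; exact hσ) (by rw [hsre]; exact hσ')
    (by rw [hsim]; exact ht1) (by rw [hsim]; exact ht')
  have b2 := hCP x hx σ t hσ ht
  have b3 := hB s (Or.inl (by rw [hsim]; exact ht1.trans (le_abs_self t)))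
  have b4 := norm_sub_le ((SPS.LI k s x h - h s) + SPS.LI k s x P) (P s)
  have b5 := norm_add_le (SPS.LI k s x h - h s) (SPS.LI k s x P)
  have b6 := le_abs_self (CN + CP + B)
  linarith
end

section
/- Let k ≥ 1 be an integer, c > 0 a real number, and x > 0. Then (k!/(2π)) · ∫_{−∞}^{∞} x^{c+it} / ( (c+it)(c+it+1)⋯(c+it+k) ) dt equals (1 − 1/x)^k if x ≥ 1, and equals 0 if 0 < x < 1. (Here x^{c+it} = exp((c+it)·log x), and the integrand is absolutely integrable since it decays like |t|^{−(k+1)}.) -/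
open Complex

noncomputable def mpF (k : ℕ) (y : ℝ) : ℂ := ((max 0 (1 - y) : ℝ) : ℂ) ^ k

lemma mpF_cont (k : ℕ) : Continuous (mpF k) := by
  unfold mpF; fun_prop

lemma mpF_aux (k : ℕ) (hk : 1 ≤ k) (s : ℂ) :
    (fun y : ℝ => (y : ℂ) ^ (s - 1) • mpF k y) =
    fun y : ℝ => (Set.Iic 1).indicator
      (fun y : ℝ => (y : ℂ) ^ (s - 1) * (1 - (y : ℂ)) ^ (((k : ℂ) + 1) - 1)) y := by
  funext y
  by_cases h : y ≤ 1
  · rw [Set.indicator_of_mem (by exact h)]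
    simp only [mpF, smul_eq_mul, add_sub_cancel_right, cpow_natCast]
    rw [max_eq_right (by linarith)]
    push_cast; rfl
  · rw [Set.indicator_of_notMem (by exact h)]
    simp only [mpF, smul_eq_mul]
    rw [max_eq_left (by linarith)]
    simp; right; omega

lemma mpF_conv (k : ℕ) (hk : 1 ≤ k) (s : ℂ) (hs : 0 < s.re) : MellinConvergent (mpF k) s := by
  unfold MellinConvergent
  rw [mpF_aux k hk s]
  have h := betaIntegral_convergent hs (v := (k : ℂ) + 1) (by simp; positivity)
  rw [intervalIntegrable_iff_integrableOn_Ioc_of_le zero_le_one] at h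
  rw [MeasureTheory.IntegrableOn, MeasureTheory.integrable_indicator_iff measurableSet_Iic,
    MeasureTheory.IntegrableOn, MeasureTheory.Measure.restrict_restrict measurableSet_Iic,
    Set.inter_comm, Set.Ioi_inter_Iic]
  exact h

lemma mpF_mellin (k : ℕ) (hk : 1 ≤ k) (s : ℂ) (hs : 0 < s.re) :
    mellin (mpF k) s = (k.factorial : ℂ) / ∏ j ∈ Finset.range (k + 1), (s + j) := by
  rw [← betaIntegral_eval_nat_add_one_right hs]
  unfold mellin betaIntegral
  rw [mpF_aux k hk s, intervalIntegral.integral_of_le zero_le_one,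
    MeasureTheory.integral_indicator measurableSet_Iic,
    MeasureTheory.Measure.restrict_restrict measurableSet_Iic,
    Set.inter_comm, Set.Ioi_inter_Iic]

lemma mp_bound (c t : ℝ) (hc : 0 < c) (k : ℕ) (hk : 1 ≤ k) :
    c ^ 2 + t ^ 2 ≤ ‖∏ j ∈ Finset.range (k + 1), ((c : ℂ) + t * Complex.I + j)‖ := by
  have key : ∀ j : ℕ, ‖(c : ℂ) + t * Complex.I + j‖ = Real.sqrt ((c + j) ^ 2 + t ^ 2) := by
    intro j
    rw [← Complex.norm_add_mul_I]
    congr 1; push_cast; ring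
  induction k, hk using Nat.le_induction with
  | base =>
    rw [Finset.prod_range_succ, Finset.prod_range_one, norm_mul, key, key]
    have h1 : Real.sqrt (c ^ 2 + t ^ 2) ≤ Real.sqrt ((c + (0 : ℕ)) ^ 2 + t ^ 2) := by simp
    have h2 : Real.sqrt (c ^ 2 + t ^ 2) ≤ Real.sqrt ((c + (1 : ℕ)) ^ 2 + t ^ 2) := by
      apply Real.sqrt_le_sqrt; push_cast; nlinarith
    calc c ^ 2 + t ^ 2 = Real.sqrt (c ^ 2 + t ^ 2) * Real.sqrt (c ^ 2 + t ^ 2) :=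
          (Real.mul_self_sqrt (by positivity)).symm
      _ ≤ _ := by gcongr
  | succ k hk ih =>
    rw [Finset.prod_range_succ, norm_mul]
    have : 1 ≤ ‖(c : ℂ) + t * Complex.I + (k + 1 : ℕ)‖ := by
      rw [key, Real.one_le_sqrt]
      have : (0 : ℝ) ≤ k := by positivity
      push_cast; nlinarith [sq_nonneg t]
    exact ih.trans (le_mul_of_one_le_right (norm_nonneg _) this)

lemma mp_vert (k : ℕ) (hk : 1 ≤ k) (c : ℝ) (hc : 0 < c) :
    VerticalIntegrable (mellin (mpF k)) c := by
  unfold VerticalIntegrable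
  have he : (fun t : ℝ => mellin (mpF k) (c + t * I)) = fun t : ℝ =>
      (k.factorial : ℂ) / ∏ j ∈ Finset.range (k + 1), ((c : ℂ) + t * Complex.I + j) := by
    funext t
    exact mpF_mellin k hk _ (by simpa using hc)
  rw [he]
  have hne : ∀ t : ℝ, ∏ j ∈ Finset.range (k + 1), ((c : ℂ) + t * Complex.I + j) ≠ 0 := by
    intro t h
    have := mp_bound c t hc k hk
    rw [h, norm_zero] at this
    nlinarith [sq_nonneg t, pow_pos hc 2]
  have hcont : Continuous fun t : ℝ =>
      (k.factorial : ℂ) / ∏ j ∈ Finset.range (k + 1), ((c : ℂ) + t * Complex.I + j) := by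
    apply Continuous.div continuous_const (by fun_prop) hne
  have hi := ((integrable_inv_one_add_sq.comp_div hc.ne').const_mul (k.factorial / c ^ 2 : ℝ))
  refine hi.mono' hcont.aestronglyMeasurable (Filter.Eventually.of_forall fun t => ?_)
  rw [norm_div, Complex.norm_natCast]
  have : (k.factorial / c ^ 2 : ℝ) * (1 + (t / c) ^ 2)⁻¹ = k.factorial / (c ^ 2 + t ^ 2) := by
    field_simp
  rw [this]
  have := mp_bound c t hc k hk
  gcongr

/-- Mellin–Perron kernel identity. For an integer `k ≥ 1`, `c > 0` and
`x > 0`, one has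
`(k!/(2π)) ∫_{-∞}^{∞} x^{c+it} / ((c+it)(c+it+1)⋯(c+it+k)) dt = (1-1/x)^k` if `x ≥ 1`
and `= 0` if `0 < x < 1`. -/
theorem mellin_perron_kernel (k : ℕ) (hk : 1 ≤ k) (c x : ℝ) (hc : 0 < c) (hx : 0 < x) :
    ((k.factorial : ℂ) / (2 * Real.pi)) *
        ∫ t : ℝ, (x : ℂ) ^ ((c : ℂ) + t * Complex.I) /
          ∏ j ∈ Finset.range (k + 1), ((c : ℂ) + t * Complex.I + j)
      = if 1 ≤ x then ((1 - 1/x : ℝ) : ℂ) ^ k else 0 := by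
  have h := mellinInv_mellin_eq c (mpF k) (inv_pos.2 hx) (mpF_conv k hk c (by simpa using hc))
    (mp_vert k hk c hc) (mpF_cont k).continuousAt
  have hr : mpF k x⁻¹ = if 1 ≤ x then ((1 - 1/x : ℝ) : ℂ) ^ k else 0 := by
    unfold mpF
    split_ifs with h1
    · rw [max_eq_right (by have := inv_le_one_of_one_le₀ h1; linarith), one_div]
    · rw [max_eq_left (by have := (one_lt_inv₀ hx).2 (not_le.1 h1); linarith)]
      simp; omega
  rw [← hr, ← h, mellinInv]
  have he : ∀ t : ℝ, ((x⁻¹ : ℝ) : ℂ) ^ (-((c : ℂ) + t * I)) • mellin (mpF k) (c + t * I) =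
      (k.factorial : ℂ) * ((x : ℂ) ^ ((c : ℂ) + t * Complex.I) /
          ∏ j ∈ Finset.range (k + 1), ((c : ℂ) + t * Complex.I + j)) := by
    intro t
    rw [mpF_mellin k hk _ (by simpa using hc), ofReal_inv, cpow_neg, inv_cpow, inv_inv, smul_eq_mul]
    · ring
    · rw [arg_ofReal_of_nonneg hx.le]; exact Real.pi_pos.ne
  simp_rw [he]
  rw [MeasureTheory.integral_const_mul, real_smul]
  push_cast
  ring
end

section
/- There is an absolute constant C > 0 with the following property. For every N ∈ ℕ, every family of nonnegative reals b_1, …, b_N, every family of positive reals λ_1, …, λ_N, and every T > 0: ∫_{−T}^{T} | Σ_{n=1}^N b_n·λ_n^{−it} |² dt ≤ C·T·Σ_{n=1}^N Σ_{m : |log(λ_m/λ_n)| ≤ 1/T} b_n·b_m. -/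
open Complex

lemma aux_normsq {N : ℕ} (b lam : Fin N → ℝ) (hl : ∀ n, 0 < lam n) (t : ℝ) :
    (‖(∑ n, (b n : ℂ) * ((lam n : ℂ) ^ (-(t : ℂ) * Complex.I)))‖)^2 =
      ∑ n, ∑ m, b n * b m * Real.cos ((Real.log (lam m / lam n)) * t) := by
  have h1 : ∀ n, (b n : ℂ) * ((lam n : ℂ) ^ (-(t : ℂ) * Complex.I)) =
      ((b n * Real.cos (Real.log (lam n) * t) : ℝ) : ℂ)
        + ((-(b n * Real.sin (Real.log (lam n) * t)) : ℝ) : ℂ) * Complex.I := by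
    intro n
    rw [Complex.cpow_def_of_ne_zero (by exact_mod_cast (hl n).ne'), ← Complex.ofReal_log (hl n).le]
    have : ((Real.log (lam n) : ℝ) : ℂ) * (-(t : ℂ) * Complex.I)
        = ((-(Real.log (lam n) * t) : ℝ) : ℂ) * Complex.I := by push_cast; ring
    rw [this, Complex.exp_mul_I, ← Complex.ofReal_cos, ← Complex.ofReal_sin, Real.cos_neg,
      Real.sin_neg]
    push_cast; ring
  simp_rw [h1]
  rw [Finset.sum_add_distrib, ← Finset.sum_mul, ← Complex.ofReal_sum, ← Complex.ofReal_sum,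
    ← Complex.normSq_eq_norm_sq, Complex.normSq_add_mul_I, sq, sq, Finset.sum_mul_sum,
    Finset.sum_mul_sum, ← Finset.sum_add_distrib]
  refine Finset.sum_congr rfl fun n _ => ?_
  rw [← Finset.sum_add_distrib]
  refine Finset.sum_congr rfl fun m _ => ?_
  rw [Real.log_div (hl m).ne' (hl n).ne', sub_mul, Real.cos_sub]
  ring

lemma aux_gauss (T d : ℝ) (hT : 0 < T) :
    MeasureTheory.Integrable (fun t : ℝ => Real.exp (-(1/T^2) * t^2) * Real.cos (d * t)) ∧
    ∫ t : ℝ, Real.exp (-(1/T^2) * t^2) * Real.cos (d * t)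
      = T * Real.sqrt Real.pi * Real.exp (-(T*d)^2/4) := by
  have hb : 0 < 1/T^2 := by positivity
  have hi := integrable_exp_neg_mul_sq hb
  constructor
  · refine hi.mul_bdd (c := 1) (by fun_prop) (Filter.Eventually.of_forall fun t => ?_)
    exact Real.abs_cos_le_one _
  · have h := fourierIntegral_gaussian (b := ((1/T^2 : ℝ) : ℂ)) (by rw [Complex.ofReal_re]; exact hb) (d : ℂ)
    have hint : MeasureTheory.Integrable (fun x : ℝ =>
        cexp (I * d * x) * cexp (-((1/T^2 : ℝ) : ℂ) * x^2)) := by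
      have h2 : MeasureTheory.Integrable (fun x : ℝ => cexp (-((1/T^2 : ℝ) : ℂ) * x^2)) :=
        integrable_cexp_neg_mul_sq (by rw [Complex.ofReal_re]; exact hb)
      refine h2.bdd_mul (c := 1) (by fun_prop) (Filter.Eventually.of_forall fun t => ?_)
      rw [show I * d * t = ((d*t : ℝ) : ℂ) * I by push_cast; ring, Complex.norm_exp_ofReal_mul_I]
    have h3 := congrArg Complex.re h
    rw [← Complex.reCLM_apply, ← ContinuousLinearMap.integral_comp_comm _ hint] at h3
    have e1 : ∀ x : ℝ, Complex.reCLM (cexp (I * d * x) * cexp (-((1/T^2 : ℝ) : ℂ) * x^2))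
        = Real.exp (-(1/T^2) * x^2) * Real.cos (d * x) := by
      intro x
      rw [show I * d * x = ((d*x : ℝ) : ℂ) * I by push_cast; ring,
        show -((1/T^2 : ℝ) : ℂ) * x^2 = ((-(1/T^2) * x^2 : ℝ) : ℂ) by push_cast; ring,
        ← Complex.ofReal_exp, Complex.reCLM_apply, Complex.re_mul_ofReal,
        Complex.exp_ofReal_mul_I_re, mul_comm]
    simp_rw [e1] at h3
    rw [h3]
    have e2 : ((Real.pi : ℂ) / ((1/T^2 : ℝ) : ℂ)) ^ (1/2 : ℂ)
        = ((T * Real.sqrt Real.pi : ℝ) : ℂ) := by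
      rw [show T * Real.sqrt Real.pi = (Real.pi / (1/T^2)) ^ (1/2 : ℝ) by
        rw [← Real.sqrt_eq_rpow, div_div_eq_mul_div, div_one, Real.sqrt_mul Real.pi_pos.le,
          Real.sqrt_sq hT.le, mul_comm],
        Complex.ofReal_cpow (by positivity)]
      push_cast; rfl
    have e3 : cexp (-(d:ℂ)^2 / (4 * ((1/T^2 : ℝ) : ℂ))) = ((Real.exp (-(T*d)^2/4) : ℝ) : ℂ) := by
      rw [Complex.ofReal_exp]
      congr 1
      have : (T:ℂ) ≠ 0 := by exact_mod_cast hT.ne'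
      push_cast
      field_simp
    rw [e2, e3, ← Complex.ofReal_mul, Complex.ofReal_re]

lemma aux_summable : Summable (fun j : ℤ => 1 / (1 + (j:ℝ)^2)) := by
  have h1 : Summable (fun j : ℤ => 1 / (j:ℝ)^2) := Real.summable_one_div_int_pow.2 (by norm_num)
  have h2 : Summable (fun j : ℤ => if j = 0 then (1:ℝ) else 0) := (hasSum_ite_eq 0 1).summable
  refine Summable.of_nonneg_of_le (fun j => by positivity) (fun j => ?_) (h1.add h2)
  by_cases hj : j = 0
  · simp [hj]
  · have : (0:ℝ) < (j:ℝ)^2 := by positivity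
    simp only [hj, if_false, add_zero]
    exact one_div_le_one_div_of_le this (by linarith)

lemma aux_schur {N : ℕ} (b : Fin N → ℝ) (k : Fin N → ℤ) (h : ℤ → ℝ)
    (hh : ∀ j, 0 ≤ h j) (hs : ∀ j, h (-j) = h j) (hsum : Summable h) :
    ∑ n, ∑ m, b n * b m * h (k n - k m) ≤
      (∑' j, h j) * ∑ n, ∑ m, (if k n = k m then b n * b m else 0) := by
  classical
  set K := Finset.univ.image k with hK
  set B : ℤ → ℝ := fun j => ∑ n, if k n = j then b n else 0 with hB
  have hmem : ∀ n, k n ∈ K := fun n => Finset.mem_image_of_mem _ (Finset.mem_univ n)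
  have key : ∀ g : ℤ → ℤ → ℝ, ∑ n, ∑ m, b n * b m * g (k n) (k m)
      = ∑ i ∈ K, ∑ j ∈ K, B i * B j * g i j := by
    intro g
    have e : ∀ i j, B i * B j * g i j
        = ∑ n, ∑ m, if k n = i then (if k m = j then b n * b m * g i j else 0) else 0 := by
      intro i j
      rw [hB]
      simp only
      rw [Finset.sum_mul_sum, Finset.sum_mul]
      refine Finset.sum_congr rfl fun n _ => ?_
      rw [Finset.sum_mul]
      refine Finset.sum_congr rfl fun m _ => ?_
      split_ifs <;> simp
    simp_rw [e]
    symm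
    calc _ = ∑ i ∈ K, ∑ n, ∑ m, ∑ j ∈ K,
          (if k n = i then (if k m = j then b n * b m * g i j else 0) else 0) := by
          refine Finset.sum_congr rfl fun i _ => ?_
          rw [Finset.sum_comm]
          refine Finset.sum_congr rfl fun n _ => ?_
          rw [Finset.sum_comm]
      _ = ∑ n, ∑ m, ∑ i ∈ K, ∑ j ∈ K,
          (if k n = i then (if k m = j then b n * b m * g i j else 0) else 0) := by
          rw [Finset.sum_comm]
          refine Finset.sum_congr rfl fun n _ => ?_
          rw [Finset.sum_comm]
      _ = _ := by
          refine Finset.sum_congr rfl fun n _ => Finset.sum_congr rfl fun m _ => ?_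
          rw [Finset.sum_eq_single (k n), Finset.sum_eq_single (k m)]
          · simp
          · intro j _ hj; simp [hj.symm]
          · intro hj; exact absurd (hmem m) hj
          · intro j _ hj; simp [hj.symm]
          · intro hj; exact absurd (hmem n) hj
  have k1 := key (fun i j => h (i - j))
  have k2 := key (fun i j => if i = j then 1 else 0)
  have k2' : ∑ n, ∑ m, (if k n = k m then b n * b m else 0) = ∑ i ∈ K, B i ^ 2 := by
    rw [show ∑ n, ∑ m, (if k n = k m then b n * b m else 0)
      = ∑ n, ∑ m, b n * b m * (if k n = k m then 1 else 0) by simp, k2]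
    refine Finset.sum_congr rfl fun i hi => ?_
    simp [hi, sq]
  rw [k1, k2']
  have hrow : ∀ i, ∑ j ∈ K, h (i - j) ≤ ∑' j, h j := by
    intro i
    have : ∑ j ∈ K, h (i - j) = ∑ j ∈ K.image (fun j => i - j), h j := by
      refine (Finset.sum_image (f := h) (g := fun j => i - j) (s := K) ?_).symm
      intro x _ y _ hxy
      simpa using hxy
    rw [this]
    exact hsum.sum_le_tsum _ (fun j _ => hh j)
  have hsym : ∑ i ∈ K, ∑ j ∈ K, B j ^ 2 * h (i - j) = ∑ i ∈ K, ∑ j ∈ K, B i ^ 2 * h (i - j) := by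
    rw [Finset.sum_comm]
    refine Finset.sum_congr rfl fun i _ => Finset.sum_congr rfl fun j _ => ?_
    rw [← hs, neg_sub]
  calc ∑ i ∈ K, ∑ j ∈ K, B i * B j * h (i - j)
      ≤ ∑ i ∈ K, ∑ j ∈ K, ((1/2) * (B i ^ 2 * h (i - j)) + (1/2) * (B j ^ 2 * h (i - j))) := by
        refine Finset.sum_le_sum fun i _ => Finset.sum_le_sum fun j _ => ?_
        nlinarith [mul_nonneg (sq_nonneg (B i - B j)) (hh (i - j))]
    _ = ∑ i ∈ K, ∑ j ∈ K, B i ^ 2 * h (i - j) := by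
        simp_rw [Finset.sum_add_distrib, ← Finset.mul_sum]
        simp_rw [Finset.mul_sum] at hsym ⊢
        simp_rw [← Finset.mul_sum] at hsym ⊢
        rw [hsym]; ring
    _ ≤ ∑ i ∈ K, B i ^ 2 * ∑' j, h j := by
        refine Finset.sum_le_sum fun i _ => ?_
        rw [← Finset.mul_sum]
        exact mul_le_mul_of_nonneg_left (hrow i) (sq_nonneg _)
    _ = _ := by rw [← Finset.sum_mul, mul_comm]

lemma aux_ker (u v : ℝ) :
    Real.sqrt Real.pi * Real.exp (-(v - u)^2/4) ≤
      16 * (1 / (1 + ((⌊u⌋ - ⌊v⌋ : ℤ) : ℝ)^2)) := by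
  have h1 : Real.sqrt Real.pi ≤ 2 := by
    rw [Real.sqrt_le_left (by norm_num)]; linarith [Real.pi_le_four]
  have h2 : Real.exp (-(v - u)^2/4) ≤ 4 / (4 + (v-u)^2) := by
    rw [neg_div, Real.exp_neg, ← one_div, div_le_div_iff₀ (Real.exp_pos _) (by positivity)]
    have := Real.add_one_le_exp ((v-u)^2/4)
    linarith
  have hj : ((⌊u⌋ - ⌊v⌋ : ℤ) : ℝ)^2 ≤ 2 * (v-u)^2 + 2 := by
    push_cast
    have a1 := Int.floor_le u
    have a2 := Int.lt_floor_add_one u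
    have a3 := Int.floor_le v
    have a4 := Int.lt_floor_add_one v
    set p : ℝ := (⌊u⌋ : ℝ)
    set q : ℝ := (⌊v⌋ : ℝ)
    have hr : ((p - q) - (u - v))^2 ≤ 1 := by
      rw [sq_le_one_iff_abs_le_one, abs_le]; constructor <;> linarith
    nlinarith [sq_nonneg ((p - q) - 2 * (u - v))]
  calc _ ≤ 2 * (4 / (4 + (v-u)^2)) := mul_le_mul h1 h2 (Real.exp_pos _).le (by norm_num)
    _ ≤ _ := by
      rw [mul_div_assoc', mul_one_div, div_le_div_iff₀ (by positivity) (by positivity)]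
      nlinarith

/-- mean value of Dirichlet polynomials with nonnegative coefficients.
There is an absolute constant `C > 0` such that for all `N`, all nonnegative `b₁,…,b_N`,
all positive `λ₁,…,λ_N` and all `T > 0`:
`∫_{-T}^T |Σₙ bₙ λₙ^{-it}|² dt ≤ C·T·Σₙ Σ_{m : |log(λₘ/λₙ)| ≤ 1/T} bₙ bₘ`. -/
theorem dirichlet_polynomial_mean_value :
    ∃ C : ℝ, 0 < C ∧ ∀ (N : ℕ) (b lam : Fin N → ℝ),
      (∀ n, 0 ≤ b n) → (∀ n, 0 < lam n) → ∀ T : ℝ, 0 < T →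
      (∫ t in (-T)..T,
          (‖(∑ n, (b n : ℂ) * ((lam n : ℂ) ^ (-(t : ℂ) * Complex.I)))‖)^2)
        ≤ C * T * ∑ n, ∑ m,
            (if |Real.log (lam m / lam n)| ≤ 1/T then b n * b m else 0) := by
  set H : ℝ := ∑' j : ℤ, 1 / (1 + (j:ℝ)^2) with hH
  have hH0 : 0 < H := aux_summable.tsum_pos (fun j => by positivity) 0 (by norm_num)
  refine ⟨Real.exp 1 * 16 * H, by positivity, fun N b lam hb hl T hT => ?_⟩
  set F : ℝ → ℝ := fun t =>
    ∑ n, ∑ m, b n * b m * Real.cos ((Real.log (lam m / lam n)) * t) with hF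
  have hFn : ∀ t, 0 ≤ F t := fun t => by
    rw [hF]; simp only; rw [← aux_normsq b lam hl t]; positivity
  have hint : ∀ n m, MeasureTheory.Integrable (fun t : ℝ => b n * b m *
      (Real.exp (-(1/T^2) * t^2) * Real.cos (Real.log (lam m / lam n) * t))) :=
    fun n m => ((aux_gauss T _ hT).1).const_mul _
  have hGe : (fun t => Real.exp (-(1/T^2) * t^2) * F t) = fun t => ∑ n, ∑ m, b n * b m *
      (Real.exp (-(1/T^2) * t^2) * Real.cos (Real.log (lam m / lam n) * t)) := by
    funext t
    rw [hF]
    simp_rw [Finset.mul_sum]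
    refine Finset.sum_congr rfl fun n _ => Finset.sum_congr rfl fun m _ => ?_
    ring
  have hGi : MeasureTheory.Integrable (fun t => Real.exp (-(1/T^2) * t^2) * F t) := by
    rw [hGe]
    exact MeasureTheory.integrable_finsetSum _ fun n _ =>
      MeasureTheory.integrable_finsetSum _ fun m _ => hint n m
  have hGint : ∫ t, Real.exp (-(1/T^2) * t^2) * F t = ∑ n, ∑ m, b n * b m *
      (T * Real.sqrt Real.pi * Real.exp (-(T*Real.log (lam m / lam n))^2/4)) := by
    rw [hGe, MeasureTheory.integral_finsetSum _ fun n _ =>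
      MeasureTheory.integrable_finsetSum _ fun m _ => hint n m]
    refine Finset.sum_congr rfl fun n _ => ?_
    rw [MeasureTheory.integral_finsetSum _ fun m _ => hint n m]
    refine Finset.sum_congr rfl fun m _ => ?_
    rw [MeasureTheory.integral_const_mul, (aux_gauss T _ hT).2]
  have hFc : Continuous F := by rw [hF]; fun_prop
  have step1 : (∫ t in (-T)..T,
          (‖(∑ n, (b n : ℂ) * ((lam n : ℂ) ^ (-(t : ℂ) * Complex.I)))‖)^2)
      ≤ Real.exp 1 * ∫ t, Real.exp (-(1/T^2) * t^2) * F t := by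
    simp_rw [aux_normsq b lam hl]
    calc (∫ t in (-T)..T, F t)
        ≤ ∫ t in (-T)..T, Real.exp 1 * (Real.exp (-(1/T^2) * t^2) * F t) := by
          refine intervalIntegral.integral_mono_on (by linarith)
            (hFc.intervalIntegrable _ _) (Continuous.intervalIntegrable (by fun_prop) _ _) ?_
          intro t ht
          rw [← mul_assoc, ← Real.exp_add]
          refine le_mul_of_one_le_left (hFn t) (Real.one_le_exp ?_)
          have : t^2 ≤ T^2 := sq_le_sq' ht.1 ht.2
          have : 1/T^2 * t^2 ≤ 1 := by
            rw [one_div_mul_eq_div]; exact div_le_one_of_le₀ this (by positivity)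
          linarith
      _ = Real.exp 1 * ∫ t in Set.Ioc (-T) T, Real.exp (-(1/T^2) * t^2) * F t := by
          rw [intervalIntegral.integral_const_mul, intervalIntegral.integral_of_le (by linarith)]
      _ ≤ _ := by
          refine mul_le_mul_of_nonneg_left ?_ (Real.exp_pos _).le
          exact MeasureTheory.setIntegral_le_integral hGi
            (Filter.Eventually.of_forall fun t => mul_nonneg (Real.exp_pos _).le (hFn t))
  set k : Fin N → ℤ := fun n => ⌊T * Real.log (lam n)⌋ with hk
  have step2 : ∫ t, Real.exp (-(1/T^2) * t^2) * F t ≤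
      16 * T * ∑ n, ∑ m, b n * b m * (1 / (1 + ((k n - k m : ℤ) : ℝ)^2)) := by
    rw [hGint]
    simp_rw [Finset.mul_sum]
    refine Finset.sum_le_sum fun n _ => Finset.sum_le_sum fun m _ => ?_
    have := aux_ker (T * Real.log (lam n)) (T * Real.log (lam m))
    rw [← mul_sub, ← Real.log_div (hl m).ne' (hl n).ne'] at this
    have h3 := mul_le_mul_of_nonneg_left this
      (mul_nonneg (mul_nonneg (hb n) (hb m)) hT.le)
    calc _ = _ := by ring
      _ ≤ _ := h3
      _ = _ := by rw [hk]; ring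
  have step3 := aux_schur b k (fun j => 1 / (1 + (j:ℝ)^2)) (fun j => by positivity)
    (fun j => by push_cast; rw [neg_sq]) aux_summable
  have step4 : ∑ n, ∑ m, (if k n = k m then b n * b m else 0) ≤ ∑ n, ∑ m,
            (if |Real.log (lam m / lam n)| ≤ 1/T then b n * b m else 0) := by
    refine Finset.sum_le_sum fun n _ => Finset.sum_le_sum fun m _ => ?_
    have hbb := mul_nonneg (hb n) (hb m)
    by_cases hnm : k n = k m
    · have := Int.abs_sub_lt_one_of_floor_eq_floor hnm.symm
      rw [← mul_sub, ← Real.log_div (hl m).ne' (hl n).ne', abs_mul, abs_of_pos hT] at this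
      have h5 : |Real.log (lam m / lam n)| ≤ 1/T := by
        rw [le_div_iff₀ hT]; linarith
      rw [if_pos hnm, if_pos h5]
    · rw [if_neg hnm]; split_ifs <;> simp [hbb]
  calc _ ≤ _ := step1
    _ ≤ Real.exp 1 * (16 * T * (H * ∑ n, ∑ m,
            (if |Real.log (lam m / lam n)| ≤ 1/T then b n * b m else 0))) := by
        gcongr
        refine step2.trans ?_
        gcongr
        refine step3.trans ?_
        gcongr
    _ = _ := by ring
end

section
/- For every real number a, ∫_{−∞}^{∞} (sin t / t)² · e^{iat} dt = π·max(0, 1 − |a|/2). In particular the integral vanishes for |a| ≥ 2 and equals π(1 − |a|/2) for |a| ≤ 2. -/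
open Complex

open MeasureTheory FourierTransform in
theorem fejer_tri_fourier (w : ℝ) (hw : w ≠ 0) :
    𝓕 (fun x : ℝ => ((max 0 (1 - |x|) : ℝ) : ℂ)) w
      = (((Real.sin (Real.pi * w) / (Real.pi * w)) ^ 2 : ℝ) : ℂ) := by
  rw [Real.fourier_eq']
  set c : ℂ := 2 * Real.pi * w * I with hc
  have hpi : (Real.pi : ℂ) ≠ 0 := by exact_mod_cast Real.pi_ne_zero
  have hwC : (w : ℂ) ≠ 0 := by exact_mod_cast hw
  have hc0 : c ≠ 0 := by simp [hc, hpi, hwC]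
  have h0 : (fun x : ℝ => cexp (((-2 * Real.pi * inner ℝ x w : ℝ) : ℂ) * I) •
      ((max 0 (1 - |x|) : ℝ) : ℂ)) =
      fun x : ℝ => cexp (-c * x) * ((max 0 (1 - |x|) : ℝ) : ℂ) := by
    ext x
    simp only [smul_eq_mul, hc]
    congr 2
    simp
    ring
  rw [h0]
  have hcont : Continuous (fun x : ℝ => cexp (-c * x) * ((max 0 (1 - |x|) : ℝ) : ℂ)) := by
    fun_prop
  have h1 : (∫ x : ℝ, cexp (-c * x) * ((max 0 (1 - |x|) : ℝ) : ℂ)) =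
      ∫ x in (-1:ℝ)..1, cexp (-c * x) * ((max 0 (1 - |x|) : ℝ) : ℂ) := by
    rw [intervalIntegral.integral_of_le (by norm_num), setIntegral_eq_integral_of_forall_compl_eq_zero]
    intro x hx
    have : 1 - |x| ≤ 0 := by
      by_contra! h
      have := abs_lt.1 (show |x| < 1 by linarith)
      exact hx ⟨this.1, this.2.le⟩
    simp [max_eq_left this]
  rw [h1, ← intervalIntegral.integral_add_adjacent_intervals (b := 0)
    (hcont.intervalIntegrable _ _) (hcont.intervalIntegrable _ _)]
  have h2 : ∫ x in (-1:ℝ)..0, cexp (-c * x) * ((max 0 (1 - |x|) : ℝ) : ℂ) =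
      ∫ x in (-1:ℝ)..0, cexp (-c * x) * (1 + x) := by
    apply intervalIntegral.integral_congr
    intro x hx
    rw [Set.uIcc_of_le (by norm_num)] at hx
    simp only
    rw [abs_of_nonpos hx.2, max_eq_right (by linarith [hx.1])]
    push_cast; ring
  have h3 : ∫ x in (0:ℝ)..1, cexp (-c * x) * ((max 0 (1 - |x|) : ℝ) : ℂ) =
      ∫ x in (0:ℝ)..1, cexp (-c * x) * (1 - x) := by
    apply intervalIntegral.integral_congr
    intro x hx
    rw [Set.uIcc_of_le (by norm_num)] at hx
    simp only
    rw [abs_of_nonneg hx.1, max_eq_right (by linarith [hx.2])]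
    push_cast; ring
  have hid : ∀ x : ℝ, HasDerivAt (fun y : ℝ => (y : ℂ)) 1 x := fun x => Complex.ofRealCLM.hasDerivAt
  have hexp : ∀ x : ℝ, HasDerivAt (fun y : ℝ => cexp (-c * y)) (cexp (-c * x) * (-c)) x := by
    intro x
    simpa using ((hid x).const_mul (-c)).cexp
  rw [h2, h3]
  rw [intervalIntegral.integral_eq_sub_of_hasDerivAt
      (f := fun x : ℝ => cexp (-c * x) * (-(1 + x) / c - 1 / c ^ 2)),
    intervalIntegral.integral_eq_sub_of_hasDerivAt
      (f := fun x : ℝ => cexp (-c * x) * (-(1 - x) / c + 1 / c ^ 2))]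
  · have hs : c ^ 2 = -(4 * (Real.pi * w) ^ 2) := by
      rw [hc]; ring_nf; simp
    have he : cexp c + cexp (-c) = 2 - 4 * Complex.sin (Real.pi * w) ^ 2 := by
      have := Complex.two_cos (2 * (Real.pi * w))
      have h4 : c = 2 * (Real.pi * w) * I := by rw [hc]; ring
      rw [h4, ← neg_mul, ← this, Complex.cos_two_mul, Complex.cos_sq']
      ring
    have key : (((Real.sin (Real.pi * w) / (Real.pi * w)) ^ 2 : ℝ) : ℂ)
        = (cexp c + cexp (-c) - 2) / c ^ 2 := by
      rw [he, hs]
      push_cast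
      field_simp
      ring
    rw [key]
    simp
    field_simp
    ring
  · intro x _
    convert! (hexp x).mul ((((hid x).const_sub 1).neg.div_const c).add_const (1 / c ^ 2)) using 1
    simp only [Pi.neg_apply]
    field_simp
    ring
  · apply Continuous.intervalIntegrable; fun_prop
  · intro x _
    convert! (hexp x).mul ((((hid x).const_add 1).neg.div_const c).sub_const (1 / c ^ 2)) using 1
    simp only [Pi.neg_apply]
    field_simp
    ring
  · apply Continuous.intervalIntegrable; fun_prop

open MeasureTheory in
theorem fejer_integrable :
    Integrable (fun t : ℝ => (((Real.sin t / t) ^ 2 : ℝ) : ℂ)) := by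
  suffices h : Integrable (fun t : ℝ => (Real.sin t / t) ^ 2) from h.ofReal
  apply (integrable_inv_one_add_sq.const_mul 2).mono'
  · exact (by fun_prop : Measurable fun t : ℝ => (Real.sin t / t) ^ 2).aestronglyMeasurable
  · filter_upwards with t
    rw [Real.norm_of_nonneg (by positivity)]
    by_cases ht : t = 0
    · simp [ht]
    have h1 := Real.sin_sq_le_one t
    have h2 : Real.sin t ^ 2 ≤ t ^ 2 := sq_le_sq.2 Real.abs_sin_le_abs
    have ht2 : 0 < t ^ 2 := by positivity
    rw [div_pow, ← div_eq_mul_inv, div_le_div_iff₀ ht2 (by positivity)]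
    nlinarith

/-- Fejér kernel integral. For every real `a`,
`∫_{-∞}^{∞} (sin t / t)² e^{iat} dt = π·max(0, 1 - |a|/2)`, where `(sin t/t)²` is
extended by the value `1` at `t = 0`. -/
theorem fejer_kernel_fourier (a : ℝ) :
    (∫ t : ℝ, ((if t = 0 then (1:ℝ) else (Real.sin t / t)^2 : ℝ) : ℂ)
        * Complex.exp (Complex.I * a * t))
      = ((Real.pi * max 0 (1 - |a|/2) : ℝ) : ℂ) := by
  open MeasureTheory FourierTransform in
  have hne : ∀ᵐ t : ℝ, t ≠ 0 := by
    simp [ae_iff]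
  set f : ℝ → ℂ := fun x : ℝ => ((max 0 (1 - |x|) : ℝ) : ℂ) with hf
  have hfc : Continuous f := by rw [hf]; fun_prop
  have hfi : Integrable f := by
    apply hfc.integrable_of_hasCompactSupport
    apply HasCompactSupport.intro (isCompact_Icc (a := (-1:ℝ)) (b := 1))
    intro x hx
    have : 1 - |x| ≤ 0 := by
      by_contra! h
      have := abs_lt.1 (show |x| < 1 by linarith)
      exact hx ⟨this.1.le, this.2.le⟩
    simp [hf, max_eq_left this]
  have hae : 𝓕 f =ᵐ[volume] fun w : ℝ =>
      (((Real.sin (Real.pi * w) / (Real.pi * w)) ^ 2 : ℝ) : ℂ) := by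
    filter_upwards [hne] with w hw using fejer_tri_fourier w hw
  have hFi : Integrable (𝓕 f) :=
    (fejer_integrable.comp_mul_left' Real.pi_ne_zero).congr hae.symm
  have inv := congrFun (hfc.fourierInv_fourier_eq hfi hFi) (a / 2)
  rw [Real.fourierInv_eq'] at inv
  have h1 : (∫ t : ℝ, ((if t = 0 then (1:ℝ) else (Real.sin t / t)^2 : ℝ) : ℂ)
        * Complex.exp (Complex.I * a * t)) =
      ∫ t : ℝ, (((Real.sin t / t)^2 : ℝ) : ℂ) * Complex.exp (Complex.I * a * t) := by
    apply integral_congr_ae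
    filter_upwards [hne] with t ht
    rw [if_neg ht]
  have h2 := Measure.integral_comp_mul_left
    (fun t : ℝ => (((Real.sin t / t)^2 : ℝ) : ℂ) * Complex.exp (Complex.I * a * t)) Real.pi
  have h3 : f (a / 2) = ∫ w : ℝ, (((Real.sin (Real.pi * w) / (Real.pi * w))^2 : ℝ) : ℂ)
      * Complex.exp (Complex.I * a * (Real.pi * w : ℝ)) := by
    rw [← inv]
    apply integral_congr_ae
    filter_upwards [hae] with w hw
    rw [hw, smul_eq_mul, mul_comm]
    congr 2
    simp
    ring
  rw [h1]
  rw [← h3, abs_of_pos (inv_pos.2 Real.pi_pos)] at h2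
  have h4 : ((Real.pi * max 0 (1 - |a|/2) : ℝ) : ℂ) = Real.pi * f (a / 2) := by
    simp [hf, abs_div]
  rw [h4, h2, Complex.real_smul, ← mul_assoc, ← Complex.ofReal_mul,
    mul_inv_cancel₀ Real.pi_ne_zero]
  simp
end

section
/- Let n ≥ 1 be an integer, y > 0 a real number, and s ∈ ℂ with Re(s) > n/2. Then ∫_{ℝⁿ} ( y² + ‖x‖² )^{−s} dx = π^{n/2} · ( Γ(s − n/2) / Γ(s) ) · y^{n − 2s}, where the integral is over Euclidean space ℝⁿ with Lebesgue measure. -/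
open Complex

open MeasureTheory Set in
/-- For `n ≥ 1`, `y > 0` and `s ∈ ℂ` with `Re s > n/2`,
`∫_{ℝⁿ} (y² + ‖x‖²)^{-s} dx = π^{n/2} · Γ(s - n/2)/Γ(s) · y^{n-2s}`. -/
theorem integral_one_add_norm_sq_cpow (n : ℕ) (hn : 1 ≤ n) (y : ℝ) (hy : 0 < y)
    (s : ℂ) (hs : (n : ℝ)/2 < s.re) :
    (∫ x : EuclideanSpace ℝ (Fin n), ((y^2 + ‖x‖^2 : ℝ) : ℂ) ^ (-s))
      = ((Real.pi ^ ((n : ℝ)/2) : ℝ) : ℂ)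
          * (Complex.Gamma (s - (n : ℂ)/2) / Complex.Gamma s)
          * (y : ℂ) ^ ((n : ℂ) - 2 * s) := by
  have hn0 : (0 : ℝ) ≤ (n : ℝ) / 2 := by positivity
  have hs0 : 0 < s.re := lt_of_le_of_lt hn0 hs
  have hG : Complex.Gamma s ≠ 0 := Complex.Gamma_ne_zero_of_re_pos hs0
  have hy2 : 0 < y ^ 2 := by positivity
  let F : EuclideanSpace ℝ (Fin n) → ℝ → ℂ := fun x t =>
    ((t : ℂ) ^ (s - 1) * Complex.exp (-((y ^ 2 : ℝ) * t))) * cexp (-(t : ℂ) * (‖x‖ : ℂ) ^ 2)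
  have hF1 : ∀ x, ∫ t in Ioi (0 : ℝ), F x t
      = Complex.Gamma s * ((y^2 + ‖x‖^2 : ℝ) : ℂ) ^ (-s) := by
    intro x
    have hr : 0 < y ^ 2 + ‖x‖ ^ 2 := by positivity
    have h := Complex.integral_cpow_mul_exp_neg_mul_Ioi hs0 hr
    rw [one_div, ← ofReal_inv, ofReal_inv, inv_cpow _ _ (by
      rw [arg_ofReal_of_nonneg hr.le]; exact Real.pi_pos.ne), ← cpow_neg, mul_comm] at h
    rw [← h]
    refine setIntegral_congr_fun measurableSet_Ioi fun t _ => ?_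
    simp only [F]
    rw [mul_assoc, ← Complex.exp_add]
    congr 2
    push_cast
    ring
  have hF2 : ∀ t ∈ Ioi (0 : ℝ), ∫ x, F x t
      = ((Real.pi ^ ((n : ℝ)/2) : ℝ) : ℂ) *
        ((t : ℂ) ^ (s - (n : ℂ) / 2 - 1) * Complex.exp (-((y ^ 2 : ℝ) * t))) := by
    intro t ht
    have ht : 0 < t := ht
    have htc : (t : ℂ) ≠ 0 := by exact_mod_cast ht.ne'
    simp only [F]
    rw [integral_const_mul, GaussianFourier.integral_cexp_neg_mul_sq_norm (by simpa using ht)]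
    rw [finrank_euclideanSpace_fin, ← ofReal_div, div_eq_mul_inv Real.pi t, ofReal_mul,
      mul_cpow_ofReal_nonneg Real.pi_pos.le (by positivity), ofReal_inv, inv_cpow _ _ (by
      rw [arg_ofReal_of_nonneg ht.le]; exact Real.pi_pos.ne), ← cpow_neg,
      ofReal_cpow Real.pi_pos.le]
    rw [show s - (n : ℂ) / 2 - 1 = (s - 1) + (-((n : ℂ) / 2)) by ring, cpow_add _ _ htc]
    push_cast
    ring
  have hF3 : ∀ t ∈ Ioi (0 : ℝ), ∫ x, ‖F x t‖
      = (Real.pi ^ ((n : ℝ)/2)) *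
        (t ^ (s.re - (n : ℝ) / 2 - 1) * Real.exp (-(y ^ 2) * t ^ (1 : ℝ))) := by
    intro t ht
    have ht : 0 < t := ht
    have : ∀ x, ‖F x t‖ = (t ^ (s.re - 1) * Real.exp (-(y ^ 2) * t)) *
        Real.exp (-t * ‖x‖ ^ 2) := by
      intro x
      simp only [F]
      rw [norm_mul, norm_mul, norm_cpow_eq_rpow_re_of_pos ht, Complex.norm_exp, Complex.norm_exp]
      congr 3
      · rw [← ofReal_mul, ← ofReal_neg, ofReal_re]; ring
      · rw [← ofReal_neg, ← ofReal_pow, ← ofReal_mul, ofReal_re]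
    simp only [this]
    rw [integral_const_mul, GaussianFourier.integral_rexp_neg_mul_sq_norm ht,
      finrank_euclideanSpace_fin, Real.div_rpow Real.pi_pos.le ht.le,
      show s.re - (n : ℝ) / 2 - 1 = (s.re - 1) - (n : ℝ) / 2 by ring, Real.rpow_sub ht _ ((n : ℝ) / 2),
      Real.rpow_one]
    ring
  have hmeas : AEStronglyMeasurable (Function.uncurry F)
      ((volume : Measure (EuclideanSpace ℝ (Fin n))).prod (volume.restrict (Ioi (0 : ℝ)))) := by
    apply Measurable.aestronglyMeasurable
    simp only [F, Function.uncurry_def]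
    fun_prop
  have hint : Integrable (Function.uncurry F)
      ((volume : Measure (EuclideanSpace ℝ (Fin n))).prod (volume.restrict (Ioi (0 : ℝ)))) := by
    rw [integrable_prod_iff' hmeas]
    constructor
    · filter_upwards [self_mem_ae_restrict measurableSet_Ioi] with t ht
      have ht : 0 < t := ht
      simp only [F, Function.uncurry_def]
      apply Integrable.const_mul
      simpa using GaussianFourier.integrable_cexp_neg_mul_sq_norm_add
        (V := EuclideanSpace ℝ (Fin n)) (b := (t : ℂ)) (by simpa using ht) 0 0
    · have h := (integrableOn_rpow_mul_exp_neg_mul_rpow (p := 1) (s := s.re - (n : ℝ) / 2 - 1)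
        (by linarith) one_pos hy2).const_mul (Real.pi ^ ((n : ℝ)/2))
      exact IntegrableOn.congr_fun h (fun t ht => (hF3 t ht).symm) measurableSet_Ioi
  have hsw := integral_integral_swap hint
  simp only [hF1] at hsw
  rw [setIntegral_congr_fun measurableSet_Ioi hF2, integral_const_mul, integral_const_mul,
    Complex.integral_cpow_mul_exp_neg_mul_Ioi (by simpa using hs) hy2] at hsw
  have hyp : (1 / ((y ^ 2 : ℝ) : ℂ)) ^ (s - (n : ℂ) / 2) = (y : ℂ) ^ ((n : ℂ) - 2 * s) := by
    rw [one_div, inv_cpow _ _ (by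
      rw [arg_ofReal_of_nonneg hy2.le]; exact Real.pi_pos.ne), ← cpow_neg, pow_two, ofReal_mul,
      mul_cpow_ofReal_nonneg hy.le hy.le, ← cpow_add _ _ (by exact_mod_cast hy.ne')]
    congr 1
    ring
  rw [hyp] at hsw
  apply mul_left_cancel₀ hG
  rw [hsw]
  field_simp
end
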